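/- Let r ≥ 1 and n₁,…,n_r ∈ ℤ_{≥0} with n₁ ≠ 1 and n_r ≠ 1 (entries equal to 1 are allowed in intermediate positions), and put w = n₁+⋯+n_r. Then the iterated integral defining B(n₁,…,n_r;τ) converges absolutely for every τ ∈ ℍ, and there exist complex numbers b_{i,j}, for 1−r ≤ i ≤ w and j ∈ ℤ_{≥0}, each lying in the ℚ-subalgebra of ℂ generated by all multiple zeta values together with 2πi and (2πi)^{−1}, such that for every τ ∈ ℍ: B(n₁,…,n_r;τ) = Σ_{j≥0} Σ_{i=1−r}^{w} b_{i,j} · τ^i · q^j, the series converging absolutely. -/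

import Mathlib

open scoped Real Nat
open Finset MeasureTheory

/-- The coefficients `f_n(ξ,τ)` of the expansion of the Kronecker function:
`f₀ = 2πi`, `f₁(ξ,τ) = π cot(πξ) − 2πi Σ_{m,p≥1}(e^{2πimξ} − e^{−2πimξ}) q^{mp}` and, for
`n ≥ 2`, `f_n(ξ,τ) = (2πi/(n−1)!)(Bₙ/n − Σ_{m,p≥1}(e^{2πimξ} + (−1)ⁿ e^{−2πimξ}) p^{n−1} q^{mp})`
(Bernoulli numbers with `B₁ = −1/2`). -/
noncomputable def fKr : ℕ → ℂ → ℂ → ℂ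
  | 0, _, _ => 2 * ↑π * Complex.I
  | 1, ξ, τ =>
      ↑π * Complex.cot (↑π * ξ) -
        2 * ↑π * Complex.I *
          ∑' mp : ℕ × ℕ,
            (Complex.exp (2 * ↑π * Complex.I * ((mp.1 : ℂ) + 1) * ξ) -
                Complex.exp (-(2 * ↑π * Complex.I * ((mp.1 : ℂ) + 1) * ξ))) *
              Complex.exp (2 * ↑π * Complex.I * τ) ^ ((mp.1 + 1) * (mp.2 + 1))
  | (n + 2), ξ, τ =>
      (2 * ↑π * Complex.I / ((n + 1)! : ℂ)) *
        ((bernoulli (n + 2) : ℂ) / ((n : ℂ) + 2) -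
          ∑' mp : ℕ × ℕ,
            (Complex.exp (2 * ↑π * Complex.I * ((mp.1 : ℂ) + 1) * ξ) +
                (-1 : ℂ) ^ (n + 2) *
                  Complex.exp (-(2 * ↑π * Complex.I * ((mp.1 : ℂ) + 1) * ξ))) *
              ((mp.2 : ℂ) + 1) ^ (n + 1) *
              Complex.exp (2 * ↑π * Complex.I * τ) ^ ((mp.1 + 1) * (mp.2 + 1)))

/-- `ω_n(ξ,τ) = Σ_{k=0}^{n} ((Im ξ/Im τ)^k / k!) · f_{n−k}(ξ,τ)`. -/
noncomputable def omKr (n : ℕ) (ξ τ : ℂ) : ℂ :=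
  ∑ k ∈ Finset.range (n + 1),
    (((ξ.im / τ.im) ^ k / (k ! : ℝ) : ℝ) : ℂ) * fKr (n - k) ξ τ

/-- The open simplex `{1 > t₁ > ⋯ > t_r > 0}` in `(Fin r → ℝ)`. -/
def openSimplex (r : ℕ) : Set (Fin r → ℝ) :=
  {t | (∀ i, 0 < t i ∧ t i < 1) ∧ ∀ i j : Fin r, i < j → t j < t i}

/-- The A-elliptic multiple zeta value
`A(n₁,…,n_r;τ) = ∫_{1>t₁>⋯>t_r>0} f_{n₁}(t₁,τ)⋯f_{n_r}(t_r,τ) dt`. -/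
noncomputable def Aell {r : ℕ} (n : Fin r → ℕ) (τ : ℂ) : ℂ :=
  ∫ t in openSimplex r, ∏ i, fKr (n i) ((t i : ℝ) : ℂ) τ

/-- The B-elliptic multiple zeta value
`B(n₁,…,n_r;τ) = τ^{n₁+⋯+n_r} ∫_{1>t₁>⋯>t_r>0} ω_{n₁}(τt₁,τ)⋯ω_{n_r}(τt_r,τ) dt`. -/
noncomputable def Bell {r : ℕ} (n : Fin r → ℕ) (τ : ℂ) : ℂ :=
  τ ^ (∑ i, n i) * ∫ t in openSimplex r, ∏ i, omKr (n i) (τ * ((t i : ℝ) : ℂ)) τ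

/-- The multiple zeta value `ζ(k₁,…,k_s) = Σ_{0<v₁<⋯<v_s} v₁^{−k₁}⋯v_s^{−k_s}`. -/
noncomputable def mzv {s : ℕ} (k : Fin s → ℕ) : ℝ :=
  ∑' v : {v : Fin s → ℕ // (∀ i, 0 < v i) ∧ StrictMono v},
    ∏ i, (1 : ℝ) / (v.1 i : ℝ) ^ (k i)

/-- `x` is a multiple zeta value (convergent: `k_s ≥ 2`, all entries `≥ 1`). -/
def IsMZV (x : ℝ) : Prop :=
  ∃ (s : ℕ) (k : Fin (s + 1) → ℕ),
    (∀ i, 1 ≤ k i) ∧ 2 ≤ k (Fin.last s) ∧ x = mzv k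

/-- The `ℚ`-subalgebra of `ℂ` generated by all multiple zeta values together with `2πi` and
`(2πi)⁻¹`. -/
noncomputable def mzvTwoPiIAlgebra : Subalgebra ℚ ℂ :=
  Algebra.adjoin ℚ
    ((Complex.ofReal '' {x : ℝ | IsMZV x}) ∪
      {2 * ↑π * Complex.I, (2 * ↑π * Complex.I)⁻¹})


open Filter Topology

namespace EllMZV

/-- The nested harmonic sum `∑_{m > i₁ > i₂ > ⋯ ≥ 1} i₁^{-k₁} i₂^{-k₂} ⋯`. -/
noncomputable def hsum : List ℕ → ℕ → ℂ
  | [], _ => 1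
  | k :: l, m => ∑ i ∈ Finset.range m, hsum l i * ((i : ℂ)⁻¹) ^ k

lemma hsum_succ (k : ℕ) (l : List ℕ) (m : ℕ) :
    hsum (k :: l) (m + 1) = hsum (k :: l) m + hsum l m * ((m : ℂ)⁻¹) ^ k := by
  simp [hsum, Finset.sum_range_succ]

/-- `m ↦ (m - j)^{-1}`, with value `0` at `m = j`. -/
noncomputable def pole (j : ℤ) (m : ℕ) : ℂ := ((m : ℂ) - j)⁻¹

lemma pole_zero (m : ℕ) : pole 0 m = (m : ℂ)⁻¹ := by simp [pole]

lemma pole_succ (j : ℤ) (m : ℕ) : pole j (m + 1) = pole (j - 1) m := by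
  simp only [pole]; push_cast; congr 1; ring

/-- Sequences which agree eventually with a combination, over the algebra of multiple zeta values,
of products of nested harmonic sums of depth at most `d` with powers `(m - j)^{-b}`, `b ≥ b₀`. -/
inductive Harm (b₀ d : ℕ) : (ℕ → ℂ) → Prop
  | gen (l : List ℕ) (j : ℤ) (b : ℕ) (hl : l.length ≤ d) (h1 : ∀ k ∈ l, 1 ≤ k) (hb : b₀ ≤ b) :
      Harm b₀ d (fun m => hsum l m * pole j m ^ b)
  | zero : Harm b₀ d (fun _ => 0)
  | add {f g : ℕ → ℂ} : Harm b₀ d f → Harm b₀ d g → Harm b₀ d (fun m => f m + g m)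
  | smul {f : ℕ → ℂ} {a : ℂ} : a ∈ mzvTwoPiIAlgebra → Harm b₀ d f → Harm b₀ d (fun m => a * f m)
  | congr {f g : ℕ → ℂ} : Harm b₀ d f → f =ᶠ[atTop] g → Harm b₀ d g

lemma rat_mem (x : ℚ) : (x : ℂ) ∈ mzvTwoPiIAlgebra := by
  simpa using mzvTwoPiIAlgebra.algebraMap_mem x

lemma int_mem (x : ℤ) : (x : ℂ) ∈ mzvTwoPiIAlgebra := by simp

lemma inv_int_mem (x : ℤ) : (x : ℂ)⁻¹ ∈ mzvTwoPiIAlgebra := by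
  simpa using rat_mem (x : ℚ)⁻¹

namespace Harm

variable {b₀ d : ℕ} {f g : ℕ → ℂ}

lemma congr' (hf : Harm b₀ d f) (h : ∀ m, f m = g m) : Harm b₀ d g :=
  hf.congr (Eventually.of_forall h)

lemma mono {b₁ e : ℕ} (hb : b₁ ≤ b₀) (hd : d ≤ e) (hf : Harm b₀ d f) : Harm b₁ e f := by
  induction hf with
  | gen l j b hl h1 hb' => exact gen l j b (hl.trans hd) h1 (hb.trans hb')
  | zero => exact zero
  | add _ _ h1 h2 => exact add h1 h2
  | smul ha _ h => exact smul ha h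
  | congr _ he h => exact congr h he

lemma sub (hf : Harm b₀ d f) (hg : Harm b₀ d g) : Harm b₀ d (fun m => f m - g m) :=
  (hf.add (hg.smul (int_mem (-1)))).congr' fun m => by push_cast; ring

lemma const {a : ℂ} (ha : a ∈ mzvTwoPiIAlgebra) : Harm 0 d (fun _ => a) :=
  ((gen [] 0 0 (by simp) (by simp) le_rfl).smul ha).congr' fun m => by simp [hsum]

lemma eventually_mem (hf : Harm b₀ d f) : ∀ᶠ m in atTop, f m ∈ mzvTwoPiIAlgebra := by
  induction hf with
  | gen l j b hl h1 hb =>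
    refine Eventually.of_forall fun m => mul_mem ?_ (pow_mem ?_ _)
    · clear hl h1
      induction l generalizing m with
      | nil => simp [hsum]
      | cons k l ih =>
        refine sum_mem fun i _ => mul_mem (ih i) (pow_mem ?_ _)
        simpa using inv_int_mem i
    · simpa [pole] using inv_int_mem (m - j)
  | zero => exact Eventually.of_forall fun m => zero_mem _
  | add _ _ h1 h2 => filter_upwards [h1, h2] with m a b using add_mem a b
  | smul ha _ h => filter_upwards [h] with m b using mul_mem ha b
  | congr _ he h => filter_upwards [h, he] with m a b using b ▸ a

lemma pole_mul_pole {i j : ℤ} (hij : i ≠ j) :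
    ∀ᶠ m in atTop, pole i m * pole j m = ((i - j : ℤ) : ℂ)⁻¹ * (pole i m - pole j m) := by
  filter_upwards [eventually_gt_atTop (max i.toNat j.toNat)] with m hm
  have h1 : (m : ℂ) - i ≠ 0 := by
    rw [sub_ne_zero]; norm_cast; omega
  have h2 : (m : ℂ) - j ≠ 0 := by
    rw [sub_ne_zero]; norm_cast; omega
  have h3 : ((i : ℂ) - j) ≠ 0 := by
    rw [sub_ne_zero]; norm_cast
  simp only [pole]; push_cast; field_simp; ring

lemma partial_fractions (l : List ℕ) (hl : l.length ≤ d) (h1 : ∀ k ∈ l, 1 ≤ k) (i j : ℤ)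
    (N : ℕ) : ∀ b k : ℕ, b + k = N + 1 →
      Harm 1 d (fun m => hsum l m * pole i m ^ b * pole j m ^ k) := by
  by_cases hij : i = j
  · subst hij
    intro b k hbk
    refine (gen l i (b + k) hl h1 (by omega)).congr' fun m => by ring
  induction N with
  | zero =>
    intro b k hbk
    rcases b with _ | b
    · exact (gen l j k hl h1 (by omega)).congr' fun m => by simp
    · obtain rfl : k = 0 := by omega
      exact (gen l i (b + 1) hl h1 (by omega)).congr' fun m => by simp
  | succ N ih =>
    intro b k hbk
    rcases b with _ | b
    · exact (gen l j k hl h1 (by omega)).congr' fun m => by simp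
    rcases k with _ | k
    · exact (gen l i (b + 1) hl h1 (by omega)).congr' fun m => by simp
    refine (((ih (b + 1) k (by omega)).sub (ih b (k + 1) (by omega))).smul
      (inv_int_mem (i - j))).congr ?_
    filter_upwards [pole_mul_pole hij] with m hm
    linear_combination (-hsum l m * pole i m ^ b * pole j m ^ k) * hm

lemma mul_pole (hf : Harm b₀ d f) (j : ℤ) {k : ℕ} (hk : 1 ≤ k) :
    Harm 1 d (fun m => f m * pole j m ^ k) := by
  induction hf with
  | gen l i b hl h1 hb => exact partial_fractions l hl h1 i j (b + k - 1) b k (by omega)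
  | zero => exact zero.congr' (by simp)
  | add _ _ h1 h2 => exact (h1.add h2).congr' fun m => by ring
  | smul ha _ h => exact (h.smul ha).congr' fun m => by ring
  | congr _ he h => exact h.congr (he.mono fun m hm => by simp [hm])

lemma mul_pole' (hf : Harm 1 d f) (j : ℤ) (k : ℕ) : Harm 1 d (fun m => f m * pole j m ^ k) := by
  rcases k with _ | k
  · exact hf.congr' (by simp)
  · exact hf.mul_pole j (by omega)

lemma shift_forward (hb₀ : b₀ ≤ 1) (hf : Harm b₀ d f) : Harm b₀ d (fun m => f (m + 1)) := by
  induction hf with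
  | gen l j b hl h1 hb =>
    rcases l with _ | ⟨k, l⟩
    · exact (gen [] (j - 1) b hl h1 hb).congr' fun m => by simp [hsum, pole_succ]
    · have h2 : Harm 1 d (fun m => hsum l m * pole 0 m ^ k * pole (j - 1) m ^ b) := by
        refine mul_pole' ?_ _ _
        exact gen l 0 k (by simp at hl; omega) (fun k hk => h1 k (by simp [hk])) (h1 k (by simp))
      refine ((gen (k :: l) (j - 1) b hl h1 hb).add (h2.mono hb₀ le_rfl)).congr' fun m => ?_
      simp only [hsum_succ, pole_succ, pole_zero]; ring
  | zero => exact zero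
  | add _ _ h1 h2 => exact h1.add h2
  | smul ha _ h => exact h.smul ha
  | congr _ he h => exact h.congr ((tendsto_add_atTop_nat 1).eventually he)

lemma shift_back (hb₀ : b₀ ≤ 1) (hf : Harm b₀ d f) : Harm b₀ d (fun m => f (m - 1)) := by
  induction hf with
  | gen l j b hl h1 hb =>
    have key : ∀ m, 1 ≤ m → pole j (m - 1) = pole (j + 1) m := by
      intro m hm
      obtain ⟨m, rfl⟩ := Nat.exists_eq_add_of_le' hm
      rw [pole_succ]; simp
    suffices h : ∀ b₀, b₀ ≤ 1 → ∀ b, b₀ ≤ b →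
        Harm b₀ d (fun m => hsum l (m - 1) * pole (j + 1) m ^ b) by
      refine (h b₀ hb₀ b hb).congr ?_
      filter_upwards [eventually_ge_atTop 1] with m hm
      rw [key m hm]
    clear hb hb₀
    induction l with
    | nil => exact fun b₀ _ b hb => gen [] (j + 1) b hl h1 hb
    | cons k l ih =>
      intro b₀ hb₀ b hb
      have h2 := ih (by simp at hl; omega) (fun k hk => h1 k (by simp [hk])) 0 (by simp) b
        (by simp)
      have h3 := h2.mul_pole 1 (h1 k (by simp))
      refine ((gen (k :: l) (j + 1) b hl h1 hb).sub (h3.mono hb₀ le_rfl)).congr ?_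
      filter_upwards [eventually_ge_atTop 1] with m hm
      obtain ⟨m, rfl⟩ := Nat.exists_eq_add_of_le' hm
      rw [hsum_succ, pole_succ 1]
      simp only [Nat.add_sub_cancel, sub_self, pole_zero]
      ring
  | zero => exact zero
  | add _ _ h1 h2 => exact h1.add h2
  | smul ha _ h => exact h.smul ha
  | congr _ he h => exact h.congr ((tendsto_sub_atTop_nat 1).eventually he)

lemma shift_back_nat (hb₀ : b₀ ≤ 1) (hf : Harm b₀ d f) (M : ℕ) :
    Harm b₀ d (fun m => f (m - M)) := by
  induction M with
  | zero => exact hf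
  | succ M ih =>
    refine (shift_back hb₀ ih).congr' fun m => ?_
    congr 1; omega

end Harm

/-- Sequences whose partial sums are harmonic up to an additive constant. -/
def Summatory (d : ℕ) (f : ℕ → ℂ) : Prop :=
  ∃ c : ℂ, Harm 0 d (fun m => (∑ i ∈ Finset.range m, f i) + c)

namespace Summatory

variable {d : ℕ} {f g : ℕ → ℂ}

lemma congr (hf : Summatory d f) (h : f =ᶠ[atTop] g) : Summatory d g := by
  obtain ⟨c, hc⟩ := hf
  obtain ⟨N, hN⟩ := eventually_atTop.1 h
  refine ⟨c + ∑ i ∈ Finset.range N, (f i - g i), hc.congr ?_⟩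
  filter_upwards [eventually_ge_atTop N] with m hm
  have : ∑ i ∈ Finset.range m, (f i - g i) = ∑ i ∈ Finset.range N, (f i - g i) := by
    symm
    refine Finset.sum_subset (by simpa using hm) fun i _ hi => ?_
    rw [hN i (by simpa using hi), sub_self]
  rw [← this, Finset.sum_sub_distrib]; ring

lemma zero : Summatory d (fun _ => 0) := ⟨0, Harm.zero.congr' (by simp)⟩

lemma add (hf : Summatory d f) (hg : Summatory d g) : Summatory d (fun m => f m + g m) := by
  obtain ⟨c, hc⟩ := hf
  obtain ⟨e, he⟩ := hg
  exact ⟨c + e, (hc.add he).congr' fun m => by rw [Finset.sum_add_distrib]; ring⟩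

lemma smul {a : ℂ} (ha : a ∈ mzvTwoPiIAlgebra) (hf : Summatory d f) :
    Summatory d (fun m => a * f m) := by
  obtain ⟨c, hc⟩ := hf
  exact ⟨a * c, (hc.smul ha).congr' fun m => by rw [← Finset.mul_sum]; ring⟩

lemma sub (hf : Summatory d f) (hg : Summatory d g) : Summatory d (fun m => f m - g m) :=
  (hf.add (hg.smul (int_mem (-1)))).congr (.of_forall fun m => by push_cast; ring)

lemma shift_forward (hf : Summatory d f) : Summatory d (fun m => f (m + 1)) := by
  obtain ⟨c, hc⟩ := hf
  refine ⟨c + f 0, (hc.shift_forward (by simp)).congr' fun m => ?_⟩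
  rw [Finset.sum_range_succ']; ring

lemma of_shift_forward (hf : Summatory d (fun m => f (m + 1))) : Summatory d f := by
  obtain ⟨c, hc⟩ := hf
  refine ⟨c - f 0, (hc.shift_back (by simp)).congr ?_⟩
  filter_upwards [eventually_ge_atTop 1] with m hm
  obtain ⟨m, rfl⟩ := Nat.exists_eq_add_of_le' hm
  rw [Finset.sum_range_succ']; simp

lemma of_harm (hf : Harm 1 d f) : Summatory (d + 1) f := by
  induction d using Nat.strong_induction_on generalizing f with
  | _ d ih =>
  induction hf with
  | gen l j b hl h1 hb =>
    have step : ∀ j : ℤ, Summatory (d + 1) (fun m => hsum l (m + 1) * pole (j - 1) m ^ b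
        - hsum l m * pole (j - 1) m ^ b) := by
      intro j
      rcases l with _ | ⟨k, l⟩
      · exact zero.congr (.of_forall fun m => by simp [hsum])
      · simp only [List.length_cons] at hl
        have h2 : Harm 1 (d - 1) (fun m => hsum l m * pole 0 m ^ k * pole (j - 1) m ^ b) := by
          refine Harm.mul_pole' ?_ _ _
          exact Harm.gen l 0 k (by omega) (fun k hk => h1 k (by simp [hk])) (h1 k (by simp))
        obtain ⟨c, hc⟩ := ih (d - 1) (by omega) h2
        refine ⟨c, (hc.mono le_rfl (by omega)).congr' fun m => ?_⟩
        congr 1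
        refine Finset.sum_congr rfl fun i _ => ?_
        simp only [hsum_succ, pole_zero]; ring
    induction j using Int.induction_on with
    | zero =>
      refine ⟨0, (Harm.gen (b :: l) 0 0 (by simpa using hl) ?_ le_rfl).congr' fun m => ?_⟩
      · simp only [List.mem_cons, forall_eq_or_imp]; exact ⟨hb, h1⟩
      · simp [hsum, pole_zero]
    | succ i hi =>
      refine of_shift_forward (((step (i + 1)).add hi).congr (.of_forall fun m => ?_))
      simp [pole_succ]
    | pred i hi =>
      refine ((hi.shift_forward).sub (step (-i))).congr (.of_forall fun m => ?_)
      simp [pole_succ]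
  | zero => exact zero
  | add _ _ h1 h2 => exact h1.add h2
  | smul ha _ h => exact h.smul ha
  | congr _ he h => exact h.congr he

end Summatory

lemma Harm.sum_range {d : ℕ} {f : ℕ → ℂ} (hf : Harm 1 d f) (hm : ∀ m, f m ∈ mzvTwoPiIAlgebra) :
    Harm 0 (d + 1) (fun m => ∑ i ∈ Finset.range m, f i) := by
  obtain ⟨c, hc⟩ := Summatory.of_harm hf
  obtain ⟨m, hm'⟩ := hc.eventually_mem.exists
  have hcm : c ∈ mzvTwoPiIAlgebra := by
    have := sub_mem hm' (sum_mem fun i (_ : i ∈ Finset.range m) => hm i)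
    simpa using this
  exact (hc.sub (Harm.const hcm)).congr' fun m => by ring

end EllMZV

namespace EllMZV

/-! ### Sums of powers of `√(i + 1)` -/

/-- The weight `√(m + 1)` used to measure decay of sequences. -/
noncomputable def wt (m : ℕ) : ℝ := √(m + 1)

lemma wt_pos (m : ℕ) : 0 < wt m := Real.sqrt_pos.2 (by positivity)

lemma wt_sq (m : ℕ) : wt m ^ 2 = m + 1 := Real.sq_sqrt (by positivity)

lemma one_le_wt (m : ℕ) : 1 ≤ wt m := Real.one_le_sqrt.2 (by simp)

lemma wt_mono : Monotone wt := fun a b h => Real.sqrt_le_sqrt (by simpa using h)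

lemma sum_inv_wt_le (m : ℕ) : ∑ i ∈ Finset.range m, (wt i)⁻¹ ≤ 4 * wt m := by
  induction m with
  | zero => simpa using (wt_pos 0).le
  | succ m ih =>
    rw [Finset.sum_range_succ]
    have h1 := wt_sq m
    have h2 := wt_sq (m + 1)
    have h3 := wt_mono (Nat.le_succ m)
    have h4 := wt_pos m
    have h6 := wt_pos (m + 1)
    push_cast at h2
    simp only [Nat.succ_eq_add_one] at h3
    have h7 : wt (m + 1) ≤ 2 * wt m := by
      refine le_of_sq_le_sq ?_ (by positivity)
      rw [mul_pow, h1, h2]; linarith [(Nat.cast_nonneg m : (0 : ℝ) ≤ m)]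
    have h9 : (wt m)⁻¹ ≤ 4 * (wt (m + 1) - wt m) := by
      rw [inv_le_iff_one_le_mul₀ h4]
      have : (wt (m + 1) - wt m) * (wt (m + 1) + wt m) = 1 := by nlinarith
      nlinarith [mul_nonneg (sub_nonneg.2 h3) (sub_nonneg.2 h7)]
    linarith

lemma inv_wt_pow_three_le (i : ℕ) : (wt i ^ 3)⁻¹ ≤ 4 * ((wt i)⁻¹ - (wt (i + 1))⁻¹) := by
  have h1 := wt_sq i
  have h2 := wt_sq (i + 1)
  have h3 := wt_mono (Nat.le_succ i)
  have h4 := wt_pos i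
  have h6 := wt_pos (i + 1)
  push_cast at h2
  simp only [Nat.succ_eq_add_one] at h3
  have h7 : (wt (i + 1) - wt i) * (wt (i + 1) + wt i) = 1 := by nlinarith
  have h8 : 0 < wt (i + 1) - wt i := by
    by_contra h
    nlinarith
  rw [inv_sub_inv h4.ne' h6.ne', inv_eq_one_div, mul_div_assoc', div_le_div_iff₀ (by positivity)
    (by positivity)]
  have h9 : wt (i + 1) * (wt (i + 1) + wt i) ≤ 4 * wt i ^ 2 := by
    have : wt (i + 1) ^ 2 ≤ 2 * wt i ^ 2 := by
      rw [h1, h2]; linarith [(Nat.cast_nonneg i : (0 : ℝ) ≤ i)]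
    nlinarith
  have := mul_le_mul_of_nonneg_left h9 (mul_pos h8 h4).le
  nlinarith

lemma summable_inv_wt : Summable fun i => (wt i ^ 3)⁻¹ := by
  refine summable_of_sum_range_le (c := 4) (fun i => by have := wt_pos i; positivity) fun n => ?_
  calc _ ≤ ∑ i ∈ Finset.range n, 4 * ((wt i)⁻¹ - (wt (i + 1))⁻¹) :=
        Finset.sum_le_sum fun i _ => inv_wt_pow_three_le i
    _ = 4 * ((wt 0)⁻¹ - (wt n)⁻¹) := by rw [← Finset.mul_sum, Finset.sum_range_sub']
    _ ≤ 4 := by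
      have := inv_pos.2 (wt_pos n)
      have h0 : wt 0 = 1 := by simp [wt]
      rw [h0]; linarith

lemma tsum_tail_inv_wt_le (m : ℕ) : ∑' i, (wt (i + m) ^ 3)⁻¹ ≤ 4 * (wt m)⁻¹ := by
  refine Real.tsum_le_of_sum_range_le (fun i => by have := wt_pos (i + m); positivity) fun n => ?_
  calc _ ≤ ∑ i ∈ Finset.range n, 4 * ((wt (i + m))⁻¹ - (wt (i + 1 + m))⁻¹) :=
        Finset.sum_le_sum fun i _ => by
          simpa [add_right_comm] using inv_wt_pow_three_le (i + m)
    _ = 4 * ((wt (0 + m))⁻¹ - (wt (n + m))⁻¹) := by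
        rw [← Finset.mul_sum, Finset.sum_range_sub' (fun i => (wt (i + m))⁻¹)]
    _ ≤ _ := by
      have := inv_pos.2 (wt_pos (n + m))
      rw [zero_add]; linarith

lemma summable_of_wt {f : ℕ → ℂ} {C : ℝ} (h : ∀ i, ‖f i‖ ≤ C * (wt i ^ 3)⁻¹) :
    Summable f :=
  .of_norm_bounded (summable_inv_wt.mul_left C) h

lemma norm_tsum_sub_sum_range_le {f : ℕ → ℂ} {C : ℝ} (h : ∀ i, ‖f i‖ ≤ C * (wt i ^ 3)⁻¹) (m : ℕ) :
    ‖∑' i, f i - ∑ i ∈ Finset.range m, f i‖ ≤ 4 * C * (wt m)⁻¹ := by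
  have hC : 0 ≤ C := by
    have := (norm_nonneg _).trans (h 0)
    exact nonneg_of_mul_nonneg_left this (by have := wt_pos 0; positivity)
  have hs := (summable_of_wt h)
  rw [← hs.sum_add_tsum_nat_add m, add_sub_cancel_left]
  refine (tsum_of_norm_bounded ((summable_nat_add_iff m).2
    (summable_inv_wt.mul_left C)).hasSum fun i => h _).trans ?_
  rw [tsum_mul_left]
  nlinarith [tsum_tail_inv_wt_le m]

/-! ### Asymptotics of nested harmonic sums -/

/-- The real harmonic number `∑_{0 < i < m} 1 / i`. -/
noncomputable def hreal (m : ℕ) : ℝ := ∑ i ∈ Finset.range m, (i : ℝ)⁻¹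

lemma hsum_one (m : ℕ) : hsum [1] m = (hreal m : ℂ) := by simp [hsum, hreal]

lemma hreal_nonneg (m : ℕ) : 0 ≤ hreal m := Finset.sum_nonneg fun i _ => by positivity

lemma hreal_mono : Monotone hreal := fun a b h =>
  Finset.sum_le_sum_of_subset_of_nonneg (by simpa using h) fun i _ _ => by positivity

lemma hreal_succ (m : ℕ) : hreal (m + 1) = (harmonic m : ℝ) := by
  simp [hreal, harmonic, Finset.sum_range_succ']

lemma hreal_tendsto : Tendsto hreal atTop atTop := by
  rw [← tendsto_add_atTop_iff_nat 1]
  refine (tendsto_atTop_mono (fun n => log_add_one_le_harmonic n) ?_).congr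
    fun m => (hreal_succ m).symm
  exact Real.tendsto_log_atTop.comp
    ((tendsto_natCast_atTop_atTop (R := ℝ)).comp (tendsto_add_atTop_nat 1)) |>.congr
      fun m => by simp

lemma hreal_pow_le (N : ℕ) : ∃ C : ℝ, 0 ≤ C ∧ ∀ m, hreal m ^ N ≤ C * ((m : ℝ) + 1) ^ (1 / 4 : ℝ) := by
  rcases Nat.eq_zero_or_pos N with rfl | hN
  · refine ⟨1, zero_le_one, fun m => ?_⟩
    rw [pow_zero, one_mul]
    exact Real.one_le_rpow (by linarith [(Nat.cast_nonneg m : (0 : ℝ) ≤ m)]) (by norm_num)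
  have hN' : (0 : ℝ) < N := by exact_mod_cast hN
  set ε : ℝ := 1 / (4 * N) with hε
  have hε0 : 0 < ε := by positivity
  refine ⟨(1 + 1 / ε) ^ N, by positivity, fun m => ?_⟩
  have h0 : (1 : ℝ) ≤ (m : ℝ) + 1 := by linarith [(Nat.cast_nonneg m : (0 : ℝ) ≤ m)]
  have h1 : hreal m ≤ (1 + 1 / ε) * ((m : ℝ) + 1) ^ ε := by
    calc hreal m ≤ hreal (m + 1) := hreal_mono (Nat.le_succ m)
      _ = (harmonic m : ℝ) := hreal_succ m
      _ ≤ 1 + Real.log m := harmonic_le_one_add_log m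
      _ ≤ 1 + Real.log (m + 1) := by
        rcases Nat.eq_zero_or_pos m with rfl | hm
        · simp
        · have : (0 : ℝ) < m := by exact_mod_cast hm
          gcongr; linarith
      _ ≤ 1 * ((m : ℝ) + 1) ^ ε + ((m : ℝ) + 1) ^ ε / ε := by
        gcongr
        · rw [one_mul]; exact Real.one_le_rpow h0 hε0.le
        · exact Real.log_le_rpow_div (by linarith) hε0
      _ = _ := by ring
  calc hreal m ^ N ≤ ((1 + 1 / ε) * ((m : ℝ) + 1) ^ ε) ^ N :=
        pow_le_pow_left₀ (hreal_nonneg m) h1 N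
    _ = _ := by
      rw [mul_pow, ← Real.rpow_natCast (_ ^ ε), ← Real.rpow_mul (by linarith)]
      congr 2
      rw [hε]; field_simp

lemma hreal_pow_div_wt (N : ℕ) : Tendsto (fun m => hreal m ^ N * (wt m)⁻¹) atTop (𝓝 0) := by
  obtain ⟨C, hC, h⟩ := hreal_pow_le N
  have h2 : Tendsto (fun m : ℕ => C * ((m : ℝ) + 1) ^ (-(1 / 4) : ℝ)) atTop (𝓝 0) := by
    rw [← mul_zero C]
    refine Tendsto.const_mul C ((tendsto_rpow_neg_atTop (by norm_num)).comp ?_)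
    exact tendsto_atTop_add_const_right _ _ (tendsto_natCast_atTop_atTop (R := ℝ))
  refine squeeze_zero (fun m => mul_nonneg (pow_nonneg (hreal_nonneg m) N)
    (inv_nonneg.2 (wt_pos m).le)) (fun m => ?_) h2
  have h0 : (0 : ℝ) < (m : ℝ) + 1 := by positivity
  calc _ ≤ C * ((m : ℝ) + 1) ^ (1 / 4 : ℝ) * (wt m)⁻¹ := by
        gcongr
        · exact inv_nonneg.2 (wt_pos m).le
        · exact h m
    _ = _ := by
      rw [wt, Real.sqrt_eq_rpow, ← Real.rpow_neg h0.le, mul_assoc, ← Real.rpow_add h0]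
      norm_num

lemma norm_hsum_le (l : List ℕ) (h1 : ∀ k ∈ l, 1 ≤ k) (m : ℕ) :
    ‖hsum l m‖ ≤ hreal m ^ l.length := by
  induction l generalizing m with
  | nil => simp [hsum]
  | cons k l ih =>
    rw [hsum, List.length_cons, pow_succ]
    refine (norm_sum_le _ _).trans ?_
    rw [hreal, Finset.mul_sum]
    refine Finset.sum_le_sum fun i hi => ?_
    rw [norm_mul, norm_pow, norm_inv, Complex.norm_natCast]
    have hk : ((i : ℝ)⁻¹) ^ k ≤ (i : ℝ)⁻¹ := by
      have hk1 : k ≠ 0 := by have := h1 k (by simp); omega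
      exact pow_le_of_le_one (by positivity) (Nat.cast_inv_le_one i) hk1
    gcongr
    refine (ih (fun k hk => h1 k (by simp [hk])) i).trans ?_
    exact pow_le_pow_left₀ (hreal_nonneg i) (hreal_mono (Finset.mem_range.1 hi).le) _

/-- Sequences with an asymptotic expansion in powers of the harmonic numbers, whose coefficients
lie in the algebra of multiple zeta values. -/
def Asymp (f : ℕ → ℂ) : Prop :=
  ∃ p : Polynomial ℂ, (∀ k, p.coeff k ∈ mzvTwoPiIAlgebra) ∧
    ∀ i : ℕ, Tendsto (fun m => (f m - p.eval (hreal m : ℂ)) * (hreal m : ℂ) ^ i) atTop (𝓝 0)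

namespace Asymp

variable {f g : ℕ → ℂ}

lemma zero : Asymp (fun _ => 0) := ⟨0, by simp, by simp⟩

lemma add (hf : Asymp f) (hg : Asymp g) : Asymp (fun m => f m + g m) := by
  obtain ⟨p, hp, h⟩ := hf
  obtain ⟨p', hp', h'⟩ := hg
  refine ⟨p + p', fun k => by simpa using add_mem (hp k) (hp' k), fun i => ?_⟩
  have := (h i).add (h' i)
  rw [add_zero] at this
  refine this.congr fun m => ?_
  rw [Polynomial.eval_add]; ring

lemma smul {a : ℂ} (ha : a ∈ mzvTwoPiIAlgebra) (hf : Asymp f) : Asymp (fun m => a * f m) := by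
  obtain ⟨p, hp, h⟩ := hf
  refine ⟨Polynomial.C a * p, fun k => by simpa using mul_mem ha (hp k), fun i => ?_⟩
  have := (h i).const_mul a
  rw [mul_zero] at this
  refine this.congr fun m => ?_
  rw [Polynomial.eval_mul, Polynomial.eval_C]; ring

lemma congr (hf : Asymp f) (he : f =ᶠ[atTop] g) : Asymp g := by
  obtain ⟨p, hp, h⟩ := hf
  exact ⟨p, hp, fun i => (h i).congr' (he.mono fun m hm => by simp [hm])⟩

lemma mul_hreal (hf : Asymp f) : Asymp (fun m => (hreal m : ℂ) * f m) := by
  obtain ⟨p, hp, h⟩ := hf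
  refine ⟨Polynomial.X * p, fun k => ?_, fun i => ?_⟩
  · rcases k with _ | k
    · simp
    · simpa using hp k
  · exact (h (i + 1)).congr fun m => by simp; ring

lemma of_norm_sub_le {z : ℂ} (hz : z ∈ mzvTwoPiIAlgebra) {C : ℝ} {N : ℕ}
    (h : ∀ᶠ m in atTop, ‖f m - z‖ ≤ C * hreal m ^ N * (wt m)⁻¹) : Asymp f := by
  refine ⟨Polynomial.C z, fun k => ?_, fun i => ?_⟩
  · rw [Polynomial.coeff_C]; split_ifs; exacts [hz, zero_mem _]
  · refine squeeze_zero_norm' ?_ (by simpa using (hreal_pow_div_wt (N + i)).const_mul C)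
    filter_upwards [h] with m hm
    rw [norm_mul, norm_pow, Complex.norm_real, Real.norm_of_nonneg (hreal_nonneg m),
      Polynomial.eval_C, pow_add]
    have := pow_nonneg (hreal_nonneg m) i
    nlinarith [mul_le_mul_of_nonneg_right hm this]

lemma mem_of_tendsto (hf : Asymp f) {z : ℂ} (hz : Tendsto f atTop (𝓝 z)) :
    z ∈ mzvTwoPiIAlgebra := by
  obtain ⟨p, hp, h⟩ := hf
  have h1 : Tendsto (fun m => p.eval (hreal m : ℂ)) atTop (𝓝 z) := by
    simpa using (hz.sub (h 0)).congr fun m => by simp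
  have hdeg : ¬ 0 < p.degree := by
    intro hd
    have h2 := p.tendsto_norm_atTop hd (l := atTop) (z := fun m => (hreal m : ℂ)) (by
      refine hreal_tendsto.congr fun m => ?_
      rw [Complex.norm_real, Real.norm_of_nonneg (hreal_nonneg m)])
    exact not_tendsto_nhds_of_tendsto_atTop h2 _ h1.norm
  rw [not_lt, ← Polynomial.natDegree_eq_zero_iff_degree_le_zero] at hdeg
  rw [Polynomial.eq_C_of_natDegree_eq_zero hdeg] at h1
  simp only [Polynomial.eval_C] at h1
  exact (tendsto_nhds_unique tendsto_const_nhds h1 : p.coeff 0 = z) ▸ hp 0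

end Asymp

end EllMZV

namespace EllMZV

/-! ### Nested harmonic sums and multiple zeta values -/

/-- Strictly increasing tuples of positive integers below `m`. -/
def incr (s m : ℕ) : Finset (Fin s → ℕ) :=
  (Fintype.piFinset fun _ => Finset.range m).filter fun v => (∀ i, 0 < v i) ∧ StrictMono v

lemma mem_incr {s m : ℕ} {v : Fin s → ℕ} :
    v ∈ incr s m ↔ (∀ i, v i < m) ∧ (∀ i, 0 < v i) ∧ StrictMono v := by
  simp [incr]

lemma snoc_mem_incr {s m i : ℕ} {v : Fin s → ℕ} :
    (Fin.snoc v i : Fin (s + 1) → ℕ) ∈ incr (s + 1) m ↔ i < m ∧ 0 < i ∧ v ∈ incr s i := by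
  simp only [mem_incr, Fin.forall_fin_succ', Fin.snoc_castSucc, Fin.snoc_last]
  constructor
  · rintro ⟨⟨h1, h2⟩, ⟨h3, h4⟩, h5⟩
    refine ⟨h2, h4, fun j => ?_, h3, fun a b hab => ?_⟩
    · simpa using h5 (Fin.castSucc_lt_last j)
    · simpa using h5 (Fin.castSucc_lt_castSucc_iff.2 hab)
  · rintro ⟨h1, h2, h3, h4, h5⟩
    refine ⟨⟨fun j => (h3 j).trans h1, h1⟩, ⟨h4, h2⟩, fun a b hab => ?_⟩
    induction b using Fin.lastCases with
    | last =>
      induction a using Fin.lastCases with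
      | last => simp at hab
      | cast a => simpa using h3 a
    | cast b =>
      induction a using Fin.lastCases with
      | last => exact absurd (hab.trans (Fin.castSucc_lt_last b)) (lt_irrefl _)
      | cast a => simpa using h5 (Fin.castSucc_lt_castSucc_iff.1 hab)

lemma sum_incr_succ {s : ℕ} (m : ℕ) (F : (Fin (s + 1) → ℕ) → ℝ) :
    ∑ v ∈ incr (s + 1) m, F v = ∑ i ∈ Finset.Ico 1 m, ∑ v ∈ incr s i, F (Fin.snoc v i) := by
  rw [Finset.sum_sigma']
  refine Finset.sum_bij' (fun v _ => ⟨v (Fin.last s), Fin.init v⟩) (fun p _ => Fin.snoc p.2 p.1)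
    (fun v hv => ?_) (fun p hp => ?_) (fun v _ => by simp) (fun p _ => by simp) fun v _ => by simp
  · rw [← Fin.snoc_init_self v, snoc_mem_incr] at hv
    simp only [Finset.mem_sigma, Finset.mem_Ico]
    exact ⟨⟨hv.2.1, hv.1⟩, hv.2.2⟩
  · simp only [Finset.mem_sigma, Finset.mem_Ico] at hp
    exact snoc_mem_incr.2 ⟨hp.1.2, hp.1.1, hp.2⟩

lemma exists_hsum_eq (l : List ℕ) (h1 : ∀ k ∈ l, 1 ≤ k) : ∃ κ : Fin l.length → ℕ,
    (∀ i, 1 ≤ κ i) ∧ (∀ k ∈ l.head?, ∀ i : Fin l.length, (i : ℕ) + 1 = l.length → κ i = k) ∧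
      ∀ m, hsum l m = ((∑ v ∈ incr l.length m, ∏ i, (1 : ℝ) / (v i : ℝ) ^ κ i : ℝ) : ℂ) := by
  induction l with
  | nil =>
    refine ⟨Fin.elim0, fun i => i.elim0, by simp, fun m => ?_⟩
    have : incr 0 m = {Fin.elim0} := by
      ext v; simp [mem_incr, Subsingleton.elim v Fin.elim0, Subsingleton.strictMono]
    simp [hsum, this]
  | cons k l ih =>
    obtain ⟨κ, hκ, -, h⟩ := ih fun k hk => h1 k (by simp [hk])
    have hk := h1 k (by simp)
    refine ⟨Fin.snoc (α := fun _ => ℕ) κ k, fun i => ?_, fun a ha i hi => ?_, fun m => ?_⟩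
    · induction i using Fin.lastCases with
      | last => simpa using hk
      | cast i => simpa using hκ i
    · obtain rfl : i = Fin.last _ := Fin.ext (by simpa using hi)
      simpa using ha
    · rw [hsum]
      refine Eq.trans ?_ (congrArg _ (sum_incr_succ m _).symm)
      have h0 : ∑ i ∈ Finset.range m, hsum l i * ((i : ℂ)⁻¹) ^ k =
          ∑ i ∈ Finset.Ico 1 m, hsum l i * ((i : ℂ)⁻¹) ^ k := by
        symm
        refine Finset.sum_subset (fun i => by simp) fun i hi hi' => ?_
        obtain rfl : i = 0 := by
          simp only [Finset.mem_range, Finset.mem_Ico] at hi hi'; omega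
        simp [Nat.one_le_iff_ne_zero.1 hk]
      rw [h0, Complex.ofReal_sum]
      refine Finset.sum_congr rfl fun i _ => ?_
      rw [h i, ← Complex.ofReal_natCast, ← Complex.ofReal_inv, ← Complex.ofReal_pow,
        ← Complex.ofReal_mul, Finset.sum_mul]
      congr 1
      refine Finset.sum_congr rfl fun v _ => ?_
      refine Eq.trans ?_ (Fin.prod_univ_castSucc _).symm
      simp

lemma mzv_eq_of_tendsto {s : ℕ} (κ : Fin s → ℕ) {z : ℝ}
    (h : Tendsto (fun m => ∑ v ∈ incr s m, ∏ i, (1 : ℝ) / (v i : ℝ) ^ κ i) atTop (𝓝 z)) :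
    mzv κ = z := by
  set A : Set (Fin s → ℕ) := {v | (∀ i, 0 < v i) ∧ StrictMono v}
  set F : (Fin s → ℕ) → ℝ := A.indicator fun v => ∏ i, (1 : ℝ) / (v i : ℝ) ^ κ i
  have hF : 0 ≤ F := fun v => Set.indicator_nonneg (fun v _ => by positivity) v
  set B : ℕ → Finset (Fin s → ℕ) := fun m => Fintype.piFinset fun _ => Finset.range m
  have hB : Monotone B := fun a b hab v => by
    simp only [B, Fintype.mem_piFinset, Finset.mem_range]
    exact fun hv i => (hv i).trans_le hab
  have hB' : Tendsto B atTop atTop := by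
    refine tendsto_atTop_finset_of_monotone hB fun v => ⟨∑ i, v i + 1, ?_⟩
    simp only [B, Fintype.mem_piFinset, Finset.mem_range]
    exact fun i => Nat.lt_succ_of_le (Finset.single_le_sum (f := v) (by simp) (Finset.mem_univ i))
  have hsumB : ∀ m, ∑ v ∈ B m, F v = ∑ v ∈ incr s m, ∏ i, (1 : ℝ) / (v i : ℝ) ^ κ i := fun m => by
    rw [incr, Finset.sum_filter]
    refine Finset.sum_congr rfl fun v _ => ?_
    simp [F, Set.indicator_apply, A]
  have hz : Tendsto (fun m => ∑ v ∈ B m, F v) atTop (𝓝 z) := by simpa only [hsumB] using h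
  have hmono : Monotone fun m => ∑ v ∈ B m, F v := fun a b hab =>
    Finset.sum_le_sum_of_subset_of_nonneg (hB hab) fun v _ _ => hF v
  have hs : Summable F := by
    refine summable_of_sum_le hF (c := z) fun u => ?_
    obtain ⟨m, hm⟩ := (hB'.eventually_ge_atTop u).exists
    exact (Finset.sum_le_sum_of_subset_of_nonneg hm fun v _ _ => hF v).trans
      (hmono.ge_of_tendsto hz m)
  have := tendsto_nhds_unique (hs.hasSum.comp hB') hz
  rw [← this]
  exact tsum_subtype A fun v => ∏ i, (1 : ℝ) / (v i : ℝ) ^ κ i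

lemma hsum_bound (k : ℕ) (l : List ℕ) (h1 : ∀ a ∈ l, 1 ≤ a) (hk : 2 ≤ k) : ∃ C : ℝ,
    ∀ i, ‖hsum l i * ((i : ℂ)⁻¹) ^ k‖ ≤ C * (wt i ^ 3)⁻¹ := by
  obtain ⟨C, hC, h⟩ := hreal_pow_le l.length
  refine ⟨C * 4, fun i => ?_⟩
  have hw := wt_pos i
  rw [norm_mul, norm_pow, norm_inv, Complex.norm_natCast]
  have h2 : ((i : ℝ)⁻¹) ^ k ≤ 4 * (wt i ^ 4)⁻¹ := by
    refine (pow_le_pow_of_le_one (by positivity) (Nat.cast_inv_le_one i) hk).trans ?_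
    rw [show wt i ^ 4 = ((i : ℝ) + 1) ^ 2 by rw [← wt_sq]; ring]
    rcases Nat.eq_zero_or_pos i with rfl | hi
    · simp
    · have : (1 : ℝ) ≤ i := by exact_mod_cast hi
      rw [inv_pow, ← div_eq_mul_inv, inv_eq_one_div, div_le_div_iff₀ (by positivity) (by positivity)]
      nlinarith
  have h3 : ((i : ℝ) + 1) ^ (1 / 4 : ℝ) ≤ wt i := by
    rw [wt, Real.sqrt_eq_rpow]
    exact Real.rpow_le_rpow_of_exponent_le (by linarith [(Nat.cast_nonneg i : (0 : ℝ) ≤ i)])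
      (by norm_num)
  calc _ ≤ (C * wt i) * (4 * (wt i ^ 4)⁻¹) := by
        gcongr
        exact (norm_hsum_le l h1 i).trans ((h i).trans (by gcongr))
    _ = _ := by field_simp

lemma tendsto_hsum (k : ℕ) (l : List ℕ) (h1 : ∀ a ∈ l, 1 ≤ a) (hk : 2 ≤ k) :
    ∃ x : ℝ, IsMZV x ∧ Tendsto (hsum (k :: l)) atTop (𝓝 (x : ℂ)) := by
  obtain ⟨C, h⟩ := hsum_bound k l h1 hk
  have hlim : Tendsto (hsum (k :: l)) atTop (𝓝 _) := (summable_of_wt h).hasSum.tendsto_sum_nat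
  obtain ⟨κ, hκ, hlast, hκs⟩ := exists_hsum_eq (k :: l) (by
    simp only [List.mem_cons, forall_eq_or_imp]; exact ⟨by omega, h1⟩)
  have hre := (Complex.continuous_re.tendsto _).comp hlim
  have h3 := mzv_eq_of_tendsto κ (hre.congr fun m => by simp only [Function.comp, hκs,
    Complex.ofReal_re])
  refine ⟨_, ⟨l.length, κ, hκ, (hlast k rfl (Fin.last _) (by simp)).symm ▸ hk, rfl⟩, ?_⟩
  rw [h3]
  have h0 : (fun _ => (0 : ℝ)) = Complex.im ∘ hsum (k :: l) := by
    ext m; simp only [Function.comp, hκs, Complex.ofReal_im]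
  have him := tendsto_nhds_unique ((Complex.continuous_im.tendsto _).comp hlim)
    (h0 ▸ tendsto_const_nhds)
  convert hlim using 2
  exact Complex.ext (Complex.ofReal_re _) ((Complex.ofReal_im _).trans him.symm)

lemma asymp_hsum_cons (k : ℕ) (l : List ℕ) (h1 : ∀ a ∈ l, 1 ≤ a) (hk : 2 ≤ k) :
    Asymp (hsum (k :: l)) := by
  obtain ⟨C, h⟩ := hsum_bound k l h1 hk
  obtain ⟨x, hx, hlim⟩ := tendsto_hsum k l h1 hk
  have h2 := (summable_of_wt h).hasSum.tendsto_sum_nat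
  refine Asymp.of_norm_sub_le (z := (x : ℂ)) (Algebra.subset_adjoin (.inl ⟨x, hx, rfl⟩))
    (C := 4 * C) (N := 0) (.of_forall fun m => ?_)
  rw [tendsto_nhds_unique hlim h2, norm_sub_rev]
  simpa [hsum] using norm_tsum_sub_sum_range_le h m

/-! ### The quasi-shuffle product with a harmonic number -/

lemma hreal_mul_hsum_cons (k : ℕ) (l : List ℕ) (m : ℕ) :
    (hreal m : ℂ) * hsum (k :: l) m = hsum (1 :: k :: l) m + hsum ((k + 1) :: l) m +
      ∑ i ∈ Finset.range m, ((hreal i : ℂ) * hsum l i) * ((i : ℂ)⁻¹) ^ k := by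
  induction m with
  | zero => simp [hsum]
  | succ m ih =>
    have : (hreal (m + 1) : ℂ) = hreal m + (m : ℂ)⁻¹ := by simp [hreal, Finset.sum_range_succ]
    rw [hsum_succ, hsum_succ, hsum_succ, this, Finset.sum_range_succ]
    linear_combination ih

lemma cons_mem_closure {P P' : List ℕ → Prop} (k : ℕ) (h : ∀ l, P l → P' (k :: l)) {f : ℕ → ℂ}
    (hf : f ∈ AddSubmonoid.closure {g | ∃ l, P l ∧ g = hsum l}) :
    (fun m => ∑ i ∈ Finset.range m, f i * ((i : ℂ)⁻¹) ^ k) ∈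
      AddSubmonoid.closure {g | ∃ l, P' l ∧ g = hsum l} := by
  induction hf using AddSubmonoid.closure_induction with
  | mem f hf =>
    obtain ⟨l, hl, rfl⟩ := hf
    exact AddSubmonoid.subset_closure ⟨k :: l, h l hl, rfl⟩
  | zero => simpa only [Pi.zero_apply, zero_mul, Finset.sum_const_zero] using! zero_mem _
  | add f g _ _ hf hg =>
    convert add_mem hf hg using 1
    ext m
    simp [add_mul, Finset.sum_add_distrib]

lemma hreal_mul_hsum_mem (l : List ℕ) (h1 : ∀ k ∈ l, 1 ≤ k) :
    (fun m => (hreal m : ℂ) * hsum l m) ∈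
      AddSubmonoid.closure {g | ∃ l : List ℕ, (∀ k ∈ l, 1 ≤ k) ∧ g = hsum l} := by
  induction l with
  | nil =>
    refine AddSubmonoid.subset_closure ⟨[1], by simp, ?_⟩
    ext m; rw [hsum_one]; simp [hsum]
  | cons k l ih =>
    have hk := h1 k (by simp)
    have hl : ∀ k ∈ l, 1 ≤ k := fun k hk => h1 k (by simp [hk])
    have h2 := cons_mem_closure (P' := fun l => ∀ k ∈ l, 1 ≤ k) k
      (fun l hl a ha => (List.mem_cons.1 ha).elim (fun h => h ▸ hk) (hl a)) (ih hl)
    have h3 : hsum (1 :: k :: l) ∈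
        AddSubmonoid.closure {g | ∃ l : List ℕ, (∀ k ∈ l, 1 ≤ k) ∧ g = hsum l} := by
      refine AddSubmonoid.subset_closure ⟨_, ?_, rfl⟩
      simp only [List.mem_cons, forall_eq_or_imp]; exact ⟨le_rfl, hk, hl⟩
    have h4 : hsum ((k + 1) :: l) ∈
        AddSubmonoid.closure {g | ∃ l : List ℕ, (∀ k ∈ l, 1 ≤ k) ∧ g = hsum l} := by
      refine AddSubmonoid.subset_closure ⟨_, ?_, rfl⟩
      simp only [List.mem_cons, forall_eq_or_imp]; exact ⟨by omega, hl⟩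
    convert add_mem (add_mem h3 h4) h2 using 1
    ext m; exact hreal_mul_hsum_cons k l m

/-- Lists of positive integers with at most `a` leading ones. -/
def FewOnes (a : ℕ) (l : List ℕ) : Prop :=
  ∃ b ≤ a, ∃ t : List ℕ, (∀ k ∈ t, 1 ≤ k) ∧ (∀ k ∈ t.head?, 2 ≤ k) ∧ l = List.replicate b 1 ++ t

lemma hreal_mul_hsum_replicate (t : List ℕ) (ht : ∀ k ∈ t, 1 ≤ k) (ht' : ∀ k ∈ t.head?, 2 ≤ k)
    (a : ℕ) : ∃ E ∈ AddSubmonoid.closure {g | ∃ l, FewOnes a l ∧ g = hsum l},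
      ∀ m, (hreal m : ℂ) * hsum (List.replicate a 1 ++ t) m =
        (a + 1) * hsum (List.replicate (a + 1) 1 ++ t) m + E m := by
  induction a with
  | zero =>
    rcases t with _ | ⟨k, l⟩
    · refine ⟨0, zero_mem _, fun m => ?_⟩
      simp [hsum, hreal]
    · have hk : 2 ≤ k := ht' k (by simp)
      have hl : ∀ k ∈ l, 1 ≤ k := fun k hk => ht k (by simp [hk])
      have h2 := cons_mem_closure (P' := FewOnes 0) k (fun l hl => ⟨0, le_rfl, k :: l, by
        simp only [List.mem_cons, forall_eq_or_imp]; exact ⟨by omega, hl⟩, by simpa using hk,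
        by simp⟩) (hreal_mul_hsum_mem l hl)
      refine ⟨_, add_mem (AddSubmonoid.subset_closure ⟨(k + 1) :: l, ⟨0, le_rfl, (k + 1) :: l, by
        simp only [List.mem_cons, forall_eq_or_imp]; exact ⟨by omega, hl⟩, by simp; omega,
        by simp⟩, rfl⟩) h2, fun m => ?_⟩
      simp only [List.replicate_zero, List.nil_append, hreal_mul_hsum_cons, Pi.add_apply]
      simp [add_assoc]
  | succ a ih =>
    obtain ⟨E, hE, h⟩ := ih
    have h2 := cons_mem_closure (P' := FewOnes (a + 1)) 1 (fun l ⟨b, hb, t, h1, h2, h3⟩ =>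
      ⟨b + 1, by omega, t, h1, h2, by simp [h3, List.replicate_succ]⟩) hE
    refine ⟨_, add_mem (AddSubmonoid.subset_closure ⟨2 :: (List.replicate a 1 ++ t),
      ⟨0, by omega, _, ?_, by simp, rfl⟩, rfl⟩) h2, fun m => ?_⟩
    · simp only [List.mem_cons, List.mem_append, List.mem_replicate]
      rintro k (rfl | ⟨_, rfl⟩ | hk)
      exacts [by omega, le_rfl, ht k hk]
    · rw [List.replicate_succ, List.cons_append, hreal_mul_hsum_cons]
      simp only [h, Pi.add_apply, List.replicate_succ, List.cons_append, add_mul,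
        Finset.sum_add_distrib]
      have : ∀ l, hsum (1 :: l) m = ∑ i ∈ Finset.range m, hsum l i * ((i : ℂ)⁻¹) ^ 1 := fun _ => rfl
      rw [this (1 :: _)]
      simp only [mul_assoc, ← Finset.mul_sum]
      push_cast; ring

lemma asymp_of_fewOnes (a : ℕ) : ∀ l, FewOnes a l → Asymp (hsum l) := by
  induction a with
  | zero =>
    rintro _ ⟨b, hb, t, h1, h2, rfl⟩
    obtain rfl : b = 0 := by omega
    rcases t with _ | ⟨k, l⟩
    · refine Asymp.of_norm_sub_le (z := 1) (one_mem _) (C := 0) (N := 0) (.of_forall fun m => ?_)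
      simp [hsum]
    · exact asymp_hsum_cons k l (fun k hk => h1 k (by simp [hk])) (h2 k (by simp))
  | succ a ih =>
    rintro _ ⟨b, hb, t, h1, h2, rfl⟩
    rcases Nat.lt_or_ge a b with hab | hab
    swap
    · exact ih _ ⟨b, hab, t, h1, h2, rfl⟩
    obtain rfl : b = a + 1 := by omega
    obtain ⟨E, hE, h⟩ := hreal_mul_hsum_replicate t h1 h2 a
    have hE' : Asymp E := by
      clear h
      induction hE using AddSubmonoid.closure_induction with
      | mem f hf => obtain ⟨l, hl, rfl⟩ := hf; exact ih l hl
      | zero => exact Asymp.zero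
      | add f g _ _ hf hg => exact hf.add hg
    have h3 := ((ih _ ⟨a, le_rfl, t, h1, h2, rfl⟩).mul_hreal.add (hE'.smul (int_mem (-1)))).smul
      (inv_int_mem (a + 1))
    refine h3.congr (.of_forall fun m => ?_)
    have : (a : ℂ) + 1 ≠ 0 := by exact_mod_cast Nat.succ_ne_zero a
    simp only [h m]
    push_cast
    field_simp
    ring

lemma asymp_hsum (l : List ℕ) (h1 : ∀ k ∈ l, 1 ≤ k) : Asymp (hsum l) := by
  refine asymp_of_fewOnes l.length l ?_
  induction l with
  | nil => exact ⟨0, le_rfl, [], by simp, by simp, rfl⟩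
  | cons k l ih =>
    rcases Nat.lt_or_ge 1 k with hk | hk
    · exact ⟨0, by simp, k :: l, h1, by simp; omega, rfl⟩
    · obtain rfl : k = 1 := le_antisymm hk (h1 k (by simp))
      obtain ⟨b, hb, t, h3, h4, h5⟩ := ih fun k hk => h1 k (by simp [hk])
      exact ⟨b + 1, by simpa using hb, t, h3, h4, by simp [h5, List.replicate_succ]⟩

lemma norm_pole_le (j : ℤ) : ∀ᶠ m in atTop, ‖pole j m‖ ≤ (wt m)⁻¹ := by
  filter_upwards [eventually_ge_atTop (2 * j.natAbs + 4)] with m hm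
  have hj : (j : ℝ) ≤ j.natAbs := by
    rw [Nat.cast_natAbs, Int.cast_abs]; exact le_abs_self _
  have hm' : (2 * j.natAbs + 4 : ℝ) ≤ m := by exact_mod_cast hm
  have h1 : wt m ≤ m - j := by
    refine Real.sqrt_le_iff.2 ⟨by linarith [(Nat.cast_nonneg j.natAbs : (0 : ℝ) ≤ j.natAbs)], ?_⟩
    have : (m : ℝ) / 2 + 2 ≤ m - j := by linarith
    nlinarith
  have h2 : ((m : ℂ) - j) = ((m - j : ℝ) : ℂ) := by push_cast; rfl
  rw [pole, h2, norm_inv, Complex.norm_real]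
  exact inv_anti₀ (wt_pos m) (h1.trans (Real.le_norm_self _))

lemma Harm.asymp {d : ℕ} {f : ℕ → ℂ} (hf : Harm 0 d f) : Asymp f := by
  induction hf with
  | gen l j b hl h1 hb =>
    rcases b with _ | b
    · exact (asymp_hsum l h1).congr (.of_forall fun m => by simp)
    refine Asymp.of_norm_sub_le (zero_mem _) (C := 1) (N := l.length) ?_
    filter_upwards [norm_pole_le j] with m hm
    rw [sub_zero, norm_mul, norm_pow, one_mul]
    refine mul_le_mul (norm_hsum_le l h1 m) ?_ (by positivity) (pow_nonneg (hreal_nonneg m) _)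
    exact (pow_le_of_le_one (norm_nonneg _) (hm.trans (inv_le_one_of_one_le₀ (one_le_wt m)))
      (by omega)).trans hm
  | zero => exact Asymp.zero
  | add _ _ h1 h2 => exact h1.add h2
  | smul ha _ h => exact h.smul ha
  | congr _ he h => exact h.congr he

/-- Sums of harmonic sequences with values in the algebra stay in the algebra. -/
lemma Harm.tsum_mem {d : ℕ} {f : ℕ → ℂ} (hf : Harm 1 d f) (hm : ∀ m, f m ∈ mzvTwoPiIAlgebra)
    (hs : Summable f) : ∑' m, f m ∈ mzvTwoPiIAlgebra :=
  (hf.sum_range hm).asymp.mem_of_tendsto hs.hasSum.tendsto_sum_nat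

end EllMZV

namespace EllMZV

open Polynomial

/-! ### Polynomials in two variables -/

/-- The `ℓ¹`-seminorm on polynomials. -/
noncomputable def ell1 {A : Type*} [Ring A] (ν : RingSeminorm A) : RingSeminorm A[X] where
  toFun p := p.sum fun _ c => ν c
  map_zero' := by simp
  add_le' p q := by
    have h : ∀ (f : A[X]) (N : ℕ), f.natDegree < N → (f.sum fun _ c => ν c) =
        ∑ i ∈ Finset.range N, ν (f.coeff i) := fun f N hN =>
      Polynomial.sum_over_range' f (fun _ => map_zero ν) N hN
    set N := p.natDegree + q.natDegree + (p + q).natDegree + 1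
    rw [h p N (by omega), h q N (by omega), h (p + q) N (by omega), ← Finset.sum_add_distrib]
    exact Finset.sum_le_sum fun i _ => by rw [coeff_add]; exact map_add_le_add ν _ _
  neg' p := by simp [Polynomial.sum_def]
  mul_le' p q := by
    have hadd : ∀ f g : A[X], ((f + g).sum fun _ c => ν c) ≤
        (f.sum fun _ c => ν c) + g.sum fun _ c => ν c := fun p q => by
      have h : ∀ (f : A[X]) (N : ℕ), f.natDegree < N → (f.sum fun _ c => ν c) =
          ∑ i ∈ Finset.range N, ν (f.coeff i) := fun f N hN =>
        Polynomial.sum_over_range' f (fun _ => map_zero ν) N hN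
      set N := p.natDegree + q.natDegree + (p + q).natDegree + 1
      rw [h p N (by omega), h q N (by omega), h (p + q) N (by omega), ← Finset.sum_add_distrib]
      exact Finset.sum_le_sum fun i _ => by rw [coeff_add]; exact map_add_le_add ν _ _
    have hsum := fun s (g : ℕ → A[X]) => Finset.le_sum_of_subadditive
      (fun f : A[X] => f.sum fun _ c => ν c) (by simp) hadd s g
    rw [Polynomial.mul_eq_sum_sum]
    refine (hsum _ _).trans ?_
    rw [Polynomial.sum_def, Finset.sum_mul]
    refine Finset.sum_le_sum fun i _ => ?_
    simp only [Polynomial.sum_def q]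
    refine (hsum _ _).trans ?_
    rw [Finset.mul_sum]
    refine Finset.sum_le_sum fun j _ => ?_
    rw [Polynomial.sum_monomial_index _ _ (map_zero ν)]
    exact map_mul_le_mul ν _ _

section ell1

variable {A : Type*} [Ring A] (ν : RingSeminorm A)

lemma ell1_monomial (i : ℕ) (c : A) : ell1 ν (monomial i c) = ν c :=
  Polynomial.sum_monomial_index _ _ (map_zero ν)

lemma ell1_eq_sum (p : A[X]) {N : ℕ} (hN : p.natDegree ≤ N) :
    ell1 ν p = ∑ i ∈ Finset.range (N + 1), ν (p.coeff i) :=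
  Polynomial.sum_over_range' p (fun _ => map_zero ν) (N + 1) (by omega)

lemma seminorm_coeff_le (p : A[X]) (i : ℕ) : ν (p.coeff i) ≤ ell1 ν p := by
  rw [ell1_eq_sum ν p (le_max_left _ i)]
  exact Finset.single_le_sum (f := fun i => ν (p.coeff i)) (fun j _ => apply_nonneg ν _)
    (by simp)

lemma seminorm_sum_le {ι : Type*} (s : Finset ι) (f : ι → A) :
    ν (∑ i ∈ s, f i) ≤ ∑ i ∈ s, ν (f i) :=
  Finset.le_sum_of_subadditive ν (map_zero ν).le (map_add_le_add ν) s f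

end ell1

/-- Polynomials in `s` (outer variable) and `L` (inner variable). -/
abbrev LP := ℂ[X][X]

lemma normRingSeminorm_apply' (z : ℂ) : normRingSeminorm ℂ z = ‖z‖ := rfl

/-- The `ℓ¹`-norm on `ℂ[L]`. -/
noncomputable def nrm₁ : RingSeminorm ℂ[X] := ell1 (normRingSeminorm ℂ)

/-- The `ℓ¹`-norm on `ℂ[L][s]`. -/
noncomputable def nrm : RingSeminorm LP := ell1 nrm₁

lemma norm_coeff_le_nrm₁ (p : ℂ[X]) (b : ℕ) : ‖p.coeff b‖ ≤ nrm₁ p :=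
  seminorm_coeff_le (normRingSeminorm ℂ) p b

lemma nrm₁_coeff_le_nrm (p : LP) (a : ℕ) : nrm₁ (p.coeff a) ≤ nrm p :=
  seminorm_coeff_le nrm₁ p a

lemma nrm₁_smul (z : ℂ) (p : ℂ[X]) : nrm₁ (z • p) = ‖z‖ * nrm₁ p := by
  rw [nrm₁, ell1_eq_sum _ _ (natDegree_smul_le z p), ell1_eq_sum _ _ le_rfl, Finset.mul_sum]
  exact Finset.sum_congr rfl fun i _ => by
    rw [coeff_smul, smul_eq_mul, normRingSeminorm_apply', normRingSeminorm_apply', norm_mul]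

lemma nrm_smul (z : ℂ) (p : LP) : nrm (z • p) = ‖z‖ * nrm p := by
  rw [nrm, ell1_eq_sum _ _ (natDegree_smul_le z p), ell1_eq_sum _ _ le_rfl, Finset.mul_sum]
  exact Finset.sum_congr rfl fun i _ => by rw [coeff_smul, nrm₁_smul]

lemma nrm_C (p : ℂ[X]) : nrm (C p) = nrm₁ p := by
  rw [← monomial_zero_left, nrm, ell1_monomial]

lemma nrm₁_one : nrm₁ 1 = 1 := by
  rw [← C_1, ← monomial_zero_left, nrm₁, ell1_monomial, normRingSeminorm_apply', norm_one]

lemma nrm₁_X : nrm₁ X = 1 := by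
  rw [← monomial_one_one_eq_X, nrm₁, ell1_monomial, normRingSeminorm_apply', norm_one]

lemma nrm_X : nrm X = 1 := by
  rw [← monomial_one_one_eq_X, nrm, ell1_monomial, nrm₁_one]

lemma nrm_one : nrm 1 = 1 := by rw [← C_1, nrm_C, nrm₁_one]

lemma nrm_pow_le (p : LP) (k : ℕ) : nrm (p ^ k) ≤ nrm p ^ k := by
  induction k with
  | zero => simp [nrm_one]
  | succ k ih =>
    rw [pow_succ, pow_succ]
    exact (map_mul_le_mul nrm _ _).trans (mul_le_mul_of_nonneg_right ih (apply_nonneg _ _))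

/-- Total degree at most `N`. -/
def TD (N : ℕ) (p : LP) : Prop := ∀ a b, N < a + b → (p.coeff a).coeff b = 0

namespace TD

variable {N M : ℕ} {p q : LP}

lemma mono (h : N ≤ M) (hp : TD N p) : TD M p := fun a b hab => hp a b (h.trans_lt hab)

lemma zero : TD N 0 := fun a b _ => by simp

lemma add (hp : TD N p) (hq : TD N q) : TD N (p + q) := fun a b hab => by
  simp [hp a b hab, hq a b hab]

lemma smul (z : ℂ) (hp : TD N p) : TD N (z • p) := fun a b hab => by simp [hp a b hab]

lemma neg (hp : TD N p) : TD N (-p) := fun a b hab => by simp [hp a b hab]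

lemma sum {ι : Type*} (s : Finset ι) {f : ι → LP} (h : ∀ i ∈ s, TD N (f i)) :
    TD N (∑ i ∈ s, f i) :=
  Finset.sum_induction f (TD N) (fun _ _ => add) zero h

lemma mul (hp : TD N p) (hq : TD M q) : TD (N + M) (p * q) := fun a b hab => by
  rw [coeff_mul, finsetSum_coeff]
  refine Finset.sum_eq_zero fun i hi => ?_
  rw [coeff_mul]
  refine Finset.sum_eq_zero fun j hj => ?_
  simp only [Finset.HasAntidiagonal.mem_antidiagonal] at hi hj
  by_cases h : N < i.1 + j.1
  · rw [hp _ _ h, zero_mul]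
  · rw [hq _ _ (by omega), mul_zero]

lemma one : TD 0 1 := fun a b hab => by
  rw [coeff_one]
  split_ifs with h
  · rw [coeff_one, if_neg (by omega)]
  · simp

lemma pow (hp : TD N p) (k : ℕ) : TD (k * N) (p ^ k) := by
  induction k with
  | zero => simpa using one
  | succ k ih => rw [pow_succ, add_mul, one_mul]; exact ih.mul hp

lemma X : TD 1 (X : LP) := fun a b hab => by
  rw [coeff_X]
  split_ifs with h
  · rw [coeff_one, if_neg (by omega)]
  · simp

lemma C_X : TD 1 (C Polynomial.X : LP) := fun a b hab => by
  rw [coeff_C]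
  split_ifs with h
  · rw [coeff_X, if_neg (by omega)]
  · simp

lemma derivative (hp : TD N p) : TD N (derivative p) := fun a b hab => by
  rw [coeff_derivative, ← Nat.cast_succ, ← C_eq_natCast, coeff_mul_C, hp _ _ (by omega), zero_mul]

lemma iterate_derivative (hp : TD N p) (j : ℕ) : TD N (Polynomial.derivative^[j] p) := by
  induction j with
  | zero => exact hp
  | succ j ih => rw [Function.iterate_succ_apply']; exact ih.derivative

lemma natDegree_le (hp : TD N p) : p.natDegree ≤ N :=
  natDegree_le_iff_coeff_eq_zero.2 fun a ha => by
    ext b; simpa using hp a b (by omega)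

lemma nrm_derivative_le (hp : TD N p) : nrm (Polynomial.derivative p) ≤ N * nrm p := by
  have h0 : p.natDegree ≤ N + 1 := hp.natDegree_le.trans (Nat.le_succ N)
  rw [nrm, ell1_eq_sum _ _ hp.derivative.natDegree_le, ell1_eq_sum _ _ h0,
    Finset.sum_range_succ' _ (N + 1), mul_add, Finset.mul_sum]
  refine le_add_of_le_of_nonneg (Finset.sum_le_sum fun i hi => ?_)
    (mul_nonneg (Nat.cast_nonneg _) (apply_nonneg _ _))
  have : (Polynomial.derivative p).coeff i = ((i : ℂ) + 1) • p.coeff (i + 1) := by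
    rw [coeff_derivative, smul_eq_C_mul, mul_comm]; simp
  rw [this, nrm₁_smul]
  rcases Nat.lt_or_ge i N with h | h
  · refine mul_le_mul_of_nonneg_right ?_ (apply_nonneg _ _)
    have : ‖(i : ℂ) + 1‖ = i + 1 := by
      rw [← Nat.cast_succ, Complex.norm_natCast]; simp
    rw [this]; exact_mod_cast h
  · have : p.coeff (i + 1) = 0 := by ext b; simpa using hp (i + 1) b (by omega)
    simp [this]

lemma nrm_iterate_derivative_le (hp : TD N p) (j : ℕ) :
    nrm (Polynomial.derivative^[j] p) ≤ (N : ℝ) ^ j * nrm p := by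
  induction j with
  | zero => simp
  | succ j ih =>
    rw [Function.iterate_succ_apply']
    calc _ ≤ N * nrm (Polynomial.derivative^[j] p) := (hp.iterate_derivative j).nrm_derivative_le
      _ ≤ N * ((N : ℝ) ^ j * nrm p) := by gcongr
      _ = _ := by ring

end TD

/-- The polynomials all of whose coefficients lie in the algebra of multiple zeta values. -/
noncomputable def algLP : Subring LP where
  carrier := {p | ∀ a b, (p.coeff a).coeff b ∈ mzvTwoPiIAlgebra}
  mul_mem' {p q} hp hq a b := by
    rw [coeff_mul, finsetSum_coeff]
    refine sum_mem fun i _ => ?_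
    rw [coeff_mul]
    exact sum_mem fun j _ => mul_mem (hp _ _) (hq _ _)
  one_mem' a b := by
    rw [coeff_one]
    split_ifs
    · rw [coeff_one]; split_ifs; exacts [one_mem _, zero_mem _]
    · simp
  add_mem' {p q} hp hq a b := by simpa using add_mem (hp a b) (hq a b)
  zero_mem' a b := by simp
  neg_mem' {p} hp a b := by simpa using hp a b

lemma algLP_smul {z : ℂ} (hz : z ∈ mzvTwoPiIAlgebra) {p : LP} (hp : p ∈ algLP) : z • p ∈ algLP :=
  fun a b => by simpa using mul_mem hz (hp a b)

lemma X_mem_algLP : (X : LP) ∈ algLP := fun a b => by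
  rw [coeff_X]
  split_ifs
  · rw [coeff_one]; split_ifs; exacts [one_mem _, zero_mem _]
  · simp

lemma C_X_mem_algLP : (C X : LP) ∈ algLP := fun a b => by
  rw [coeff_C]
  split_ifs
  · rw [coeff_X]; split_ifs; exacts [one_mem _, zero_mem _]
  · simp

lemma coeff_iterate_derivative_LP (p : LP) (j a b : ℕ) :
    ((derivative^[j] p).coeff a).coeff b = ((a + j).descFactorial j : ℂ) *
      (p.coeff (a + j)).coeff b := by
  rw [coeff_iterate_derivative, nsmul_eq_mul, ← C_eq_natCast, coeff_C_mul]

/-! ### Inverting `λ + ∂/∂s` -/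

/-- The antiderivative in `s`, without constant term. -/
noncomputable def antider (p : LP) : LP :=
  p.sum fun k c => monomial (k + 1) (((k : ℂ) + 1)⁻¹ • c)

lemma coeff_antider_zero (p : LP) : (antider p).coeff 0 = 0 := by
  rw [antider, Polynomial.sum_def, finsetSum_coeff]
  exact Finset.sum_eq_zero fun k _ => by rw [coeff_monomial, if_neg (by omega)]

lemma coeff_antider_succ (p : LP) (a : ℕ) :
    (antider p).coeff (a + 1) = ((a : ℂ) + 1)⁻¹ • p.coeff a := by
  rw [antider, Polynomial.sum_def, finsetSum_coeff, Finset.sum_eq_single a]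
  · simp
  · intro k _ hk; rw [coeff_monomial, if_neg (by omega)]
  · intro h; simp [notMem_support_iff.1 h]

lemma derivative_antider (p : LP) : derivative (antider p) = p := by
  ext1 a
  have h : (a : ℂ[X]) + 1 = C ((a : ℂ) + 1) := by simp
  have h0 : (a : ℂ) + 1 ≠ 0 := by exact_mod_cast Nat.succ_ne_zero a
  rw [coeff_derivative, coeff_antider_succ, smul_eq_C_mul, h, mul_right_comm, ← C_mul,
    inv_mul_cancel₀ h0, C_1, one_mul]

lemma TD.antider {N : ℕ} {p : LP} (hp : TD N p) : TD (N + 1) (antider p) := fun a b hab => by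
  rcases a with _ | a
  · rw [coeff_antider_zero]; simp
  · rw [coeff_antider_succ, coeff_smul, hp a b (by omega), smul_zero]

lemma antider_mem {p : LP} (hp : p ∈ algLP) : antider p ∈ algLP := fun a b => by
  rcases a with _ | a
  · rw [coeff_antider_zero]; simp
  · rw [coeff_antider_succ, coeff_smul]
    exact mul_mem (by simpa using inv_int_mem (a + 1)) (hp a b)

lemma nrm_antider_le (p : LP) : nrm (antider p) ≤ nrm p := by
  have h : (EllMZV.antider p).natDegree ≤ p.natDegree + 1 :=
    natDegree_le_iff_coeff_eq_zero.2 fun a ha => by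
      obtain ⟨a, rfl⟩ := Nat.exists_eq_add_of_le' (show 1 ≤ a by omega)
      rw [coeff_antider_succ, coeff_eq_zero_of_natDegree_lt (by omega), smul_zero]
  rw [nrm, ell1_eq_sum _ _ h, Finset.sum_range_succ', ell1_eq_sum _ p le_rfl, coeff_antider_zero,
    map_zero, add_zero]
  refine Finset.sum_le_sum fun a _ => ?_
  rw [coeff_antider_succ, nrm₁_smul]
  refine mul_le_of_le_one_left (apply_nonneg _ _) ?_
  rw [← Nat.cast_succ, norm_inv, Complex.norm_natCast]
  exact inv_le_one_of_one_le₀ (by simp)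

/-- The inverse of `z + ∂/∂s` when `z ≠ 0`, and `0` when `z = 0`. -/
noncomputable def invShift (z : ℂ) (p : LP) : LP :=
  ∑ j ∈ Finset.range (p.natDegree + 1), ((-1) ^ j * z⁻¹ ^ (j + 1)) • derivative^[j] p

lemma invShift_eq (z : ℂ) (p : LP) {N : ℕ} (hN : p.natDegree ≤ N) :
    invShift z p = ∑ j ∈ Finset.range (N + 1), ((-1) ^ j * z⁻¹ ^ (j + 1)) • derivative^[j] p := by
  refine Finset.sum_subset (by simpa using hN) fun j _ hj => ?_
  rw [iterate_derivative_eq_zero (by simp at hj; omega), smul_zero]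

lemma invShift_zero_left (p : LP) : invShift 0 p = 0 := by simp [invShift]

lemma invShift_spec {z : ℂ} (hz : z ≠ 0) (p : LP) :
    z • invShift z p + derivative (invShift z p) = p := by
  have h : z • invShift z p + derivative (invShift z p) = z • (∑ j ∈ Finset.range
      (p.natDegree + 1 + 1), ((-1 : ℂ) ^ j * z⁻¹ ^ (j + 1)) • derivative^[j] p) +
      derivative (∑ j ∈ Finset.range (p.natDegree + 1),
        ((-1 : ℂ) ^ j * z⁻¹ ^ (j + 1)) • derivative^[j] p) := by
    rw [← invShift_eq z p (Nat.le_succ _), ← invShift_eq z p le_rfl]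
  rw [h, Finset.smul_sum, Finset.sum_range_succ', derivative_sum]
  have : ∀ j, z • ((-1 : ℂ) ^ (j + 1) * z⁻¹ ^ (j + 1 + 1)) • derivative^[j + 1] p =
      - derivative (((-1 : ℂ) ^ j * z⁻¹ ^ (j + 1)) • derivative^[j] p) := fun j => by
    rw [derivative_smul, ← Function.iterate_succ_apply' derivative, smul_smul, ← neg_smul]
    congr 1
    linear_combination (-(-1) ^ j * z⁻¹ ^ (j + 1)) * mul_inv_cancel₀ hz
  simp only [this, Finset.sum_neg_distrib]
  simp [hz]

end EllMZV

namespace EllMZV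

open Polynomial

/-! ### Double power series -/

/-- Formal double power series in `x = q ^ t` (inner) and `y = q ^ (1 - t)` (outer). -/
abbrev FS := PowerSeries (PowerSeries LP)

/-- The coefficient of `x ^ m * y ^ n`. -/
noncomputable def co (F : FS) (m n : ℕ) : LP := PowerSeries.coeff m (PowerSeries.coeff n F)

/-- The coefficient of `x ^ m * y ^ n * s ^ a * L ^ b`. -/
noncomputable def cf (F : FS) (m n a b : ℕ) : ℂ := ((co F m n).coeff a).coeff b

/-- The double power series with given coefficients. -/
noncomputable def mk2 (f : ℕ → ℕ → LP) : FS :=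
  PowerSeries.mk fun n => PowerSeries.mk fun m => f m n

@[simp] lemma co_mk2 (f : ℕ → ℕ → LP) (m n : ℕ) : co (mk2 f) m n = f m n := by simp [co, mk2]

@[simp] lemma co_add (F G : FS) (m n : ℕ) : co (F + G) m n = co F m n + co G m n := by simp [co]

@[simp] lemma co_neg (F : FS) (m n : ℕ) : co (-F) m n = -co F m n := by simp [co]

@[simp] lemma co_zero (m n : ℕ) : co 0 m n = 0 := by simp [co]

lemma co_one (m n : ℕ) : co 1 m n = if m = 0 ∧ n = 0 then 1 else 0 := by
  rw [co, PowerSeries.coeff_one]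
  by_cases hn : n = 0
  · simp [hn, PowerSeries.coeff_one]
  · simp [hn]

lemma fs_ext {F G : FS} (h : ∀ m n, co F m n = co G m n) : F = G :=
  PowerSeries.ext fun n => PowerSeries.ext fun m => h m n

lemma co_mul (F G : FS) (m n : ℕ) : co (F * G) m n =
    ∑ i ∈ Finset.HasAntidiagonal.antidiagonal n,
      ∑ j ∈ Finset.HasAntidiagonal.antidiagonal m, co F j.1 i.1 * co G j.2 i.2 := by
  simp only [co, PowerSeries.coeff_mul, map_sum]

lemma co_mul' (F G : FS) (m n : ℕ) : co (F * G) m n =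
    ∑ i ∈ Finset.range (n + 1), ∑ j ∈ Finset.range (m + 1), co F j i * co G (m - j) (n - i) := by
  rw [co_mul, Finset.Nat.sum_antidiagonal_eq_sum_range_succ_mk]
  exact Finset.sum_congr rfl fun i _ => Finset.Nat.sum_antidiagonal_eq_sum_range_succ_mk _ _

/-- The derivation `L⁻¹ d/dt`, where `s = L * t`, `x = exp s` and `y = exp (L - s)`. -/
noncomputable def derD (F : FS) : FS :=
  mk2 fun m n => ((m : ℂ) - n) • co F m n + derivative (co F m n)

lemma co_derD (F : FS) (m n : ℕ) :
    co (derD F) m n = ((m : ℂ) - n) • co F m n + derivative (co F m n) := co_mk2 _ _ _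

lemma derD_add (F G : FS) : derD (F + G) = derD F + derD G := fs_ext fun m n => by
  simp only [co_derD, co_add, derivative_add, smul_add]; abel

lemma derD_mul (F G : FS) : derD (F * G) = derD F * G + F * derD G := fs_ext fun m n => by
  simp only [co_derD, co_add, co_mul, Finset.smul_sum, derivative_sum, ← Finset.sum_add_distrib]
  refine Finset.sum_congr rfl fun i hi => Finset.sum_congr rfl fun j hj => ?_
  simp only [Finset.HasAntidiagonal.mem_antidiagonal] at hi hj
  rw [← hi, ← hj, derivative_mul, add_mul, mul_add, smul_mul_assoc, mul_smul_comm]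
  have : (((j.1 + j.2 : ℕ) : ℂ) - ((i.1 + i.2 : ℕ) : ℂ)) =
      ((j.1 : ℂ) - i.1) + ((j.2 : ℂ) - i.2) := by push_cast; ring
  rw [this, add_smul]
  abel

/-- The substitution `s ↦ L - s` on polynomials. -/
noncomputable def flip : LP →+* LP := compRingHom (C X - X)

lemma flip_apply (p : LP) : flip p = p.comp (C X - X) := rfl

lemma flip_smul (z : ℂ) (p : LP) : flip (z • p) = z • flip p := by
  simp only [flip_apply, smul_comp]

@[simp] lemma flip_C (p : ℂ[X]) : flip (C p) = C p := by simp [flip_apply]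

@[simp] lemma flip_X : flip X = C X - X := by simp [flip_apply]

lemma flip_flip (p : LP) : flip (flip p) = p := by
  simp [flip_apply, comp_assoc]

lemma derivative_flip (p : LP) : derivative (flip p) = -flip (derivative p) := by
  have : derivative (C X - X : LP) = -1 := by simp
  rw [flip_apply, flip_apply, derivative_comp, this]
  ring

/-- The symmetry `t ↦ 1 - t`. -/
noncomputable def sig (F : FS) : FS := mk2 fun m n => flip (co F n m)

@[simp] lemma co_sig (F : FS) (m n : ℕ) : co (sig F) m n = flip (co F n m) := co_mk2 _ _ _

lemma sig_mul (F G : FS) : sig (F * G) = sig F * sig G := fs_ext fun m n => by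
  simp only [co_sig, co_mul, map_sum, map_mul]
  exact Finset.sum_comm

lemma derD_sig (F : FS) : derD (sig F) = -sig (derD F) := fs_ext fun m n => by
  rw [co_derD, co_sig, co_neg, co_sig, co_derD, map_add, flip_smul, derivative_flip,
    ← neg_sub (m : ℂ), neg_smul]
  abel

/-- The inverse of `derD` without constants of integration. -/
noncomputable def intJ (G : FS) : FS :=
  mk2 fun m n => invShift ((m : ℂ) - n) (co G m n) + if m = n then antider (co G m n) else 0

lemma co_intJ (G : FS) (m n : ℕ) : co (intJ G) m n =
    invShift ((m : ℂ) - n) (co G m n) + if m = n then antider (co G m n) else 0 := co_mk2 _ _ _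

lemma co_intJ_of_ne (G : FS) {m n : ℕ} (h : m ≠ n) :
    co (intJ G) m n = invShift ((m : ℂ) - n) (co G m n) := by rw [co_intJ, if_neg h, add_zero]

lemma co_intJ_diag (G : FS) (n : ℕ) : co (intJ G) n n = antider (co G n n) := by
  rw [co_intJ, if_pos rfl, sub_self, invShift_zero_left, zero_add]

lemma derD_intJ (G : FS) : derD (intJ G) = G := fs_ext fun m n => by
  rw [co_derD]
  by_cases h : m = n
  · subst h
    rw [co_intJ_diag, sub_self, zero_smul, zero_add, derivative_antider]
  · rw [co_intJ_of_ne G h, invShift_spec (sub_ne_zero.2 (by exact_mod_cast h))]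

/-- The diagonal series `∑ n, k n * (x * y) ^ n`. -/
noncomputable def diagS (k : ℕ → ℂ[X]) : FS := mk2 fun m n => if m = n then C (k n) else 0

@[simp] lemma co_diagS (k : ℕ → ℂ[X]) (m n : ℕ) :
    co (diagS k) m n = if m = n then C (k n) else 0 := co_mk2 _ _ _

lemma derD_diagS (k : ℕ → ℂ[X]) : derD (diagS k) = 0 := fs_ext fun m n => by
  rw [co_derD, co_diagS]
  split_ifs with h
  · simp [h]
  · simp

lemma eq_zero_of_smul_add_derivative {z : ℂ} (hz : z ≠ 0) {p : LP}
    (h : z • p + derivative p = 0) : p = 0 := by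
  by_contra hp
  have h1 := congrArg (fun f => f.coeff p.natDegree) h
  simp only [coeff_add, coeff_smul, coeff_derivative, coeff_zero,
    coeff_eq_zero_of_natDegree_lt (Nat.lt_succ_self p.natDegree), zero_mul, add_zero] at h1
  rcases smul_eq_zero.1 h1 with h2 | h2
  · exact hz h2
  · exact hp (leadingCoeff_eq_zero.1 h2)

lemma eq_diagS_of_derD_eq_zero {F : FS} (h : derD F = 0) :
    F = diagS fun n => (co F n n).coeff 0 := fs_ext fun m n => by
  have h1 := congrArg (fun G => co G m n) h
  simp only [co_derD, co_zero] at h1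
  rw [co_diagS]
  split_ifs with hmn
  · subst hmn
    rw [sub_self, zero_smul, zero_add] at h1
    exact eq_C_of_derivative_eq_zero h1
  · exact eq_zero_of_smul_add_derivative (sub_ne_zero.2 (by exact_mod_cast hmn)) h1

/-! ### The kernels -/

/-- The polynomial `∑ k ≤ n, B_k L ^ k s ^ (n - k) / (k! (n - k)!)`. -/
noncomputable def bern (n : ℕ) : LP :=
  ∑ k ∈ Finset.range (n + 1),
    ((bernoulli k : ℂ) / ((k ! : ℂ) * ((n - k)! : ℂ))) • (C X ^ k * X ^ (n - k))

/-- The coefficient `(p * L + s) ^ k` of `x ^ (M (p + 1)) * y ^ (M p)`. -/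
noncomputable def kerP (k m n : ℕ) : LP :=
  if n < m ∧ (m - n) ∣ n then (((n / (m - n) : ℕ) : ℂ) • C X + X) ^ k else 0

/-- The expansion of the normalized kernel `ω_n (τ t, τ)` in `x`, `y`. -/
noncomputable def kerW : ℕ → FS
  | 0 => 1
  | k + 1 => mk2 fun m n => (if m = 0 ∧ n = 0 then bern (k + 1) else 0) -
      ((k ! : ℂ)⁻¹) • (C X * (kerP k m n + ((-1 : ℂ) ^ (k + 1)) • flip (kerP k n m)))

lemma co_kerW_succ (k m n : ℕ) : co (kerW (k + 1)) m n =
    (if m = 0 ∧ n = 0 then bern (k + 1) else 0) -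
      ((k ! : ℂ)⁻¹) • (C X * (kerP k m n + ((-1 : ℂ) ^ (k + 1)) • flip (kerP k n m))) := co_mk2 _ _ _

/-- Evaluation at `L`, `s`. -/
noncomputable def evLP (L s : ℂ) : LP →+* ℂ := evalEvalRingHom L s

@[simp] lemma evLP_C (L s : ℂ) (p : ℂ[X]) : evLP L s (C p) = p.eval L := by simp [evLP]

@[simp] lemma evLP_X (L s : ℂ) : evLP L s X = s := by simp [evLP]

@[simp] lemma evLP_smul (L s z : ℂ) (p : LP) : evLP L s (z • p) = z * evLP L s p := by
  simp [evLP]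

lemma evLP_eq (L s : ℂ) (p : LP) : evLP L s p = (p.map (evalRingHom L)).eval s := by
  simp [evLP, map_evalRingHom_eval]

lemma evLP_flip (L s : ℂ) (p : LP) : evLP L s (flip p) = evLP L (L - s) p := by
  rw [evLP_eq, evLP_eq, flip_apply, Polynomial.map_comp, eval_comp]
  simp

lemma lp_ext {p q : LP} (h : ∀ L s : ℂ, L ≠ 0 → evLP L s p = evLP L s q) : p = q := by
  have h1 : ∀ L : ℂ, L ≠ 0 → p.map (evalRingHom L) = q.map (evalRingHom L) := fun L hL =>
    Polynomial.funext fun s => by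
      simpa [evLP, map_evalRingHom_eval] using h L s hL
  ext1 a
  refine mul_left_cancel₀ (X_ne_zero (R := ℂ)) (Polynomial.funext fun L => ?_)
  by_cases hL : L = 0
  · simp [hL]
  · have := congrArg (fun f => f.coeff a) (h1 L hL)
    simp only [coeff_map, coe_evalRingHom] at this
    simp [this]

lemma evLP_bern (n : ℕ) {L : ℂ} (hL : L ≠ 0) (s : ℂ) :
    evLP L s (bern n) = L ^ n / (n ! : ℂ) * aeval (s / L) (Polynomial.bernoulli n) := by
  rw [bern, map_sum, Polynomial.bernoulli, map_sum, Finset.mul_sum]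
  refine Finset.sum_congr rfl fun k hk => ?_
  have hk' : k ≤ n := by simpa [Nat.lt_succ_iff] using hk
  have h1 : (n.choose k : ℂ) = (n ! : ℂ) / ((k ! : ℂ) * ((n - k)! : ℂ)) := Nat.cast_choose ℂ hk'
  have h2 : L ^ n = L ^ k * L ^ (n - k) := by rw [← pow_add, Nat.add_sub_cancel' hk']
  have h3 : (n ! : ℂ) ≠ 0 := by exact_mod_cast n.factorial_ne_zero
  simp only [evLP_smul, map_mul, map_pow, evLP_C, evLP_X, eval_X, aeval_monomial, div_pow,
    eq_ratCast, Rat.cast_natCast, h1, h2]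
  field_simp

lemma flip_bern (n : ℕ) : flip (bern n) = ((-1 : ℂ) ^ n) • bern n := lp_ext fun L s hL => by
  have h := congrArg (aeval (s / L)) (Polynomial.bernoulli_comp_one_sub_X n)
  rw [aeval_comp] at h
  simp only [map_sub, map_one, aeval_X, map_mul, map_pow, map_neg] at h
  rw [evLP_flip, evLP_bern n hL, evLP_smul, evLP_bern n hL, sub_div,
    div_self hL, h]
  ring

lemma co_smul (z : ℂ) (F : FS) (m n : ℕ) : co (z • F) m n = z • co F m n := rfl

lemma sig_kerW (n : ℕ) : sig (kerW n) = ((-1 : ℂ) ^ n) • kerW n := fs_ext fun m m' => by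
  rw [co_smul, co_sig]
  rcases n with _ | k
  · rw [kerW, co_one, co_one, pow_zero, one_smul]
    simp only [and_comm]
    split_ifs <;> simp
  · rw [co_kerW_succ, co_kerW_succ, map_sub, flip_smul, map_mul, map_add, flip_smul,
      flip_flip, flip_C, smul_sub, smul_comm _ ((k ! : ℂ)⁻¹)]
    congr 1
    · simp only [and_comm]
      split_ifs
      · exact flip_bern _
      · simp
    · congr 1
      rw [← mul_smul_comm, smul_add, smul_smul, ← mul_pow, add_comm]
      norm_num

end EllMZV

namespace EllMZV

open Polynomial

/-! ### Growth and regularity classes of double series -/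

/-- Membership in some class `Harm b d`. -/
def HarmE (b : ℕ) (f : ℕ → ℂ) : Prop := ∃ d, Harm b d f

namespace HarmE

variable {b : ℕ} {f g : ℕ → ℂ}

lemma zero : HarmE b (fun _ => 0) := ⟨0, .zero⟩

lemma add (hf : HarmE b f) (hg : HarmE b g) : HarmE b (fun m => f m + g m) := by
  obtain ⟨d, hf⟩ := hf
  obtain ⟨e, hg⟩ := hg
  exact ⟨max d e, (hf.mono le_rfl (le_max_left _ _)).add (hg.mono le_rfl (le_max_right _ _))⟩

lemma smul {a : ℂ} (ha : a ∈ mzvTwoPiIAlgebra) (hf : HarmE b f) : HarmE b (fun m => a * f m) :=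
  hf.imp fun _ h => h.smul ha

lemma congr (hf : HarmE b f) (h : f =ᶠ[atTop] g) : HarmE b g := hf.imp fun _ hd => hd.congr h

lemma congr' (hf : HarmE b f) (h : ∀ m, f m = g m) : HarmE b g := hf.imp fun _ hd => hd.congr' h

lemma mono {c : ℕ} (h : c ≤ b) (hf : HarmE b f) : HarmE c f := hf.imp fun _ hd => hd.mono h le_rfl

lemma sum {ι : Type*} (s : Finset ι) {F : ι → ℕ → ℂ} (h : ∀ i ∈ s, HarmE b (F i)) :
    HarmE b (fun m => ∑ i ∈ s, F i m) := by
  classical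
  induction s using Finset.induction_on with
  | empty => exact zero.congr' (by simp)
  | insert i s hi ih =>
    refine ((h i (by simp)).add (ih fun j hj => h j (by simp [hj]))).congr' fun m => ?_
    rw [Finset.sum_insert hi]

lemma mul_pole (hf : HarmE b f) (j : ℤ) {k : ℕ} (hk : 1 ≤ k) :
    HarmE 1 (fun m => f m * pole j m ^ k) := hf.imp fun _ h => h.mul_pole j hk

lemma shift_back_nat (hb : b ≤ 1) (hf : HarmE b f) (M : ℕ) : HarmE b (fun m => f (m - M)) :=
  hf.imp fun _ h => h.shift_back_nat hb M

lemma sum_range (hf : HarmE 1 f) (hm : ∀ m, f m ∈ mzvTwoPiIAlgebra) :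
    HarmE 0 (fun m => ∑ i ∈ Finset.range m, f i) := by
  obtain ⟨d, hd⟩ := hf
  exact ⟨d + 1, hd.sum_range hm⟩

end HarmE

/-- `g m n` is bounded by `w m` times a polynomial in `n`. -/
def PolyBd (w : ℕ → ℝ) (g : ℕ → ℕ → ℝ) : Prop :=
  ∃ (C : ℝ) (A : ℕ), 0 ≤ C ∧ ∀ m n, g m n ≤ C * ((n : ℝ) + 1) ^ A * w m

namespace PolyBd

variable {w v w' : ℕ → ℝ} {g g' : ℕ → ℕ → ℝ}

lemma of_le (hg : PolyBd w g') (K : ℝ) (k : ℕ) (hK : 0 ≤ K) (hv0 : ∀ m, 0 ≤ v m)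
    (hv : ∀ m, v m * w m ≤ w' m) (h : ∀ m n, g m n ≤ K * ((n : ℝ) + 1) ^ k * v m * g' m n) :
    PolyBd w' g := by
  obtain ⟨C, A, hC, hg⟩ := hg
  refine ⟨K * C, k + A, by positivity, fun m n => (h m n).trans ?_⟩
  calc K * ((n : ℝ) + 1) ^ k * v m * g' m n
      ≤ K * ((n : ℝ) + 1) ^ k * v m * (C * ((n : ℝ) + 1) ^ A * w m) := by
        have := hv0 m
        gcongr
        exact hg m n
    _ = K * C * ((n : ℝ) + 1) ^ (k + A) * (v m * w m) := by ring
    _ ≤ K * C * ((n : ℝ) + 1) ^ (k + A) * w' m := by gcongr; exact hv m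

lemma mono (hg : PolyBd w g') (h : ∀ m n, g m n ≤ g' m n) : PolyBd w g :=
  hg.of_le (v := fun _ => 1) 1 0 zero_le_one (by simp) (by simp) (by simpa using h)

lemma mono_wt (hg : PolyBd w g) (h : ∀ m, w m ≤ w' m) : PolyBd w' g :=
  hg.of_le (v := fun _ => 1) 1 0 zero_le_one (by simp) (by simpa using h) (by simp)

lemma const_mul (hg : PolyBd w g) {K : ℝ} (hK : 0 ≤ K) : PolyBd w (fun m n => K * g m n) :=
  hg.of_le (v := fun _ => 1) K 0 hK (by simp) (by simp) (by simp)

lemma add (hw : ∀ m, 0 ≤ w m) (hg : PolyBd w g) (hg' : PolyBd w g') :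
    PolyBd w (fun m n => g m n + g' m n) := by
  obtain ⟨C, A, hC, hg⟩ := hg
  obtain ⟨C', A', hC', hg'⟩ := hg'
  refine ⟨C + C', A + A', by positivity, fun m n => (add_le_add (hg m n) (hg' m n)).trans ?_⟩
  have h1 : (1 : ℝ) ≤ (n : ℝ) + 1 := by simp
  have h2 : ((n : ℝ) + 1) ^ A ≤ ((n : ℝ) + 1) ^ (A + A') := pow_le_pow_right₀ h1 (by omega)
  have h3 : ((n : ℝ) + 1) ^ A' ≤ ((n : ℝ) + 1) ^ (A + A') := pow_le_pow_right₀ h1 (by omega)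
  have := hw m
  rw [add_mul, add_mul]
  gcongr

lemma sum_range (hg : PolyBd w g) {K : ℝ} (hK : 0 ≤ K)
    (h : ∀ m, ∑ i ∈ Finset.range m, w i ≤ K * w' m) :
    PolyBd w' (fun m n => ∑ i ∈ Finset.range m, g i n) := by
  obtain ⟨C, A, hC, hg⟩ := hg
  refine ⟨C * K, A, by positivity, fun m n => ?_⟩
  calc ∑ i ∈ Finset.range m, g i n ≤ ∑ i ∈ Finset.range m, C * ((n : ℝ) + 1) ^ A * w i :=
        Finset.sum_le_sum fun i _ => hg i n
    _ = C * ((n : ℝ) + 1) ^ A * ∑ i ∈ Finset.range m, w i := by rw [Finset.mul_sum]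
    _ ≤ C * ((n : ℝ) + 1) ^ A * (K * w' m) := by gcongr; exact h m
    _ = _ := by ring

lemma conv {q : ℕ → ℕ → ℝ} (hg : PolyBd w g) (hg0 : ∀ m n, 0 ≤ g m n) (hw : ∀ m, 0 ≤ w m)
    (hw' : ∀ m j, j ≤ m → w (m - j) ≤ (j + 1) * w m) (hq : PolyBd (fun _ => 1) q)
    (hq2 : ∀ m n, 2 * n < m → q m n = 0) :
    PolyBd w (fun m n => ∑ i ∈ Finset.range (n + 1), ∑ j ∈ Finset.range (m + 1),
      q j i * g (m - j) (n - i)) := by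
  obtain ⟨C, A, hC, hg⟩ := hg
  obtain ⟨C', A', hC', hq⟩ := hq
  refine ⟨4 * C * C', A + A' + 3, by positivity, fun m n => ?_⟩
  have key : ∀ i ∈ Finset.range (n + 1), ∀ j ∈ Finset.range (m + 1),
      q j i * g (m - j) (n - i) ≤ if j ∈ Finset.range (2 * n + 1) then
        2 * C * C' * ((n : ℝ) + 1) ^ (A + A' + 1) * w m else 0 := by
    intro i hi j hj
    have hi' : i ≤ n := by simpa [Nat.lt_succ_iff] using hi
    have hj' : j ≤ m := by simpa [Nat.lt_succ_iff] using hj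
    split_ifs with h
    · have hjn : j ≤ 2 * n := by simpa [Nat.lt_succ_iff] using h
      have h1 : (i : ℝ) ≤ n := by exact_mod_cast hi'
      have h2 : ((n - i : ℕ) : ℝ) ≤ n := by exact_mod_cast Nat.sub_le n i
      have h3 : (j : ℝ) + 1 ≤ 2 * ((n : ℝ) + 1) := by
        have : (j : ℝ) ≤ 2 * n := by exact_mod_cast hjn
        linarith
      have hwm := hw m
      calc q j i * g (m - j) (n - i)
          ≤ (C' * ((i : ℝ) + 1) ^ A' * 1) * (C * (((n - i : ℕ) : ℝ) + 1) ^ A * w (m - j)) := by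
            refine mul_le_mul (hq j i) (hg _ _) (hg0 _ _) (by positivity)
        _ ≤ (C' * ((n : ℝ) + 1) ^ A' * 1) * (C * ((n : ℝ) + 1) ^ A *
            (2 * ((n : ℝ) + 1) * w m)) := by
            gcongr
            · exact mul_nonneg (by positivity) (hw _)
            · exact hw _
            · exact (hw' m j hj').trans (by gcongr)
        _ = _ := by ring
    · rw [hq2 j i (by simp at h; omega), zero_mul]
  have hwm := hw m
  calc _ ≤ ∑ i ∈ Finset.range (n + 1), ∑ j ∈ Finset.range (m + 1),
        (if j ∈ Finset.range (2 * n + 1) then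
          2 * C * C' * ((n : ℝ) + 1) ^ (A + A' + 1) * w m else 0) :=
        Finset.sum_le_sum fun i hi => Finset.sum_le_sum fun j hj => key i hi j hj
    _ ≤ ∑ i ∈ Finset.range (n + 1), ((2 * n + 1 : ℕ) : ℝ) *
          (2 * C * C' * ((n : ℝ) + 1) ^ (A + A' + 1) * w m) := by
        refine Finset.sum_le_sum fun i _ => ?_
        rw [← Finset.sum_filter, Finset.sum_const, nsmul_eq_mul]
        gcongr
        calc _ ≤ (Finset.range (2 * n + 1)).card := Finset.card_le_card fun j hj => by
              simpa using (Finset.mem_filter.1 hj).2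
          _ = _ := by simp
    _ ≤ ((n : ℝ) + 1) * ((2 * ((n : ℝ) + 1)) *
          (2 * C * C' * ((n : ℝ) + 1) ^ (A + A' + 1) * w m)) := by
        rw [Finset.sum_const, nsmul_eq_mul, Finset.card_range]
        push_cast
        gcongr
        linarith
    _ = _ := by ring

end PolyBd

lemma wt_sub_le {m j : ℕ} (h : j ≤ m) : wt m ≤ (j + 1) * wt (m - j) := by
  have h1 : wt m ^ 2 ≤ ((j + 1) * wt (m - j)) ^ 2 := by
    rw [mul_pow, wt_sq, wt_sq, Nat.cast_sub h]
    have : (j : ℝ) ≤ m := by exact_mod_cast h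
    have hj : (0 : ℝ) ≤ j := by positivity
    nlinarith [mul_nonneg hj (sub_nonneg.2 this), mul_nonneg (mul_nonneg hj hj) (sub_nonneg.2 this)]
  exact le_of_sq_le_sq h1 (mul_nonneg (by positivity) (wt_pos _).le)

lemma inv_wt_sub_le (m j : ℕ) (h : j ≤ m) : (wt (m - j))⁻¹ ≤ (j + 1) * (wt m)⁻¹ := by
  rw [← div_eq_mul_inv, le_div_iff₀ (wt_pos m), ← div_eq_inv_mul, div_le_iff₀ (wt_pos _)]
  exact wt_sub_le h

/-- Double series with coefficients of total degree at most `N` in `s` and `L`, lying in the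
algebra of multiple zeta values, given by harmonic sums in `m`, of size at most `w m` and, for the
part of degree `0` in `s`, at most `u m`, up to polynomial factors in `n`. -/
structure Cls (N b : ℕ) (u w : ℕ → ℝ) (f : ℕ → ℕ → LP) : Prop where
  td : ∀ m n, TD N (f m n)
  mem : ∀ m n, f m n ∈ algLP
  harm : ∀ n a b', HarmE b (fun m => ((f m n).coeff a).coeff b')
  bd₀ : PolyBd u (fun m n => nrm₁ ((f m n).coeff 0))
  bd : PolyBd w (fun m n => nrm (f m n))

/-- The class containing the iterated integrals. -/
def Strong (N : ℕ) (F : FS) : Prop :=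
  Cls N 1 (fun m => (wt m ^ 3)⁻¹) (fun m => (wt m)⁻¹) (co F)

/-- The class containing their integrands. -/
def Weak (N : ℕ) (F : FS) : Prop :=
  Cls N 0 (fun m => (wt m)⁻¹) wt (co F)

namespace TD

variable {N : ℕ} {p : LP}

lemma C {c : ℂ[X]} (h : ∀ b, N < b → c.coeff b = 0) : TD N (C c) := fun a b hab => by
  rw [coeff_C]
  split_ifs with ha
  · exact h b (by omega)
  · simp

lemma flip (hp : TD N p) : TD N (flip p) := by
  conv => arg 2; rw [p.as_sum_range_C_mul_X_pow, map_sum]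
  refine sum _ fun a _ => ?_
  rw [map_mul, map_pow, flip_C, flip_X]
  rcases le_or_gt a N with h | h
  · have h1 : TD 1 (Polynomial.C Polynomial.X - Polynomial.X : LP) := by
      rw [sub_eq_add_neg]; exact C_X.add X.neg
    have h2 : TD (N - a) (Polynomial.C (p.coeff a)) := C fun b hb => hp a b (by omega)
    exact (h2.mul (h1.pow a)).mono (by omega)
  · have : p.coeff a = 0 := by ext b; simpa using hp a b (by omega)
    rw [this, map_zero, zero_mul]
    exact zero

lemma invShift (hp : TD N p) (z : ℂ) : TD N (invShift z p) :=
  sum _ fun j _ => (hp.iterate_derivative j).smul _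

end TD

lemma C_mem_algLP {c : ℂ[X]} (h : ∀ b, c.coeff b ∈ mzvTwoPiIAlgebra) : C c ∈ algLP := fun a b => by
  rw [coeff_C]
  split_ifs
  · exact h b
  · simp

lemma flip_mem {p : LP} (hp : p ∈ algLP) : flip p ∈ algLP := by
  rw [p.as_sum_range_C_mul_X_pow, map_sum]
  refine sum_mem fun a _ => ?_
  rw [map_mul, map_pow, flip_C, flip_X]
  exact mul_mem (C_mem_algLP fun b => hp a b) (pow_mem (sub_mem C_X_mem_algLP X_mem_algLP) a)

lemma iterate_derivative_mem {p : LP} (hp : p ∈ algLP) (j : ℕ) : derivative^[j] p ∈ algLP :=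
  fun a b => by
    rw [coeff_iterate_derivative_LP]
    exact mul_mem (by simp) (hp _ _)

lemma invShift_mem {p : LP} (hp : p ∈ algLP) (z : ℤ) : invShift z p ∈ algLP :=
  sum_mem fun j _ => algLP_smul (mul_mem (pow_mem (by simp) _)
    (pow_mem (inv_int_mem z) _)) (iterate_derivative_mem hp j)

end EllMZV

namespace EllMZV

open Polynomial

/-! ### Integration improves decay -/

lemma norm_inv_sub_le (m n : ℕ) : ‖((m : ℂ) - n)⁻¹‖ ≤ ((n : ℝ) + 2) * (wt m ^ 2)⁻¹ := by
  rcases eq_or_ne m n with rfl | h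
  · simp only [sub_self, inv_zero, norm_zero]; positivity
  have h1 : ‖(m : ℂ) - n‖ = |(m : ℝ) - n| := by
    rw [← Real.norm_eq_abs, ← Complex.norm_real]; simp
  have hz : (m : ℤ) - n ≠ 0 := sub_ne_zero.2 (by exact_mod_cast h)
  have h2 : (1 : ℝ) ≤ |(m : ℝ) - n| := by
    have := Int.one_le_abs hz
    exact_mod_cast this
  have h3 : (m : ℝ) - n ≤ |(m : ℝ) - n| := le_abs_self _
  have hn : (0 : ℝ) ≤ n := by positivity
  rw [norm_inv, h1, wt_sq, ← div_eq_mul_inv, inv_eq_one_div, div_le_div_iff₀ (by linarith)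
    (by positivity)]
  nlinarith [mul_nonneg hn (sub_nonneg.2 h2)]

lemma inv_wt_sq_le_one (m : ℕ) : (wt m ^ 2)⁻¹ ≤ 1 := by
  rw [wt_sq]; exact inv_le_one_of_one_le₀ (by simp)

lemma norm_inv_sub_pow_le {N j : ℕ} (hj : j ≤ N) (m n : ℕ) :
    ‖((m : ℂ) - n)⁻¹‖ ^ (j + 1) ≤ 2 ^ (N + 1) * ((n : ℝ) + 1) ^ (N + 1) * (wt m ^ 2)⁻¹ := by
  have h0 : 0 ≤ (wt m ^ 2)⁻¹ := by positivity
  calc _ ≤ (((n : ℝ) + 2) * (wt m ^ 2)⁻¹) ^ (j + 1) :=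
        pow_le_pow_left₀ (norm_nonneg _) (norm_inv_sub_le m n) _
    _ = ((n : ℝ) + 2) ^ (j + 1) * ((wt m ^ 2)⁻¹ ^ j * (wt m ^ 2)⁻¹) := by
        rw [mul_pow, pow_succ ((wt m ^ 2)⁻¹)]
    _ ≤ (2 * ((n : ℝ) + 1)) ^ (N + 1) * (1 * (wt m ^ 2)⁻¹) := by
        have : (n : ℝ) + 2 ≤ 2 * (n + 1) := by linarith [(Nat.cast_nonneg n : (0 : ℝ) ≤ n)]
        refine mul_le_mul ?_ ?_ (by positivity) (by positivity)
        · refine (pow_le_pow_left₀ (by positivity) this _).trans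
            (pow_le_pow_right₀ ?_ (by omega))
          linarith [(Nat.cast_nonneg n : (0 : ℝ) ≤ n)]
        · gcongr
          exact pow_le_one₀ h0 (inv_wt_sq_le_one m)
    _ = _ := by rw [mul_pow, one_mul]

lemma norm_inv_sub_pow_le' {N j : ℕ} (hj : j + 1 ≤ N) (m n : ℕ) :
    ‖((m : ℂ) - n)⁻¹‖ ^ (j + 1 + 1) ≤
      2 ^ (N + 1) * ((n : ℝ) + 1) ^ (N + 1) * ((wt m ^ 2)⁻¹ * (wt m ^ 2)⁻¹) := by
  obtain ⟨N, rfl⟩ := Nat.exists_eq_add_of_le' (show 1 ≤ N by omega)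
  rw [pow_succ]
  calc _ ≤ (2 ^ (N + 1) * ((n : ℝ) + 1) ^ (N + 1) * (wt m ^ 2)⁻¹) *
        (2 * ((n : ℝ) + 1) * (wt m ^ 2)⁻¹) := by
        refine mul_le_mul (norm_inv_sub_pow_le (by omega) m n) ?_ (norm_nonneg _) (by positivity)
        refine (norm_inv_sub_le m n).trans ?_
        gcongr
        linarith [(Nat.cast_nonneg n : (0 : ℝ) ≤ n)]
    _ = _ := by ring

lemma nrm_invShift_term_le {N : ℕ} {p : LP} (hp : TD N p) (z : ℂ) {j : ℕ} (hj : j ≤ N) :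
    nrm (((-1) ^ j * z⁻¹ ^ (j + 1)) • derivative^[j] p) ≤
      ‖z⁻¹‖ ^ (j + 1) * (((N : ℝ) + 1) ^ N * nrm p) := by
  rw [nrm_smul, norm_mul, norm_pow, norm_pow, norm_neg, norm_one, one_pow, one_mul]
  gcongr
  refine (hp.nrm_iterate_derivative_le j).trans ?_
  gcongr
  calc (N : ℝ) ^ j ≤ (N + 1 : ℝ) ^ j := by gcongr; simp
    _ ≤ _ := pow_le_pow_right₀ (by simp) hj

lemma nrm_invShift_le {N : ℕ} {p : LP} (hp : TD N p) (m n : ℕ) :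
    nrm (invShift ((m : ℂ) - n) p) ≤ ((N : ℝ) + 1) * (2 ^ (N + 1) * ((N : ℝ) + 1) ^ N) *
      ((n : ℝ) + 1) ^ (N + 1) * (wt m ^ 2)⁻¹ * nrm p := by
  rw [invShift_eq _ _ hp.natDegree_le]
  refine (seminorm_sum_le nrm _ _).trans ?_
  calc _ ≤ ∑ j ∈ Finset.range (N + 1), 2 ^ (N + 1) * ((n : ℝ) + 1) ^ (N + 1) * (wt m ^ 2)⁻¹ *
        (((N : ℝ) + 1) ^ N * nrm p) := by
        refine Finset.sum_le_sum fun j hj => ?_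
        have hj' : j ≤ N := by simpa [Nat.lt_succ_iff] using hj
        refine (nrm_invShift_term_le hp _ hj').trans ?_
        gcongr
        exact norm_inv_sub_pow_le hj' m n
    _ = _ := by rw [Finset.sum_const, nsmul_eq_mul, Finset.card_range]; push_cast; ring

lemma nrm₁_coeff_zero_invShift_le {N : ℕ} {p : LP} (hp : TD N p) (m n : ℕ) :
    nrm₁ ((invShift ((m : ℂ) - n) p).coeff 0) ≤
      2 * ((n : ℝ) + 1) ^ 1 * (wt m ^ 2)⁻¹ * nrm₁ (p.coeff 0) +
      (N : ℝ) * (2 ^ (N + 1) * ((N : ℝ) + 1) ^ N) *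
      ((n : ℝ) + 1) ^ (N + 1) * ((wt m ^ 2)⁻¹ * (wt m ^ 2)⁻¹) * nrm p := by
  rw [invShift_eq _ _ hp.natDegree_le, Finset.sum_range_succ', coeff_add, add_comm]
  refine (map_add_le_add nrm₁ _ _).trans (add_le_add ?_ ?_)
  · rw [coeff_smul, nrm₁_smul]
    simp only [pow_zero, one_mul, zero_add, pow_one, Function.iterate_zero, id]
    gcongr
    refine (norm_inv_sub_le m n).trans ?_
    gcongr
    linarith [(Nat.cast_nonneg n : (0 : ℝ) ≤ n)]
  · rw [finsetSum_coeff]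
    refine (seminorm_sum_le nrm₁ _ _).trans ?_
    calc _ ≤ ∑ j ∈ Finset.range N, 2 ^ (N + 1) * ((n : ℝ) + 1) ^ (N + 1) *
          ((wt m ^ 2)⁻¹ * (wt m ^ 2)⁻¹) * (((N : ℝ) + 1) ^ N * nrm p) := by
          refine Finset.sum_le_sum fun j hj => ?_
          have hj' : j + 1 ≤ N := by simpa using hj
          refine (nrm₁_coeff_le_nrm _ _).trans ((nrm_invShift_term_le hp _ hj').trans ?_)
          gcongr
          exact norm_inv_sub_pow_le' hj' m n
      _ = _ := by rw [Finset.sum_const, nsmul_eq_mul, Finset.card_range]; ring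

lemma wt_inv_mul_wt (m : ℕ) : (wt m ^ 2)⁻¹ * wt m = (wt m)⁻¹ := by
  have := (wt_pos m).ne'
  field_simp

lemma wt_inv_mul_inv (m : ℕ) : (wt m ^ 2)⁻¹ * (wt m)⁻¹ = (wt m ^ 3)⁻¹ := by
  have := (wt_pos m).ne'
  field_simp

lemma wt_inv_mul_inv_mul_wt (m : ℕ) : (wt m ^ 2)⁻¹ * (wt m ^ 2)⁻¹ * wt m = (wt m ^ 3)⁻¹ := by
  have := (wt_pos m).ne'
  field_simp

lemma harmE_intJ {N : ℕ} {G : FS} (h : Weak N G) (n a b : ℕ) :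
    HarmE 1 (fun m => ((co (intJ G) m n).coeff a).coeff b) := by
  have h1 : HarmE 1 (fun m => ∑ j ∈ Finset.range (N + 1),
      (((-1) ^ j * ((a + j).descFactorial j : ℂ)) *
        (((co G m n).coeff (a + j)).coeff b * pole n m ^ (j + 1)))) :=
    HarmE.sum _ fun j _ => (((h.harm n (a + j) b).mul_pole n (by omega)).smul (by
      exact mul_mem (pow_mem (by simp) _) (by simp)))
  refine h1.congr ?_
  filter_upwards [eventually_gt_atTop n] with m hm
  rw [co_intJ_of_ne G hm.ne', invShift_eq _ _ (h.td m n).natDegree_le, finsetSum_coeff,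
    finsetSum_coeff]
  refine Finset.sum_congr rfl fun j _ => ?_
  rw [coeff_smul, coeff_smul, coeff_iterate_derivative_LP, smul_eq_mul, pole, Int.cast_natCast]
  ring

lemma Weak.intJ {N : ℕ} {G : FS} (h : Weak N G) : Strong (N + 1) (intJ G) where
  td m n := by
    rw [co_intJ]
    refine (((h.td m n).invShift _).mono (Nat.le_succ N)).add ?_
    split_ifs
    · exact (h.td m n).antider
    · exact TD.zero
  mem m n := by
    rw [co_intJ]
    refine add_mem (by simpa using invShift_mem (h.mem m n) (m - n)) ?_
    split_ifs
    · exact antider_mem (h.mem m n)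
    · exact zero_mem _
  harm := harmE_intJ h
  bd₀ := by
    have h1 := h.bd₀.of_le (g := fun m n => 2 * ((n : ℝ) + 1) ^ 1 * (wt m ^ 2)⁻¹ *
      nrm₁ ((co G m n).coeff 0)) 2 1 (by norm_num) (fun m => by positivity)
      (fun m => (wt_inv_mul_inv m).le) (fun m n => le_rfl)
    have h2 := h.bd.of_le (g := fun m n => (N : ℝ) * (2 ^ (N + 1) * ((N : ℝ) + 1) ^ N) *
      ((n : ℝ) + 1) ^ (N + 1) * ((wt m ^ 2)⁻¹ * (wt m ^ 2)⁻¹) * nrm (co G m n))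
      ((N : ℝ) * (2 ^ (N + 1) * ((N : ℝ) + 1) ^ N)) (N + 1) (by positivity)
      (fun m => by positivity) (fun m => (wt_inv_mul_inv_mul_wt m).le) (fun m n => le_rfl)
    refine (PolyBd.add (fun m => by have := wt_pos m; positivity) h1 h2).mono fun m n => ?_
    have : (co (EllMZV.intJ G) m n).coeff 0 = (invShift ((m : ℂ) - n) (co G m n)).coeff 0 := by
      rw [co_intJ, coeff_add]
      split_ifs
      · rw [coeff_antider_zero, add_zero]
      · rw [coeff_zero, add_zero]
    rw [this]
    exact nrm₁_coeff_zero_invShift_le (h.td m n) m n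
  bd := by
    have h1 := h.bd.of_le (g := fun m n => nrm (invShift ((m : ℂ) - n) (co G m n))) _ _
      (by positivity) (fun m => by positivity) (fun m => (wt_inv_mul_wt m).le)
      (fun m n => nrm_invShift_le (h.td m n) m n)
    have h2 := h.bd.of_le (g := fun m n => nrm (if m = n then antider (co G m n) else 0)) 1 1
      zero_le_one (fun m => by positivity) (fun m => (wt_inv_mul_wt m).le) (fun m n => by
        split_ifs with hmn
        · subst hmn
          rw [wt_sq, one_mul, pow_one, mul_inv_cancel₀ (by positivity), one_mul]
          exact nrm_antider_le _
        · rw [map_zero]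
          have : 0 ≤ nrm (co G m n) := apply_nonneg _ _
          positivity)
    refine (PolyBd.add (fun m => by have := wt_pos m; positivity) h1 h2).mono fun m n => ?_
    rw [co_intJ]
    exact map_add_le_add nrm _ _

end EllMZV

namespace EllMZV

open Polynomial

/-! ### Multiplication by the kernels -/

lemma nrm_add_le (p q : LP) : nrm (p + q) ≤ nrm p + nrm q := map_add_le_add nrm p q

lemma nrm_mul_le (p q : LP) : nrm (p * q) ≤ nrm p * nrm q := map_mul_le_mul nrm p q

lemma nrm_nonneg (p : LP) : 0 ≤ nrm p := apply_nonneg nrm p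

lemma nrm₁_nonneg (p : ℂ[X]) : 0 ≤ nrm₁ p := apply_nonneg nrm₁ p

lemma coeff_coeff_mul (p q : LP) (a b : ℕ) : ((p * q).coeff a).coeff b =
    ∑ i ∈ Finset.HasAntidiagonal.antidiagonal a, ∑ j ∈ Finset.HasAntidiagonal.antidiagonal b,
      (p.coeff i.1).coeff j.1 * (q.coeff i.2).coeff j.2 := by
  simp only [coeff_mul, finsetSum_coeff]

namespace Cls

variable {N M b : ℕ} {u u' w w' : ℕ → ℝ} {f g : ℕ → ℕ → LP}

lemma add (hu : ∀ m, 0 ≤ u m) (hw : ∀ m, 0 ≤ w m) (hf : Cls N b u w f) (hg : Cls N b u w g) :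
    Cls N b u w (fun m n => f m n + g m n) where
  td m n := (hf.td m n).add (hg.td m n)
  mem m n := add_mem (hf.mem m n) (hg.mem m n)
  harm n a b' := ((hf.harm n a b').add (hg.harm n a b')).congr' fun m => by simp
  bd₀ := (PolyBd.add hu hf.bd₀ hg.bd₀).mono fun m n => by
    rw [coeff_add]; exact map_add_le_add nrm₁ _ _
  bd := (PolyBd.add hw hf.bd hg.bd).mono fun m n => nrm_add_le _ _

lemma mono {c : ℕ} (hN : N ≤ M) (hc : c ≤ b) (hu : ∀ m, u m ≤ u' m) (hw : ∀ m, w m ≤ w' m)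
    (hf : Cls N b u w f) : Cls M c u' w' f where
  td m n := (hf.td m n).mono hN
  mem := hf.mem
  harm n a b' := (hf.harm n a b').mono hc
  bd₀ := hf.bd₀.mono_wt hu
  bd := hf.bd.mono_wt hw

lemma of_bd₀ (hf : Cls N b u w f) (h : PolyBd u' fun m n => nrm₁ ((f m n).coeff 0)) :
    Cls N b u' w f := ⟨hf.td, hf.mem, hf.harm, h, hf.bd⟩

lemma harm_mul_left (hf : ∀ n a b', HarmE b (fun m => ((f m n).coeff a).coeff b')) {p : LP}
    (hp : p ∈ algLP) (n a b' : ℕ) : HarmE b (fun m => ((p * f m n).coeff a).coeff b') :=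
  (HarmE.sum _ fun i _ => HarmE.sum _ fun j _ => (hf n i.2 j.2).smul (hp i.1 j.1)).congr'
    fun m => (coeff_coeff_mul p (f m n) a b').symm

lemma mul_left (hf : Cls N b u w f) {p : LP} (hp : p ∈ algLP) (hM : TD M p) :
    Cls (M + N) b u w (fun m n => p * f m n) where
  td m n := hM.mul (hf.td m n)
  mem m n := mul_mem hp (hf.mem m n)
  harm := harm_mul_left hf.harm hp
  bd₀ := (hf.bd₀.const_mul (nrm₁_nonneg (p.coeff 0))).mono fun m n => by
    rw [mul_coeff_zero]; exact map_mul_le_mul nrm₁ _ _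
  bd := (hf.bd.const_mul (nrm_nonneg p)).mono fun m n => nrm_mul_le _ _

lemma sum_range {K : ℝ} (hK : 0 ≤ K) (h : ∀ m, ∑ i ∈ Finset.range m, w i ≤ K * w' m)
    (hf : Cls N 1 u w f) (hu : PolyBd u' fun m n => nrm₁ ((∑ i ∈ Finset.range m, f i n).coeff 0)) :
    Cls N 0 u' w' (fun m n => ∑ i ∈ Finset.range m, f i n) where
  td m n := TD.sum _ fun i _ => hf.td i n
  mem m n := sum_mem fun i _ => hf.mem i n
  harm n a b' := ((hf.harm n a b').sum_range fun m => hf.mem m n a b').congr' fun m => by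
    simp only [finsetSum_coeff]
  bd₀ := hu
  bd := (hf.bd.sum_range hK h).mono fun m n => seminorm_sum_le nrm _ _

lemma conv {q : ℕ → ℕ → LP} (hf : Cls N 1 u w f) (hw : ∀ m, 0 ≤ w m)
    (hw' : ∀ m j, j ≤ m → w (m - j) ≤ (j + 1) * w m) (hqt : ∀ m n, TD M (q m n))
    (hqm : ∀ m n, q m n ∈ algLP) (hqb : PolyBd (fun _ => 1) fun m n => nrm (q m n))
    (hq0 : ∀ m n, 2 * n < m → q m n = 0) :
    Cls (M + N) 1 w w (fun m n => ∑ i ∈ Finset.range (n + 1), ∑ j ∈ Finset.range (m + 1),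
      q j i * f (m - j) (n - i)) := by
  have hbd : PolyBd w fun m n => nrm (∑ i ∈ Finset.range (n + 1), ∑ j ∈ Finset.range (m + 1),
      q j i * f (m - j) (n - i)) := by
    refine (hf.bd.conv (fun m n => nrm_nonneg _) hw hw' hqb
      fun m n h => by rw [hq0 m n h, map_zero]).mono fun m n => ?_
    refine (seminorm_sum_le nrm _ _).trans (Finset.sum_le_sum fun i _ => ?_)
    exact (seminorm_sum_le nrm _ _).trans (Finset.sum_le_sum fun j _ => nrm_mul_le _ _)
  refine ⟨fun m n => TD.sum _ fun i _ => TD.sum _ fun j _ => (hqt _ _).mul (hf.td _ _),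
    fun m n => sum_mem fun i _ => sum_mem fun j _ => mul_mem (hqm _ _) (hf.mem _ _),
    fun n a b' => ?_, hbd.mono fun m n => nrm₁_coeff_le_nrm _ _, hbd⟩
  have h1 : HarmE 1 (fun m => ∑ i ∈ Finset.range (n + 1), ∑ j ∈ Finset.range (2 * n + 1),
      ((q j i * f (m - j) (n - i)).coeff a).coeff b') :=
    HarmE.sum _ fun i _ => HarmE.sum _ fun j _ =>
      (harm_mul_left hf.harm (hqm j i) (n - i) a b').shift_back_nat le_rfl j
  refine h1.congr ?_
  filter_upwards [eventually_ge_atTop (2 * n)] with m hm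
  simp only [finsetSum_coeff]
  refine Finset.sum_congr rfl fun i hi => ?_
  have hi' : i ≤ n := by simpa [Nat.lt_succ_iff] using hi
  refine Finset.sum_subset (Finset.range_subset_range.2 (by omega)) fun j _ hj => ?_
  rw [hq0 j i (by simp at hj; omega), zero_mul]
  simp

end Cls

lemma kerP_mem (k m n : ℕ) : kerP k m n ∈ algLP := by
  rw [kerP]
  split_ifs
  · exact pow_mem (add_mem (algLP_smul (by simp) C_X_mem_algLP) X_mem_algLP) k
  · exact zero_mem _

lemma kerP_td (k m n : ℕ) : TD k (kerP k m n) := by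
  rw [kerP]
  split_ifs
  · simpa using ((TD.C_X.smul ((n / (m - n) : ℕ) : ℂ)).add TD.X).pow k
  · exact TD.zero

lemma kerP_eq_zero (k : ℕ) {m n : ℕ} (h : m ≤ n ∨ (1 ≤ n ∧ 2 * n < m)) : kerP k m n = 0 := by
  rw [kerP, if_neg]
  rintro ⟨h1, h2⟩
  rcases h with h | ⟨h, h'⟩
  · omega
  · have := Nat.le_of_dvd h h2
    omega

lemma nrm_smul_C_X_add_le (c : ℕ) (k : ℕ) : nrm (((c : ℂ) • (C X : LP) + X) ^ k) ≤ ((c : ℝ) + 1) ^ k := by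
  refine (nrm_pow_le _ _).trans (pow_le_pow_left₀ (nrm_nonneg _) ?_ k)
  refine (nrm_add_le _ _).trans ?_
  rw [nrm_smul, nrm_C, nrm₁_X, nrm_X]
  simp

lemma nrm_kerP_le (k m n : ℕ) : nrm (kerP k m n) ≤ ((n : ℝ) + 1) ^ k := by
  rw [kerP]
  split_ifs
  · refine (nrm_smul_C_X_add_le _ k).trans ?_
    gcongr
    exact Nat.div_le_self _ _
  · rw [map_zero]; positivity

lemma nrm_flip_kerP_le (k m n : ℕ) : nrm (flip (kerP k n m)) ≤ ((n : ℝ) + 1) ^ k := by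
  rw [kerP]
  split_ifs with h
  · rw [map_pow, map_add, flip_smul, flip_C, flip_X]
    refine (nrm_pow_le _ _).trans (pow_le_pow_left₀ (nrm_nonneg _) ?_ k)
    refine (nrm_add_le _ _).trans ?_
    rw [nrm_smul, nrm_C, nrm₁_X]
    have h1 : nrm (C X - X : LP) ≤ 2 := by
      refine (map_sub_le_add nrm _ _).trans ?_
      rw [nrm_C, nrm₁_X, nrm_X]; norm_num
    have h2 : ((m / (n - m) : ℕ) : ℝ) + 1 ≤ n := by
      have := Nat.div_le_self m (n - m)
      exact_mod_cast (by omega : m / (n - m) + 1 ≤ n)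
    simp only [Complex.norm_natCast, mul_one]
    linarith
  · rw [map_zero, map_zero]; positivity

lemma bern_mem (n : ℕ) : bern n ∈ algLP :=
  sum_mem fun k _ => algLP_smul (by
    have := rat_mem (_root_.bernoulli k / ((k ! : ℚ) * ((n - k)! : ℚ)))
    push_cast at this
    exact this) (mul_mem (pow_mem C_X_mem_algLP _) (pow_mem X_mem_algLP _))

lemma bern_td (n : ℕ) : TD n (bern n) := TD.sum _ fun k hk => TD.smul _ (by
  have hk' : k ≤ n := by simpa [Nat.lt_succ_iff] using hk
  exact ((TD.C_X.pow k).mul (TD.X.pow (n - k))).mono (by omega))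

lemma inv_factorial_mem (k : ℕ) : (k ! : ℂ)⁻¹ ∈ mzvTwoPiIAlgebra := by
  simpa using inv_int_mem (k ! : ℤ)

lemma co_kerW_mem (k m n : ℕ) : co (kerW (k + 1)) m n ∈ algLP := by
  rw [co_kerW_succ]
  refine sub_mem ?_ (algLP_smul (inv_factorial_mem k) (mul_mem C_X_mem_algLP
    (add_mem (kerP_mem k m n) (algLP_smul (pow_mem (by simp) _) (flip_mem (kerP_mem k n m))))))
  split_ifs
  · exact bern_mem _
  · exact zero_mem _

lemma co_kerW_td (k m n : ℕ) : TD (k + 1) (co (kerW (k + 1)) m n) := by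
  rw [co_kerW_succ, sub_eq_add_neg]
  refine TD.add ?_ (TD.neg (TD.smul _ ?_))
  · split_ifs
    · exact bern_td _
    · exact TD.zero
  · rw [add_comm k]
    exact TD.C_X.mul ((kerP_td k m n).add (TD.smul _ (kerP_td k n m).flip))

lemma co_kerW_row (k m : ℕ) :
    co (kerW (k + 1)) (m + 1) 0 = (-(k ! : ℂ)⁻¹) • (C X * X ^ k) := by
  rw [co_kerW_succ, if_neg (by omega), kerP_eq_zero k (Or.inl (Nat.zero_le (m + 1))), kerP,
    if_pos (by simp)]
  simp

lemma co_kerW_eq_zero (k : ℕ) {m n : ℕ} (hn : 1 ≤ n) (h : 2 * n < m) :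
    co (kerW (k + 1)) m n = 0 := by
  rw [co_kerW_succ, if_neg (by omega), kerP_eq_zero k (Or.inr ⟨hn, h⟩),
    kerP_eq_zero k (Or.inl (by omega))]
  simp

lemma nrm_co_kerW_le (k m n : ℕ) :
    nrm (co (kerW (k + 1)) m n) ≤ (nrm (bern (k + 1)) + 2) * ((n : ℝ) + 1) ^ k * 1 := by
  have h0 : (1 : ℝ) ≤ ((n : ℝ) + 1) ^ k := one_le_pow₀ (by simp)
  rw [co_kerW_succ]
  refine (map_sub_le_add nrm _ _).trans ?_
  rw [mul_one, add_mul]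
  refine add_le_add ?_ ?_
  · split_ifs
    · exact le_mul_of_one_le_right (nrm_nonneg _) h0
    · rw [map_zero]; have := nrm_nonneg (bern (k + 1)); positivity
  · rw [nrm_smul]
    have h1 : ‖(k ! : ℂ)⁻¹‖ ≤ 1 := by
      rw [norm_inv, Complex.norm_natCast]
      exact inv_le_one_of_one_le₀ (by exact_mod_cast k.factorial_pos)
    refine (mul_le_of_le_one_left (nrm_nonneg _) h1).trans ((nrm_mul_le _ _).trans ?_)
    rw [nrm_C, nrm₁_X, one_mul, two_mul]
    refine (nrm_add_le _ _).trans (add_le_add (nrm_kerP_le k m n) ?_)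
    rw [nrm_smul, norm_pow, norm_neg, norm_one, one_pow, one_mul]
    exact nrm_flip_kerP_le k m n

/-- The kernel without the non-decaying part of its row `n = 0`. -/
noncomputable def kerQ (k m n : ℕ) : LP :=
  if n = 0 ∧ 1 ≤ m then 0 else co (kerW (k + 1)) m n

lemma co_kerW_mul (k : ℕ) (F : FS) (m n : ℕ) : co (kerW (k + 1) * F) m n =
    (-(k ! : ℂ)⁻¹) • (C X * X ^ k) * (∑ i ∈ Finset.range m, co F i n) +
      ∑ i ∈ Finset.range (n + 1), ∑ j ∈ Finset.range (m + 1),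
        kerQ k j i * co F (m - j) (n - i) := by
  have h : ∑ i ∈ Finset.range (n + 1), ∑ j ∈ Finset.range (m + 1),
      (co (kerW (k + 1)) j i - kerQ k j i) * co F (m - j) (n - i) =
      (-(k ! : ℂ)⁻¹) • (C X * X ^ k) * (∑ i ∈ Finset.range m, co F i n) := by
    rw [Finset.sum_eq_single_of_mem 0 (by simp), Finset.sum_range_succ', Finset.mul_sum,
      ← Finset.sum_range_reflect]
    · have h0 : kerQ k 0 0 = co (kerW (k + 1)) 0 0 := by rw [kerQ, if_neg (by omega)]
      rw [h0, sub_self, zero_mul, add_zero]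
      refine Finset.sum_congr rfl fun j hj => ?_
      have hj' := Finset.mem_range.1 hj
      rw [kerQ, if_pos (by omega), sub_zero, co_kerW_row, Nat.sub_zero,
        show m - (m - 1 - j + 1) = j by omega]
    · intro i _ hi
      refine Finset.sum_eq_zero fun j _ => ?_
      rw [kerQ, if_neg (by omega), sub_self, zero_mul]
  rw [← h, co_mul', ← Finset.sum_add_distrib]
  refine Finset.sum_congr rfl fun i _ => ?_
  rw [← Finset.sum_add_distrib]
  exact Finset.sum_congr rfl fun j _ => by ring

/-- The vanishing at `t = 0`. -/
def ZeroSum (F : FS) : Prop := ∀ n b, ∑' m, cf F m n 0 b = 0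

lemma Strong.norm_cf_le {N : ℕ} {F : FS} (h : Strong N F) : ∃ (C : ℝ) (A : ℕ), 0 ≤ C ∧
    ∀ m n b, ‖cf F m n 0 b‖ ≤ C * ((n : ℝ) + 1) ^ A * (wt m ^ 3)⁻¹ := by
  obtain ⟨C, A, hC, hb⟩ := h.bd₀
  exact ⟨C, A, hC, fun m n b => (norm_coeff_le_nrm₁ _ b).trans (hb m n)⟩

lemma Strong.summable {N : ℕ} {F : FS} (h : Strong N F) (n b : ℕ) :
    Summable fun m => cf F m n 0 b := by
  obtain ⟨C, A, _, hb⟩ := h.norm_cf_le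
  exact summable_of_wt fun m => hb m n b

lemma Strong.tsum_mem {N : ℕ} {F : FS} (h : Strong N F) (n b : ℕ) :
    ∑' m, cf F m n 0 b ∈ mzvTwoPiIAlgebra := by
  obtain ⟨d, hd⟩ := h.harm n 0 b
  exact hd.tsum_mem (fun m => h.mem m n 0 b) (h.summable n b)

lemma Strong.sum_range_bd₀ {N : ℕ} {F : FS} (h : Strong N F) (hz : ZeroSum F) :
    PolyBd (fun m => (wt m)⁻¹) fun m n => nrm₁ ((∑ i ∈ Finset.range m, co F i n).coeff 0) := by
  obtain ⟨C, A, hC, hb⟩ := h.norm_cf_le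
  refine ⟨(N + 1) * (4 * C), A, by positivity, fun m n => ?_⟩
  have htd : TD N (∑ i ∈ Finset.range m, co F i n) := TD.sum _ fun i _ => h.td i n
  have hdeg : ((∑ i ∈ Finset.range m, co F i n).coeff 0).natDegree ≤ N :=
    natDegree_le_iff_coeff_eq_zero.2 fun b hb => htd 0 b (by omega)
  beta_reduce
  rw [nrm₁, ell1_eq_sum _ _ hdeg]
  calc _ ≤ ∑ b ∈ Finset.range (N + 1), 4 * (C * ((n : ℝ) + 1) ^ A) * (wt m)⁻¹ := by
        refine Finset.sum_le_sum fun b _ => ?_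
        have := norm_tsum_sub_sum_range_le (fun i => hb i n b) m
        rw [hz n b, zero_sub, norm_neg] at this
        simpa only [normRingSeminorm_apply', finsetSum_coeff, cf] using this
    _ = _ := by rw [Finset.sum_const, nsmul_eq_mul, Finset.card_range]; push_cast; ring

lemma wt_inv_nonneg (m : ℕ) : 0 ≤ (wt m)⁻¹ := (inv_pos.2 (wt_pos m)).le

lemma inv_wt_le_wt (m : ℕ) : (wt m)⁻¹ ≤ wt m :=
  (inv_le_one_of_one_le₀ (one_le_wt m)).trans (one_le_wt m)

lemma Strong.kerW_mul {N : ℕ} {F : FS} (h : Strong N F) (k : ℕ) (hz : k = 1 → ZeroSum F) :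
    Weak (k + N) (kerW k * F) := by
  rcases k with _ | k
  · rw [kerW, one_mul, zero_add]
    refine Cls.mono le_rfl zero_le_one (fun m => ?_) inv_wt_le_wt h
    refine inv_anti₀ (wt_pos m) ?_
    exact le_self_pow₀ (one_le_wt m) (by norm_num)
  have hp : (-(k ! : ℂ)⁻¹) • (C X * X ^ k) ∈ algLP :=
    algLP_smul (neg_mem (inv_factorial_mem k)) (mul_mem C_X_mem_algLP (pow_mem X_mem_algLP k))
  have ht : TD (k + 1) ((-(k ! : ℂ)⁻¹) • (C X * X ^ k)) := by
    have := (TD.C_X.mul (TD.X.pow k)).smul (-(k ! : ℂ)⁻¹)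
    rwa [mul_one, add_comm] at this
  have h1 : Cls (k + 1 + N) 0 (fun m => (wt m)⁻¹) wt (fun m n =>
      (-(k ! : ℂ)⁻¹) • (C X * X ^ k) * (∑ i ∈ Finset.range m, co F i n)) := by
    rcases k.eq_zero_or_pos with rfl | hk
    · exact (h.sum_range (by norm_num) sum_inv_wt_le (h.sum_range_bd₀ (hz rfl))).mul_left hp ht
    · have h2 := (h.sum_range (by norm_num) sum_inv_wt_le
        ((h.bd.sum_range (by norm_num) sum_inv_wt_le).mono fun m n =>
          (nrm₁_coeff_le_nrm _ 0).trans (seminorm_sum_le nrm _ _))).mul_left hp ht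
      refine h2.of_bd₀ ⟨0, 0, le_rfl, fun m n => ?_⟩
      beta_reduce
      rw [mul_coeff_zero, coeff_smul, mul_coeff_zero, coeff_X_pow, if_neg (by omega)]
      simp
  have h2 : Cls (k + 1 + N) 0 (fun m => (wt m)⁻¹) wt (fun m n =>
      ∑ i ∈ Finset.range (n + 1), ∑ j ∈ Finset.range (m + 1),
        kerQ k j i * co F (m - j) (n - i)) := by
    refine Cls.mono le_rfl zero_le_one (fun _ => le_rfl) inv_wt_le_wt
      (Cls.conv h wt_inv_nonneg inv_wt_sub_le (fun m n => ?_) (fun m n => ?_)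
        ⟨nrm (bern (k + 1)) + 2, k, by have := nrm_nonneg (bern (k + 1)); positivity,
          fun m n => ?_⟩ fun m n hmn => ?_)
    · rw [kerQ]; split_ifs; exacts [TD.zero, co_kerW_td k m n]
    · rw [kerQ]; split_ifs; exacts [zero_mem _, co_kerW_mem k m n]
    · beta_reduce
      rw [kerQ]
      split_ifs
      · rw [map_zero]; have := nrm_nonneg (bern (k + 1)); positivity
      · exact nrm_co_kerW_le k m n
    · rw [kerQ]
      split_ifs with h0
      · rfl
      · exact co_kerW_eq_zero k (by omega) hmn
  have h3 : co (kerW (k + 1) * F) = fun m n => (-(k ! : ℂ)⁻¹) • (C X * X ^ k) *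
      (∑ i ∈ Finset.range m, co F i n) + ∑ i ∈ Finset.range (n + 1),
        ∑ j ∈ Finset.range (m + 1), kerQ k j i * co F (m - j) (n - i) :=
    funext fun m => funext fun n => co_kerW_mul k F m n
  rw [Weak, h3]
  exact h1.add wt_inv_nonneg (fun m => (wt_pos m).le) h2

end EllMZV

namespace EllMZV

open Polynomial

/-! ### The iterated integrals as formal series -/

/-- The constant of integration: minus the value at `t = 0`. -/
noncomputable def kap (N : ℕ) (F : FS) (n : ℕ) : ℂ[X] :=
  ∑ b ∈ Finset.range (N + 1), monomial b (-∑' m, cf F m n 0 b)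

lemma coeff_kap {N : ℕ} {F : FS} (h : Strong N F) (n b : ℕ) :
    (kap N F n).coeff b = -∑' m, cf F m n 0 b := by
  rw [kap, finsetSum_coeff]
  simp only [coeff_monomial]
  rw [Finset.sum_ite_eq' (Finset.range (N + 1)) b]
  split_ifs with hb
  · rfl
  · have : ∀ m, cf F m n 0 b = 0 := fun m => h.td m n 0 b (by
      have := Finset.mem_range.not.1 hb; omega)
    simp [this]

lemma Strong.diagS {N : ℕ} {k : ℕ → ℂ[X]} (hN : ∀ n b, N < b → (k n).coeff b = 0)
    (hk : ∀ n b, (k n).coeff b ∈ mzvTwoPiIAlgebra)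
    (hb : ∃ (C : ℝ) (A : ℕ), 0 ≤ C ∧ ∀ n, nrm₁ (k n) ≤ C * ((n : ℝ) + 1) ^ A) :
    Strong N (diagS k) := by
  obtain ⟨K, A, hK, hb⟩ := hb
  have hw : ∀ m : ℕ, 1 ≤ ((m : ℝ) + 1) ^ 2 * (wt m ^ 3)⁻¹ := fun m => by
    have h1 := wt_pos m
    rw [← div_eq_mul_inv, le_div_iff₀ (by positivity), one_mul, ← wt_sq, ← pow_mul]
    exact pow_le_pow_right₀ (one_le_wt m) (by norm_num)
  have hw' : ∀ m : ℕ, 1 ≤ ((m : ℝ) + 1) ^ 2 * (wt m)⁻¹ := fun m => by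
    have h1 := wt_pos m
    rw [← div_eq_mul_inv, le_div_iff₀ (by positivity), one_mul, ← wt_sq, ← pow_mul]
    exact le_self_pow₀ (one_le_wt m) (by norm_num)
  refine ⟨fun m n => ?_, fun m n => ?_, fun n a b => ?_, ⟨K, A + 2, hK, fun m n => ?_⟩,
    ⟨K, A + 2, hK, fun m n => ?_⟩⟩
  · rw [co_diagS]
    split_ifs
    · intro a b hab
      rw [coeff_C]
      split_ifs with h
      · exact hN n b (by omega)
      · rfl
    · exact TD.zero
  · rw [co_diagS]
    split_ifs
    · intro a b
      rw [coeff_C]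
      split_ifs
      · exact hk n b
      · exact zero_mem _
    · exact zero_mem _
  · refine HarmE.zero.congr (Filter.eventually_atTop.2 ⟨n + 1, fun m hm => ?_⟩)
    beta_reduce
    rw [co_diagS, if_neg (by omega)]
    simp
  · beta_reduce
    rw [co_diagS]
    split_ifs with h
    · subst h
      rw [coeff_C_zero, pow_add]
      calc _ ≤ K * ((m : ℝ) + 1) ^ A * 1 := by rw [mul_one]; exact hb m
        _ ≤ K * ((m : ℝ) + 1) ^ A * (((m : ℝ) + 1) ^ 2 * (wt m ^ 3)⁻¹) := by
          gcongr
          exact hw m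
        _ = _ := by ring
    · have := wt_pos m
      simp only [coeff_zero, map_zero]
      positivity
  · beta_reduce
    rw [co_diagS]
    split_ifs with h
    · subst h
      rw [nrm_C, pow_add]
      calc _ ≤ K * ((m : ℝ) + 1) ^ A * 1 := by rw [mul_one]; exact hb m
        _ ≤ K * ((m : ℝ) + 1) ^ A * (((m : ℝ) + 1) ^ 2 * (wt m)⁻¹) := by
          gcongr
          exact hw' m
        _ = _ := by ring
    · have := wt_pos m
      simp only [map_zero]
      positivity

lemma one_eq_diagS : (1 : FS) = diagS fun n => if n = 0 then 1 else 0 := fs_ext fun m n => by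
  rw [co_one, co_diagS]
  by_cases h : m = n
  · subst h
    by_cases h0 : m = 0 <;> simp [h0]
  · rw [if_neg (by omega), if_neg h]

lemma derD_one : derD 1 = 0 := by rw [one_eq_diagS, derD_diagS]

lemma Strong.one : Strong 0 1 := by
  rw [one_eq_diagS]
  refine Strong.diagS (fun n b hb => ?_) (fun n b => ?_) ⟨1, 0, zero_le_one, fun n => ?_⟩
  · split_ifs
    · rw [coeff_one, if_neg (by omega)]
    · rfl
  · split_ifs
    · rw [coeff_one]
      split_ifs
      exacts [one_mem _, zero_mem _]
    · exact zero_mem _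
  · split_ifs
    · rw [nrm₁_one]; simp
    · rw [map_zero]; simp

lemma Strong.diagS_kap {N : ℕ} {F : FS} (h : Strong N F) : Strong N (EllMZV.diagS (kap N F)) := by
  refine Strong.diagS (fun n b hb => ?_) (fun n b => ?_) ?_
  · rw [coeff_kap h]
    have : ∀ m, cf F m n 0 b = 0 := fun m => h.td m n 0 b (by omega)
    simp [this]
  · rw [coeff_kap h]
    exact neg_mem (h.tsum_mem n b)
  · obtain ⟨K, A, hK, hb⟩ := h.norm_cf_le
    refine ⟨(N + 1) * (4 * K), A, by positivity, fun n => ?_⟩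
    have hdeg : (kap N F n).natDegree ≤ N := natDegree_le_iff_coeff_eq_zero.2 fun b hb => by
      rw [coeff_kap h]
      have : ∀ m, cf F m n 0 b = 0 := fun m => h.td m n 0 b (by omega)
      simp [this]
    rw [nrm₁, ell1_eq_sum _ _ hdeg]
    calc _ ≤ ∑ b ∈ Finset.range (N + 1), 4 * (K * ((n : ℝ) + 1) ^ A) := by
          refine Finset.sum_le_sum fun b _ => ?_
          have := norm_tsum_sub_sum_range_le (fun i => hb i n b) 0
          rw [Finset.sum_range_zero, sub_zero, wt] at this
          rw [coeff_kap h, normRingSeminorm_apply', norm_neg]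
          simpa using this
      _ = _ := by rw [Finset.sum_const, nsmul_eq_mul, Finset.card_range]; push_cast; ring

lemma Strong.add {N : ℕ} {F G : FS} (hF : Strong N F) (hG : Strong N G) : Strong N (F + G) := by
  have h : co (F + G) = fun m n => co F m n + co G m n :=
    funext fun m => funext fun n => co_add F G m n
  rw [Strong, h]
  exact Cls.add (fun m => by have := wt_pos m; positivity) wt_inv_nonneg hF hG

/-- The primitive of `G` vanishing at `t = 0`. -/
noncomputable def prim (N : ℕ) (G : FS) : FS := intJ G + diagS (kap N (intJ G))

lemma derD_prim (N : ℕ) (G : FS) : derD (prim N G) = G := by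
  rw [prim, derD_add, derD_intJ, derD_diagS, add_zero]

lemma Weak.prim {N : ℕ} {G : FS} (h : Weak N G) : Strong (N + 1) (prim (N + 1) G) :=
  h.intJ.add h.intJ.diagS_kap

lemma Weak.zeroSum_prim {N : ℕ} {G : FS} (h : Weak N G) : ZeroSum (EllMZV.prim (N + 1) G) := by
  intro n b
  have h1 : ∀ m, cf (EllMZV.prim (N + 1) G) m n 0 b =
      cf (EllMZV.intJ G) m n 0 b + if m = n then (kap (N + 1) (EllMZV.intJ G) n).coeff b else 0 := by
    intro m
    rw [EllMZV.prim, cf, co_add, co_diagS, coeff_add, coeff_add, cf]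
    split_ifs <;> simp
  simp only [h1]
  rw [Summable.tsum_add (h.intJ.summable n b) (summable_of_ne_finset_zero (s := {n}) (by
    intro m hm
    rw [if_neg (by simpa using hm)])), tsum_ite_eq, coeff_kap h.intJ, add_neg_cancel]

/-- The words for which the iterated integral from `0` converges. -/
def Adm : List ℕ → Prop
  | [] => True
  | n :: v => (n = 1 → v ≠ []) ∧ Adm v

/-- The expansion of the iterated integral from `0` to `t`. -/
noncomputable def itS : List ℕ → FS
  | [] => 1
  | n :: v => prim (n + (v.sum + v.length) + 1) (kerW n * itS v)

lemma derD_itS_cons (n : ℕ) (v : List ℕ) : derD (itS (n :: v)) = kerW n * itS v := derD_prim _ _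

lemma strong_itS : ∀ {v : List ℕ}, Adm v →
    Strong (v.sum + v.length) (itS v) ∧ (v ≠ [] → ZeroSum (itS v))
  | [], _ => ⟨Strong.one, fun h => absurd rfl h⟩
  | n :: v, h => by
    have ih := strong_itS h.2
    have h1 : Weak (n + (v.sum + v.length)) (kerW n * itS v) :=
      ih.1.kerW_mul n fun hn => ih.2 (h.1 hn)
    refine ⟨?_, fun _ => h1.zeroSum_prim⟩
    have h2 := h1.prim
    rw [itS, List.sum_cons, List.length_cons]
    convert h2 using 1
    ring

/-! ### Vanishing of the part of degree `0` in `L` -/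

/-- Polynomials divisible by `L`. -/
noncomputable def divL : Ideal LP := RingHom.ker (mapRingHom (evalRingHom (0 : ℂ)))

lemma mem_divL {p : LP} : p ∈ divL ↔ ∀ a, (p.coeff a).coeff 0 = 0 := by
  rw [divL, RingHom.mem_ker, coe_mapRingHom, Polynomial.ext_iff]
  refine forall_congr' fun a => ?_
  rw [coeff_map, coeff_zero, coe_evalRingHom, coeff_zero_eq_eval_zero]

lemma smul_mem_divL (z : ℂ) {p : LP} (hp : p ∈ divL) : z • p ∈ divL :=
  mem_divL.2 fun a => by rw [coeff_smul, coeff_smul, mem_divL.1 hp, smul_zero]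

lemma derivative_mem_divL {p : LP} (hp : p ∈ divL) : derivative p ∈ divL := by
  rw [divL, RingHom.mem_ker, coe_mapRingHom] at hp ⊢
  rw [← derivative_map, hp, derivative_zero]

lemma invShift_mem_divL (z : ℂ) {p : LP} (hp : p ∈ divL) : invShift z p ∈ divL := by
  refine sum_mem fun j hj => smul_mem_divL _ ?_
  clear hj
  induction j with
  | zero => exact hp
  | succ j ih => rw [Function.iterate_succ_apply']; exact derivative_mem_divL ih

lemma antider_mem_divL {p : LP} (hp : p ∈ divL) : antider p ∈ divL := mem_divL.2 fun a => by
  rcases a with _ | a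
  · rw [coeff_antider_zero, coeff_zero]
  · rw [coeff_antider_succ, coeff_smul, mem_divL.1 hp, smul_zero]

lemma flip_mem_divL {p : LP} (hp : p ∈ divL) : flip p ∈ divL := by
  rw [divL, RingHom.mem_ker, coe_mapRingHom] at hp ⊢
  rw [flip_apply, Polynomial.map_comp, hp, zero_comp]

/-- Series whose coefficients of `x ^ m * y ^ n` are divisible by `L` for `(m, n) ≠ (0, 0)`. -/
def LV (F : FS) : Prop := ∀ m n, ¬(m = 0 ∧ n = 0) → co F m n ∈ divL

lemma LV.one : LV 1 := fun m n h => by rw [co_one, if_neg h]; exact zero_mem _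

lemma LV.mul {F G : FS} (hF : LV F) (hG : LV G) : LV (F * G) := fun m n h => by
  rw [co_mul']
  refine sum_mem fun i _ => sum_mem fun j _ => ?_
  by_cases hij : j = 0 ∧ i = 0
  · refine Ideal.mul_mem_left _ _ (hG _ _ ?_)
    rwa [hij.1, hij.2]
  · exact Ideal.mul_mem_right _ _ (hF _ _ hij)

lemma LV.add {F G : FS} (hF : LV F) (hG : LV G) : LV (F + G) := fun m n h => by
  rw [co_add]; exact add_mem (hF m n h) (hG m n h)

lemma LV.smul (z : ℂ) {F : FS} (hF : LV F) : LV (z • F) := fun m n h => by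
  rw [co_smul]; exact smul_mem_divL z (hF m n h)

lemma LV.sig {F : FS} (hF : LV F) : LV (sig F) := fun m n h => by
  rw [co_sig]; exact flip_mem_divL (hF n m fun h' => h ⟨h'.2, h'.1⟩)

lemma LV.kerW (k : ℕ) : LV (kerW k) := by
  rcases k with _ | k
  · exact LV.one
  · intro m n h
    have hC : (C X : LP) ∈ divL := mem_divL.2 fun a => by
      rw [coeff_C]; split_ifs <;> simp
    rw [co_kerW_succ, if_neg h, zero_sub]
    exact neg_mem (smul_mem_divL _ (Ideal.mul_mem_right _ _ hC))

lemma LV.intJ {F : FS} (hF : LV F) : LV (intJ F) := fun m n h => by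
  rw [co_intJ]
  refine add_mem (invShift_mem_divL _ (hF m n h)) ?_
  split_ifs
  · exact antider_mem_divL (hF m n h)
  · exact zero_mem _

lemma LV.prim {N : ℕ} {G : FS} (h : Strong N (EllMZV.intJ G)) (hG : LV G) :
    LV (prim N G) ∧ cf (EllMZV.prim N G) 0 0 0 0 = 0 := by
  have h1 : ∀ m n, cf (EllMZV.intJ G) m n 0 0 = 0 := fun m n => by
    by_cases hmn : m = 0 ∧ n = 0
    · rw [hmn.1, hmn.2, cf, co_intJ_diag, coeff_antider_zero, coeff_zero]
    · exact mem_divL.1 (hG.intJ m n hmn) 0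
  have h2 : ∀ n, (kap N (EllMZV.intJ G) n).coeff 0 = 0 := fun n => by
    rw [coeff_kap h]; simp [h1]
  have h3 : ∀ m n, co (EllMZV.diagS (kap N (EllMZV.intJ G))) m n ∈ divL := fun m n => by
    rw [co_diagS]
    split_ifs
    · refine mem_divL.2 fun a => ?_
      rw [coeff_C]
      split_ifs
      · exact h2 n
      · rw [coeff_zero]
    · exact zero_mem _
  refine ⟨hG.intJ.add fun m n _ => h3 m n, ?_⟩
  have := mem_divL.1 (h3 0 0) 0
  rw [EllMZV.prim, cf, co_add, coeff_add, coeff_add, this, add_zero]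
  exact h1 0 0

lemma LV.itS : ∀ {v : List ℕ}, Adm v → LV (itS v) ∧ (v ≠ [] → cf (EllMZV.itS v) 0 0 0 0 = 0)
  | [], _ => ⟨LV.one, fun h => absurd rfl h⟩
  | n :: v, h => by
    have ih := strong_itS h.2
    have h1 : Weak (n + (v.sum + v.length)) (EllMZV.kerW n * EllMZV.itS v) :=
      ih.1.kerW_mul n fun hn => ih.2 (h.1 hn)
    have := LV.prim h1.intJ ((LV.kerW n).mul (LV.itS h.2).1)
    exact ⟨this.1, fun _ => this.2⟩

/-! ### Regularity of coefficients -/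

/-- Coefficients of bounded degree in the algebra of multiple zeta values. -/
def Reg (N : ℕ) (F : FS) : Prop := ∀ m n, TD N (co F m n) ∧ co F m n ∈ algLP

lemma Strong.reg {N : ℕ} {F : FS} (h : Strong N F) : Reg N F := fun m n => ⟨h.td m n, h.mem m n⟩

namespace Reg

variable {N M : ℕ} {F G : FS}

lemma add (hF : Reg N F) (hG : Reg N G) : Reg N (F + G) := fun m n => by
  rw [co_add]
  exact ⟨(hF m n).1.add (hG m n).1, add_mem (hF m n).2 (hG m n).2⟩

lemma mul (hF : Reg N F) (hG : Reg M G) : Reg (N + M) (F * G) := fun m n => by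
  rw [co_mul']
  exact ⟨TD.sum _ fun i _ => TD.sum _ fun j _ => (hF _ _).1.mul (hG _ _).1,
    sum_mem fun i _ => sum_mem fun j _ => mul_mem (hF _ _).2 (hG _ _).2⟩

lemma sig (hF : Reg N F) : Reg N (sig F) := fun m n => by
  rw [co_sig]
  exact ⟨(hF n m).1.flip, flip_mem (hF n m).2⟩

lemma smul {z : ℂ} (hz : z ∈ mzvTwoPiIAlgebra) (hF : Reg N F) : Reg N (z • F) := fun m n => by
  rw [co_smul]
  exact ⟨(hF m n).1.smul z, algLP_smul hz (hF m n).2⟩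

end Reg

/-! ### Composition of paths -/

/-- The iterated integral from `t` to `1`, of the reversed word. -/
noncomputable def itR (u : List ℕ) : FS := ((-1 : ℂ) ^ u.sum) • sig (itS u)

lemma derD_smul (z : ℂ) (F : FS) : derD (z • F) = z • derD F := fs_ext fun m n => by
  simp only [co_derD, co_smul, derivative_smul, smul_add, smul_smul]
  rw [mul_comm]

lemma sig_one : sig 1 = 1 := fs_ext fun m n => by
  rw [co_sig, co_one, co_one]
  by_cases h : m = 0 ∧ n = 0
  · rw [if_pos h, if_pos ⟨h.2, h.1⟩, map_one]
  · rw [if_neg h, if_neg fun h' => h ⟨h'.2, h'.1⟩, map_zero]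

lemma itR_nil : itR [] = 1 := by rw [itR, itS, sig_one, List.sum_nil, pow_zero, one_smul]

lemma derD_itR_cons (n : ℕ) (u : List ℕ) : derD (itR (n :: u)) = -(kerW n * itR u) := by
  rw [itR, derD_smul, derD_sig, derD_itS_cons, sig_mul, sig_kerW, itR, List.sum_cons]
  rw [smul_mul_assoc, smul_neg, smul_smul, mul_smul_comm, pow_add, mul_right_comm, ← mul_pow]
  norm_num

/-- The composition of paths, telescoping to the full iterated integral. -/
noncomputable def pathS : List ℕ → List ℕ → FS
  | u, [] => itR u
  | u, n :: v => itR u * itS (n :: v) + pathS (n :: u) v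

lemma telescope {R : Type*} [CommRing R] (a b c k e : R) :
    a * b + c * (k * e) + -(k * c) * e = a * b := by ring

lemma derD_pathS : ∀ v u : List ℕ, derD (pathS u v) = derD (itR u) * itS v
  | [], u => by rw [pathS, itS, mul_one]
  | n :: v, u => by
    rw [pathS, derD_add, derD_mul, derD_pathS v, derD_itS_cons, derD_itR_cons]
    exact telescope _ _ _ _ _

lemma neg_one_pow_mem (k : ℕ) : (-1 : ℂ) ^ k ∈ mzvTwoPiIAlgebra :=
  pow_mem (neg_mem (one_mem _)) k

lemma reg_pathS : ∀ {v u : List ℕ}, Adm u → Adm v → (u = [] → v.head? ≠ some 1) →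
    Reg ((u.sum + u.length) + (v.sum + v.length)) (pathS u v)
  | [], u, hu, _, _ => by
    simpa [pathS, itR] using (strong_itS hu).1.reg.sig.smul (neg_one_pow_mem u.sum)
  | n :: v, u, hu, hv, h => by
    have h1 := ((strong_itS hu).1.reg.sig.smul (neg_one_pow_mem u.sum)).mul (strong_itS hv).1.reg
    have h2 := reg_pathS (v := v) (u := n :: u) ⟨fun hn hu' => by simp [hu', hn] at h, hu⟩ hv.2
      (by simp)
    refine h1.add ?_
    convert h2 using 1
    simp only [List.sum_cons, List.length_cons]
    ring

/-- Series whose constant term and coefficients of `L ^ 0` vanish. -/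
def LV₀ (F : FS) : Prop := LV F ∧ cf F 0 0 0 0 = 0

lemma LV₀.add {F G : FS} (hF : LV₀ F) (hG : LV₀ G) : LV₀ (F + G) := by
  refine ⟨hF.1.add hG.1, ?_⟩
  have h1 := hF.2
  have h2 := hG.2
  rw [cf] at *
  rw [co_add, coeff_add, coeff_add, h1, h2, add_zero]

lemma cf_zero_eq (F : FS) : cf F 0 0 0 0 = evLP 0 0 (co F 0 0) := by
  rw [cf, evLP]; simp [coeff_zero_eq_eval_zero]

lemma cf_zero_mul (F G : FS) : cf (F * G) 0 0 0 0 = cf F 0 0 0 0 * cf G 0 0 0 0 := by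
  simp only [cf_zero_eq, co_mul']
  simp

lemma cf_zero_itR (u : List ℕ) : cf (itR u) 0 0 0 0 = (-1 : ℂ) ^ u.sum * cf (itS u) 0 0 0 0 := by
  rw [cf_zero_eq, cf_zero_eq, itR, co_smul, evLP_smul, co_sig, evLP_flip, sub_zero]

lemma LV.itR {u : List ℕ} (hu : Adm u) : LV (itR u) := (LV.itS hu).1.sig.smul _

lemma lv₀_pathS : ∀ {v u : List ℕ}, Adm u → Adm v → (u = [] → v.head? ≠ some 1 ∧ v ≠ []) →
    LV₀ (pathS u v)
  | [], u, hu, _, h => by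
    refine ⟨LV.itR hu, ?_⟩
    rw [pathS, cf_zero_itR, (LV.itS hu).2 fun h' => (h h').2 rfl, mul_zero]
  | n :: v, u, hu, hv, h => by
    refine LV₀.add ⟨(LV.itR hu).mul (LV.itS hv).1, ?_⟩ (lv₀_pathS
      ⟨fun hn hu' => by simpa [hn] using (h hu').1, hu⟩ hv.2 (by simp))
    rw [cf_zero_mul, (LV.itS hv).2 (by simp), mul_zero]

/-- The coefficients of the `q`-expansion of the full iterated integral. -/
noncomputable def dcoef (v : List ℕ) (j b : ℕ) : ℂ := cf (pathS [] v) j j 0 b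

lemma dcoef_mem {v : List ℕ} (hv : Adm v) (h : v.head? ≠ some 1) (j b : ℕ) :
    dcoef v j b ∈ mzvTwoPiIAlgebra :=
  (reg_pathS (u := []) trivial hv fun _ => h) j j |>.2 0 b

lemma dcoef_eq_zero {v : List ℕ} (hv : Adm v) (h : v.head? ≠ some 1) (j : ℕ) {b : ℕ}
    (hb : v.sum + v.length < b) : dcoef v j b = 0 :=
  ((reg_pathS (u := []) trivial hv fun _ => h) j j).1 0 b (by simpa using hb)

lemma dcoef_zero {v : List ℕ} (hv : Adm v) (h : v.head? ≠ some 1) (hne : v ≠ []) (j : ℕ) :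
    dcoef v j 0 = 0 := by
  have := lv₀_pathS (u := []) trivial hv fun _ => ⟨h, hne⟩
  rcases Nat.eq_zero_or_pos j with rfl | hj
  · exact this.2
  · exact mem_divL.1 (this.1 j j (by omega)) 0

lemma pathS_eq (v : List ℕ) :
    pathS [] v = diagS fun j => (co (pathS [] v) j j).coeff 0 := by
  refine eq_diagS_of_derD_eq_zero ?_
  rw [derD_pathS, itR_nil, derD_one, zero_mul]

lemma evLP_pathS {v : List ℕ} (hv : Adm v) (h : v.head? ≠ some 1) (hne : v ≠ []) (L s : ℂ)
    (m n : ℕ) : evLP L s (co (pathS [] v) m n) = if m = n then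
      ∑ b ∈ Finset.Icc 1 (v.sum + v.length), dcoef v n b * L ^ b else 0 := by
  rw [pathS_eq, co_diagS]
  split_ifs
  · have hdeg : ((co (pathS [] v) n n).coeff 0).natDegree < v.sum + v.length + 1 :=
      Nat.lt_succ_iff.2 (natDegree_le_iff_coeff_eq_zero.2 fun b hb => dcoef_eq_zero hv h n hb)
    rw [evLP_C, eval_eq_sum_range' hdeg]
    symm
    refine Finset.sum_subset (fun b hb => ?_) fun b _ hb => ?_
    · rw [Finset.mem_range]; have := Finset.mem_Icc.1 hb; omega
    · have : b = 0 ∨ v.sum + v.length < b := by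
        rw [Finset.mem_Icc] at hb; omega
      rcases this with rfl | h'
      · exact mul_eq_zero_of_left (dcoef_zero hv h hne n) _
      · exact mul_eq_zero_of_left (dcoef_eq_zero hv h n h') _
  · rw [map_zero]

end EllMZV

namespace EllMZV

open Polynomial

/-! ### Evaluation of double series -/

lemma norm_eval_le {p : ℂ[X]} {N : ℕ} (hN : p.natDegree ≤ N) {K : ℝ} (hK : 1 ≤ K) {L : ℂ}
    (hL : ‖L‖ ≤ K) : ‖p.eval L‖ ≤ K ^ N * nrm₁ p := by
  rw [eval_eq_sum_range' (Nat.lt_succ_of_le hN), nrm₁, ell1_eq_sum _ _ hN, Finset.mul_sum]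
  refine (norm_sum_le _ _).trans (Finset.sum_le_sum fun b hb => ?_)
  have hb' : b ≤ N := Nat.lt_succ_iff.1 (Finset.mem_range.1 hb)
  rw [norm_mul, norm_pow, normRingSeminorm_apply', mul_comm]
  gcongr
  exact (pow_le_pow_left₀ (norm_nonneg _) hL b).trans (pow_le_pow_right₀ hK hb')

lemma TD.natDegree_coeff_le {N : ℕ} {p : LP} (h : TD N p) (a : ℕ) : (p.coeff a).natDegree ≤ N :=
  natDegree_le_iff_coeff_eq_zero.2 fun b hb => h a b (by omega)

lemma evLP_eq_sum {N : ℕ} {p : LP} (h : TD N p) (L s : ℂ) :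
    evLP L s p = ∑ a ∈ Finset.range (N + 1), (p.coeff a).eval L * s ^ a := by
  rw [evLP_eq, eval_eq_sum_range' (n := N + 1)
    (Nat.lt_succ_of_le (natDegree_map_le.trans h.natDegree_le))]
  simp only [coeff_map, coe_evalRingHom]

lemma norm_evLP_le {N : ℕ} {p : LP} (h : TD N p) {K : ℝ} (hK : 1 ≤ K) {L s : ℂ}
    (hL : ‖L‖ ≤ K) (hs : ‖s‖ ≤ K) : ‖evLP L s p‖ ≤ K ^ N * K ^ N * nrm p := by
  rw [evLP_eq_sum h, nrm, ell1_eq_sum _ _ h.natDegree_le, Finset.mul_sum]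
  refine (norm_sum_le _ _).trans (Finset.sum_le_sum fun a ha => ?_)
  have ha' : a ≤ N := Nat.lt_succ_iff.1 (Finset.mem_range.1 ha)
  have hK0 : 0 ≤ K := zero_le_one.trans hK
  rw [norm_mul, norm_pow, mul_right_comm]
  exact mul_le_mul (norm_eval_le (h.natDegree_coeff_le a) hK hL)
    ((pow_le_pow_left₀ (norm_nonneg _) hs a).trans (pow_le_pow_right₀ hK ha')) (by positivity)
    (mul_nonneg (by positivity) (nrm₁_nonneg _))

lemma norm_evLP_sub_le {N : ℕ} {p : LP} (h : TD N p) {K : ℝ} (hK : 1 ≤ K) {L s : ℂ}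
    (hL : ‖L‖ ≤ K) (hs : ‖s‖ ≤ K) :
    ‖evLP L s p - (p.coeff 0).eval L‖ ≤ ‖s‖ * (K ^ N * K ^ N * nrm p) := by
  have hK0 : 0 ≤ K := zero_le_one.trans hK
  rw [evLP_eq_sum h, Finset.sum_range_succ', pow_zero, mul_one, add_sub_cancel_right, nrm,
    ell1_eq_sum _ _ h.natDegree_le, Finset.sum_range_succ', mul_add, mul_add]
  refine le_add_of_le_of_nonneg ?_ (mul_nonneg (norm_nonneg _)
    (mul_nonneg (by positivity) (apply_nonneg nrm₁ _)))
  rw [Finset.mul_sum, Finset.mul_sum]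
  refine (norm_sum_le _ _).trans (Finset.sum_le_sum fun a ha => ?_)
  have ha' : a ≤ N := (Finset.mem_range.1 ha).le
  have h1 := norm_eval_le (h.natDegree_coeff_le (a + 1)) hK hL
  have h2 := (pow_le_pow_left₀ (norm_nonneg _) hs a).trans (pow_le_pow_right₀ hK ha')
  rw [norm_mul, norm_pow, pow_succ]
  calc _ = ‖s‖ * (‖(p.coeff (a + 1)).eval L‖ * ‖s‖ ^ a) := by ring
    _ ≤ ‖s‖ * (K ^ N * nrm₁ (p.coeff (a + 1)) * K ^ N) := by gcongr
    _ = _ := by ring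

/-- Polynomial growth of the coefficients, locally uniformly in `L` and `s`. -/
def PB (F : FS) : Prop := ∀ K : ℝ, ∃ (B : ℝ) (A : ℕ), 0 ≤ B ∧ ∀ L s : ℂ, ‖L‖ ≤ K → ‖s‖ ≤ K →
  ∀ m n, ‖evLP L s (co F m n)‖ ≤ B * (((m : ℝ) + 1) ^ A * ((n : ℝ) + 1) ^ A)

lemma PB.of_nrm {N : ℕ} {F : FS} (h : ∀ m n, TD N (co F m n)) {B : ℝ} {A : ℕ} (hB : 0 ≤ B)
    (hb : ∀ m n, nrm (co F m n) ≤ B * (((m : ℝ) + 1) ^ A * ((n : ℝ) + 1) ^ A)) : PB F := by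
  intro K
  set K' := max 1 K
  have hK : 1 ≤ K' := le_max_left _ _
  have hK0 : 0 ≤ K' := zero_le_one.trans hK
  refine ⟨K' ^ N * K' ^ N * B, A, by positivity, fun L s hL hs m n => ?_⟩
  refine (norm_evLP_le (h m n) hK (hL.trans (le_max_right _ _)) (hs.trans (le_max_right _ _))).trans
    ?_
  rw [mul_assoc _ B]
  exact mul_le_mul_of_nonneg_left (hb m n) (by positivity)

lemma Cls.pb {N b : ℕ} {u w : ℕ → ℝ} {F : FS} (h : Cls N b u w (co F))
    (hw : ∀ m, w m ≤ (m : ℝ) + 1) : PB F := by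
  obtain ⟨B, A, hB, hb⟩ := h.bd
  refine PB.of_nrm h.td (A := A + 1) hB fun m n => (hb m n).trans ?_
  rw [mul_assoc]
  refine mul_le_mul_of_nonneg_left ?_ hB
  have h1 : (1 : ℝ) ≤ (m : ℝ) + 1 := by simp
  have h2 : (1 : ℝ) ≤ (n : ℝ) + 1 := by simp
  calc ((n : ℝ) + 1) ^ A * w m ≤ ((n : ℝ) + 1) ^ (A + 1) * ((m : ℝ) + 1) := by
        refine mul_le_mul_of_nonneg_left (hw m) (by positivity) |>.trans ?_
        gcongr
        simp
    _ ≤ ((n : ℝ) + 1) ^ (A + 1) * ((m : ℝ) + 1) ^ (A + 1) := by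
        gcongr
        exact le_self_pow₀ h1 (by omega)
    _ = _ := mul_comm _ _

lemma wt_le (m : ℕ) : wt m ≤ (m : ℝ) + 1 := by
  rw [← wt_sq]; exact le_self_pow₀ (one_le_wt m) (by norm_num)

lemma Strong.pb {N : ℕ} {F : FS} (h : Strong N F) : PB F :=
  Cls.pb h fun m => (inv_wt_le_wt m).trans (wt_le m)

lemma pb_kerW (k : ℕ) : PB (kerW k) := by
  rcases k with _ | k
  · exact Strong.one.pb
  · refine PB.of_nrm (co_kerW_td k) (B := nrm (bern (k + 1)) + 2) (A := k)
      (by have := nrm_nonneg (bern (k + 1)); positivity) fun m n => ?_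
    refine (nrm_co_kerW_le k m n).trans ?_
    rw [mul_one]
    refine mul_le_mul_of_nonneg_left (le_mul_of_one_le_left (by positivity)
      (one_le_pow₀ (by simp))) (by have := nrm_nonneg (bern (k + 1)); positivity)

namespace PB

variable {F G : FS}

lemma add (hF : PB F) (hG : PB G) : PB (F + G) := fun K => by
  obtain ⟨B, A, hB, h⟩ := hF K
  obtain ⟨B', A', hB', h'⟩ := hG K
  refine ⟨B + B', A + A', by positivity, fun L s hL hs m n => ?_⟩
  have h1 : (1 : ℝ) ≤ (m : ℝ) + 1 := by simp
  have h2 : (1 : ℝ) ≤ (n : ℝ) + 1 := by simp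
  rw [co_add, map_add, add_mul]
  refine (norm_add_le _ _).trans (add_le_add ((h L s hL hs m n).trans ?_)
    ((h' L s hL hs m n).trans ?_)) <;> gcongr <;> omega

lemma mul (hF : PB F) (hG : PB G) : PB (F * G) := fun K => by
  obtain ⟨B, A, hB, h⟩ := hF K
  obtain ⟨B', A', hB', h'⟩ := hG K
  refine ⟨B * B', A + A' + 1, by positivity, fun L s hL hs m n => ?_⟩
  rw [co_mul', map_sum]
  refine (norm_sum_le _ _).trans ?_
  calc _ ≤ ∑ i ∈ Finset.range (n + 1), ∑ j ∈ Finset.range (m + 1),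
        B * (((m : ℝ) + 1) ^ A * ((n : ℝ) + 1) ^ A) *
          (B' * (((m : ℝ) + 1) ^ A' * ((n : ℝ) + 1) ^ A')) := by
        refine Finset.sum_le_sum fun i hi => ?_
        rw [map_sum]
        refine (norm_sum_le _ _).trans (Finset.sum_le_sum fun j hj => ?_)
        have hi' : (i : ℝ) ≤ n := by
          exact_mod_cast Nat.lt_succ_iff.1 (Finset.mem_range.1 hi)
        have hj' : (j : ℝ) ≤ m := by
          exact_mod_cast Nat.lt_succ_iff.1 (Finset.mem_range.1 hj)
        have hi2 : ((n - i : ℕ) : ℝ) ≤ n := by exact_mod_cast Nat.sub_le n i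
        have hj2 : ((m - j : ℕ) : ℝ) ≤ m := by exact_mod_cast Nat.sub_le m j
        rw [map_mul, norm_mul]
        refine mul_le_mul ((h L s hL hs j i).trans ?_) ((h' L s hL hs _ _).trans ?_)
          (norm_nonneg _) (by positivity) <;> gcongr
    _ = _ := by
        simp only [Finset.sum_const, Finset.card_range, nsmul_eq_mul]
        push_cast
        ring

lemma smul (z : ℂ) (hF : PB F) : PB (z • F) := fun K => by
  obtain ⟨B, A, hB, h⟩ := hF K
  refine ⟨‖z‖ * B, A, by positivity, fun L s hL hs m n => ?_⟩
  rw [co_smul, evLP_smul, norm_mul, mul_assoc]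
  exact mul_le_mul_of_nonneg_left (h L s hL hs m n) (norm_nonneg _)

lemma sig (hF : PB F) : PB (sig F) := fun K => by
  obtain ⟨B, A, hB, h⟩ := hF (2 * |K|)
  refine ⟨B, A, hB, fun L s hL hs m n => ?_⟩
  have h1 := le_abs_self K
  rw [co_sig, evLP_flip, mul_comm (((m : ℝ) + 1) ^ A)]
  exact h L (L - s) (by linarith [abs_nonneg K]) ((norm_sub_le _ _).trans (by linarith)) n m

end PB

/-- The terms of the evaluation of a double series at `s = L t`, `x = exp s`, `y = exp (L - s)`. -/
noncomputable def tm (L : ℂ) (F : FS) (t : ℝ) (p : ℕ × ℕ) : ℂ :=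
  evLP L (L * t) (co F p.1 p.2) *
    (Complex.exp (L * t) ^ p.1 * Complex.exp (L * (1 - t)) ^ p.2)

/-- The evaluation of a double series at `s = L t`, `x = exp s`, `y = exp (L - s)`. -/
noncomputable def ev (L : ℂ) (F : FS) (t : ℝ) : ℂ := ∑' p, tm L F t p

lemma norm_exp_mul (L : ℂ) (t : ℝ) : ‖Complex.exp (L * t)‖ = Real.exp (L.re * t) := by
  rw [Complex.norm_exp]; simp

lemma norm_exp_mul_one_sub (L : ℂ) (t : ℝ) :
    ‖Complex.exp (L * (1 - t))‖ = Real.exp (L.re * (1 - t)) := by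
  have := norm_exp_mul L (1 - t)
  push_cast at this
  exact this

lemma summable_geom (A : ℕ) {r : ℝ} (h0 : 0 ≤ r) (h1 : r < 1) :
    Summable fun m : ℕ => ((m : ℝ) + 1) ^ A * r ^ m := by
  have h2 : ∀ m : ℕ, ((m : ℝ) + 1) ^ A * r ^ m ≤ 2 ^ A * ((m : ℝ) ^ A * r ^ m + r ^ m) := by
    intro m
    rcases Nat.eq_zero_or_pos m with rfl | hm
    · have : (1 : ℝ) ≤ 2 ^ A := one_le_pow₀ (by norm_num)
      have h3 : (0 : ℝ) ≤ 0 ^ A := by positivity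
      simp only [Nat.cast_zero, zero_add, one_pow, pow_zero, mul_one]
      nlinarith
    · have hm' : (1 : ℝ) ≤ m := by exact_mod_cast hm
      have : ((m : ℝ) + 1) ^ A ≤ 2 ^ A * (m : ℝ) ^ A := by
        rw [← mul_pow]; gcongr; linarith
      have h4 : 0 ≤ r ^ m := pow_nonneg h0 m
      have h5 : (0 : ℝ) ≤ 2 ^ A * r ^ m := by positivity
      nlinarith
  refine Summable.of_nonneg_of_le (fun m => by positivity) h2 (Summable.mul_left _
    (Summable.add ?_ (summable_geometric_of_lt_one h0 h1)))
  exact summable_pow_mul_geometric_of_norm_lt_one A (by rwa [Real.norm_of_nonneg h0])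

lemma summable_geom₂ (A A' : ℕ) (B : ℝ) {r ρ : ℝ} (h0 : 0 ≤ r) (h1 : r < 1) (h0' : 0 ≤ ρ)
    (h1' : ρ < 1) : Summable fun p : ℕ × ℕ =>
      B * (((p.1 : ℝ) + 1) ^ A * ((p.2 : ℝ) + 1) ^ A') * (r ^ p.1 * ρ ^ p.2) := by
  have := ((summable_geom A h0 h1).mul_of_nonneg (summable_geom A' h0' h1')
    (fun m => by positivity) fun m => by positivity).mul_left B
  refine this.congr fun p => ?_
  ring

lemma norm_tm_le {L : ℂ} {F : FS} {B : ℝ} {A : ℕ} {t r ρ : ℝ} {p : ℕ × ℕ}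
    (h : ‖evLP L (L * t) (co F p.1 p.2)‖ ≤ B * (((p.1 : ℝ) + 1) ^ A * ((p.2 : ℝ) + 1) ^ A))
    (hr : Real.exp (L.re * t) ≤ r) (hρ : Real.exp (L.re * (1 - t)) ≤ ρ) :
    ‖tm L F t p‖ ≤
      B * (((p.1 : ℝ) + 1) ^ A * ((p.2 : ℝ) + 1) ^ A) * (r ^ p.1 * ρ ^ p.2) := by
  have h0 := (norm_nonneg _).trans h
  have h1 := (Real.exp_pos (L.re * t)).le.trans hr
  rw [tm, norm_mul, norm_mul, norm_pow, norm_pow, norm_exp_mul, norm_exp_mul_one_sub]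
  gcongr

lemma norm_mul_ofReal_le (L : ℂ) {t : ℝ} (h0 : 0 ≤ t) (h1 : t ≤ 1) : ‖L * (t : ℂ)‖ ≤ ‖L‖ := by
  rw [norm_mul, Complex.norm_real, Real.norm_of_nonneg h0]
  exact mul_le_of_le_one_right (norm_nonneg _) h1

lemma exp_mul_lt_one {L : ℂ} (hL : L.re < 0) {t : ℝ} (h0 : 0 < t) : Real.exp (L.re * t) < 1 := by
  rw [Real.exp_lt_one_iff]; exact mul_neg_of_neg_of_pos hL h0

lemma PB.summable {F : FS} (hF : PB F) {L : ℂ} (hL : L.re < 0) {t : ℝ} (h0 : 0 < t) (h1 : t < 1) :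
    Summable fun p => ‖tm L F t p‖ := by
  obtain ⟨B, A, hB, h⟩ := hF ‖L‖
  exact Summable.of_nonneg_of_le (fun _ => norm_nonneg _)
    (fun p => norm_tm_le (h L _ le_rfl (norm_mul_ofReal_le L h0.le h1.le) p.1 p.2) le_rfl le_rfl)
    (summable_geom₂ A A B (Real.exp_pos _).le (exp_mul_lt_one hL h0) (Real.exp_pos _).le
      (exp_mul_lt_one hL (sub_pos.2 h1)))

lemma ev_add {F G : FS} (hF : PB F) (hG : PB G) {L : ℂ} (hL : L.re < 0) {t : ℝ} (h0 : 0 < t)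
    (h1 : t < 1) : ev L (F + G) t = ev L F t + ev L G t := by
  rw [ev, ev, ev, ← (hF.summable hL h0 h1).of_norm.tsum_add (hG.summable hL h0 h1).of_norm]
  refine tsum_congr fun p => ?_
  rw [tm, tm, tm, co_add, map_add, add_mul]

lemma ev_smul (z : ℂ) (F : FS) (L : ℂ) (t : ℝ) : ev L (z • F) t = z * ev L F t := by
  rw [ev, ev, ← tsum_mul_left]
  refine tsum_congr fun p => ?_
  rw [tm, tm, co_smul, evLP_smul, mul_assoc]

lemma ev_sig (F : FS) (L : ℂ) (t : ℝ) : ev L (sig F) t = ev L F (1 - t) := by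
  rw [ev, ev, ← (Equiv.prodComm ℕ ℕ).tsum_eq]
  refine tsum_congr fun p => ?_
  rw [tm, tm, Equiv.prodComm_apply, co_sig, evLP_flip]
  push_cast
  simp only [Prod.fst_swap, Prod.snd_swap]
  rw [show L - L * t = L * (1 - t) by ring, show L * (1 - (1 - (t : ℂ))) = L * t by ring,
    mul_comm (Complex.exp (L * t) ^ _)]

/-- The transposition of pairs of pairs. -/
def pairEmb : (ℕ × ℕ) × (ℕ × ℕ) ↪ (ℕ × ℕ) × (ℕ × ℕ) where
  toFun q := ((q.2.1, q.1.1), (q.2.2, q.1.2))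
  inj' := by
    intro a b h
    simp only [Prod.mk.injEq] at h
    ext <;> tauto

lemma pairEmb_apply (i j : ℕ × ℕ) : pairEmb (i, j) = ((j.1, i.1), (j.2, i.2)) := rfl

/-- Antidiagonals in `ℕ × ℕ`. -/
@[reducible]
def prodAntidiagonal : Finset.HasAntidiagonal (ℕ × ℕ) where
  antidiagonal p := (Finset.HasAntidiagonal.antidiagonal p.2 ×ˢ
    Finset.HasAntidiagonal.antidiagonal p.1).map pairEmb
  mem_antidiagonal {p q} := by
    simp only [Finset.mem_map, Finset.mem_product, Finset.HasAntidiagonal.mem_antidiagonal]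
    constructor
    · rintro ⟨⟨i, j⟩, ⟨h1, h2⟩, rfl⟩
      simp only [pairEmb_apply, Prod.mk_add_mk]
      exact Prod.ext h2 h1
    · rintro rfl
      exact ⟨((q.1.2, q.2.2), (q.1.1, q.2.1)), ⟨rfl, rfl⟩, rfl⟩

lemma ev_mul {F G : FS} (hF : PB F) (hG : PB G) {L : ℂ} (hL : L.re < 0) {t : ℝ} (h0 : 0 < t)
    (h1 : t < 1) : ev L (F * G) t = ev L F t * ev L G t := by
  let _ := prodAntidiagonal
  have hf := hF.summable hL h0 h1
  have hg := hG.summable hL h0 h1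
  rw [ev, ev, ev, hf.of_norm.tsum_mul_tsum_eq_tsum_sum_antidiagonal hg.of_norm
    (summable_mul_of_summable_norm hf hg)]
  refine tsum_congr fun p => ?_
  refine Eq.trans ?_ (Finset.sum_map (Finset.HasAntidiagonal.antidiagonal p.2 ×ˢ
    Finset.HasAntidiagonal.antidiagonal p.1) pairEmb
      fun kl => tm L F t kl.1 * tm L G t kl.2).symm
  simp only [Finset.sum_product, pairEmb_apply]
  rw [tm, co_mul, map_sum, Finset.sum_mul]
  refine Finset.sum_congr rfl fun i hi => ?_
  rw [map_sum, Finset.sum_mul]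
  refine Finset.sum_congr rfl fun j hj => ?_
  simp only [Finset.HasAntidiagonal.mem_antidiagonal] at hi hj
  simp only [tm]
  rw [← hi, ← hj, map_mul, pow_add, pow_add]
  ring

end EllMZV

namespace EllMZV

open Polynomial

lemma hasDerivAt_tm (L : ℂ) (F : FS) (p : ℕ × ℕ) (t : ℝ) :
    HasDerivAt (fun t : ℝ => tm L F t p) (L * tm L (derD F) t p) t := by
  set P := (co F p.1 p.2).map (evalRingHom L) with hP
  have hl : HasDerivAt (fun z : ℂ => L * z) L t := by
    simpa using (hasDerivAt_id (t : ℂ)).const_mul L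
  have hr : HasDerivAt (fun z : ℂ => L * (1 - z)) (-L) t := by
    simpa using ((hasDerivAt_id (t : ℂ)).const_sub 1).const_mul L
  have h1 : HasDerivAt (fun z : ℂ => P.eval (L * z)) ((derivative P).eval (L * t) * L) t :=
    (P.hasDerivAt (L * t)).comp (t : ℂ) hl
  have h2 : HasDerivAt (fun z : ℂ => Complex.exp ((p.1 : ℂ) * (L * z)))
      (Complex.exp ((p.1 : ℂ) * (L * t)) * ((p.1 : ℂ) * L)) t := (hl.const_mul (p.1 : ℂ)).cexp
  have h3 : HasDerivAt (fun z : ℂ => Complex.exp ((p.2 : ℂ) * (L * (1 - z))))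
      (Complex.exp ((p.2 : ℂ) * (L * (1 - t))) * ((p.2 : ℂ) * -L)) t :=
    (hr.const_mul (p.2 : ℂ)).cexp
  have h4 := (h1.mul (h2.mul h3)).comp_ofReal
  refine (h4.congr_deriv ?_).congr_of_eventuallyEq (Eventually.of_forall fun u => ?_)
  · rw [tm, co_derD, map_add, evLP_smul, evLP_eq, evLP_eq, ← hP, ← derivative_map, ← hP,
      Complex.exp_nat_mul, Complex.exp_nat_mul]
    simp only [Pi.mul_apply]
    rw [Complex.exp_nat_mul, Complex.exp_nat_mul]
    ring
  · simp only [tm, Pi.mul_apply]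
    rw [evLP_eq, Complex.exp_nat_mul, Complex.exp_nat_mul]

lemma exp_mul_le_exp_mul {L : ℂ} (hL : L.re < 0) {a t : ℝ} (h : a ≤ t) :
    Real.exp (L.re * t) ≤ Real.exp (L.re * a) :=
  Real.exp_le_exp.2 (mul_le_mul_of_nonpos_left h hL.le)

lemma hasDerivAt_ev {F : FS} (hF : PB F) (hD : PB (derD F)) {L : ℂ} (hL : L.re < 0) {t : ℝ}
    (h0 : 0 < t) (h1 : t < 1) : HasDerivAt (ev L F) (L * ev L (derD F) t) t := by
  obtain ⟨B, A, hB, h⟩ := hD ‖L‖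
  have hs := (summable_geom₂ A A B (Real.exp_pos (L.re * (t / 2))).le
    (exp_mul_lt_one hL (by linarith)) (Real.exp_pos (L.re * ((1 - t) / 2))).le
      (exp_mul_lt_one hL (by linarith))).mul_left ‖L‖
  have := hasDerivAt_tsum_of_isPreconnected hs (isOpen_Ioo (a := t / 2) (b := (1 + t) / 2))
    isPreconnected_Ioo (fun p u _ => hasDerivAt_tm L F p u) (fun p u hu => ?_)
    (y₀ := t) ⟨by linarith, by linarith⟩ (hF.summable hL h0 h1).of_norm (y := t)
    ⟨by linarith, by linarith⟩
  · rw [tsum_mul_left] at this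
    exact this
  · rw [norm_mul]
    refine mul_le_mul_of_nonneg_left (norm_tm_le (h L _ le_rfl
      (norm_mul_ofReal_le L (by linarith [hu.1]) (by linarith [hu.2])) p.1 p.2)
      (exp_mul_le_exp_mul hL hu.1.le) (exp_mul_le_exp_mul hL (by linarith [hu.2])))
      (norm_nonneg _)

lemma mul_exp_le {c t : ℝ} (hc : 0 < c) (h0 : 0 ≤ t) (h1 : t ≤ 1) (m : ℕ) :
    t * Real.exp (-c * t) ^ m ≤ (1 + c⁻¹) * (wt m ^ 2)⁻¹ := by
  rw [wt_sq, ← div_eq_mul_inv, le_div_iff₀ (by positivity), ← Real.exp_nat_mul]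
  have h2 : Real.exp (m * (-c * t)) ≤ 1 := Real.exp_le_one_iff.2 (by
    have : 0 ≤ (m : ℝ) * (c * t) := by positivity
    linarith)
  have h3 : c * (m * t) * Real.exp (m * (-c * t)) ≤ 1 := by
    have h4 := Real.add_one_le_exp (m * (c * t))
    have h5 : Real.exp (m * (-c * t)) = (Real.exp (m * (c * t)))⁻¹ := by
      rw [← Real.exp_neg]; ring_nf
    rw [h5, ← div_eq_mul_inv, div_le_one (Real.exp_pos _)]
    linarith
  have h6 : m * t * Real.exp (m * (-c * t)) ≤ c⁻¹ := by
    rw [← one_div, le_div_iff₀ hc]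
    linarith
  have h7 : t * Real.exp (m * (-c * t)) ≤ 1 := mul_le_one₀ h1 (Real.exp_pos _).le h2
  linarith

lemma Strong.tendsto_ev {N : ℕ} {F : FS} (h : Strong N F) (hz : ZeroSum F) {L : ℂ}
    (hL : L.re < 0) : Tendsto (ev L F) (𝓝[>] 0) (𝓝 0) := by
  obtain ⟨B, A, hB, hb⟩ := h.bd₀
  obtain ⟨B', A', hB', hb'⟩ := h.bd
  set K := max 1 ‖L‖
  have hK : 1 ≤ K := le_max_left _ _
  have hLK : ‖L‖ ≤ K := le_max_right _ _
  have hK0 : 0 ≤ K := zero_le_one.trans hK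
  set c := -L.re with hc
  have hc0 : 0 < c := neg_pos.2 hL
  set ρ := Real.exp (L.re * (1 / 2)) with hρ
  have hρ0 : 0 ≤ ρ := (Real.exp_pos _).le
  have hρ1 : ρ < 1 := exp_mul_lt_one hL (by norm_num)
  set g : ℕ × ℕ → ℂ := fun p =>
    ((co F p.1 p.2).coeff 0).eval L * Complex.exp L ^ p.2 with hg
  set bound : ℕ × ℕ → ℝ := fun p => (wt p.1 ^ 3)⁻¹ *
    ((K ^ N * B + ‖L‖ * (1 + c⁻¹) * (K ^ N * K ^ N * B')) *
      (((p.2 : ℝ) + 1) ^ (A + A') * ρ ^ p.2)) with hbound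
  have hsum : Summable bound := by
    refine summable_inv_wt.mul_of_nonneg ((summable_geom (A + A') hρ0 hρ1).mul_left _)
      (fun m => ?_) (fun n => ?_)
    · have := wt_pos m
      positivity
    · simp only [Pi.zero_apply]
      positivity
  have hlim : ∀ p, Tendsto (fun t => tm L F t p) (𝓝[>] 0) (𝓝 (g p)) := fun p => by
    have h1 := ((hasDerivAt_tm L F p 0).continuousAt.tendsto).mono_left
      (nhdsWithin_le_nhds (s := Set.Ioi 0))
    convert h1 using 2
    rw [hg, tm]
    have : evLP L 0 (co F p.1 p.2) = ((co F p.1 p.2).coeff 0).eval L := by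
      rw [evLP_eq, ← coeff_zero_eq_eval_zero, coeff_map, coe_evalRingHom]
    simp [this]
  have hbd : ∀ᶠ t : ℝ in 𝓝[>] 0, ∀ p, ‖tm L F t p‖ ≤ bound p := by
    filter_upwards [Ioo_mem_nhdsGT (show (0 : ℝ) < 1 / 2 by norm_num)] with t ht p
    have ht0 := ht.1.le
    have ht1 : t ≤ 1 := by linarith [ht.2]
    have hLt : ‖L * (t : ℂ)‖ ≤ K := (norm_mul_ofReal_le L ht0 ht1).trans hLK
    have e1 := norm_eval_le ((h.td p.1 p.2).natDegree_coeff_le 0) hK hLK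
    have e2 := norm_evLP_sub_le (h.td p.1 p.2) hK hLK hLt
    have e3 : ‖L * (t : ℂ)‖ = ‖L‖ * t := by
      rw [norm_mul, Complex.norm_real, Real.norm_of_nonneg ht0]
    have e4 := norm_le_norm_add_norm_sub' (evLP L (L * t) (co F p.1 p.2))
      (((co F p.1 p.2).coeff 0).eval L)
    rw [e3] at e2
    have e5 : Real.exp (L.re * t) ≤ 1 := (exp_mul_lt_one hL ht.1).le
    have e6 : Real.exp (L.re * (1 - t)) ≤ ρ := exp_mul_le_exp_mul hL (by linarith [ht.2])
    have e7 := mul_exp_le hc0 ht0 ht1 p.1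
    rw [hc, neg_neg] at e7
    have hn1 : (1 : ℝ) ≤ (p.2 : ℝ) + 1 := by simp
    have hA : ((p.2 : ℝ) + 1) ^ A ≤ ((p.2 : ℝ) + 1) ^ (A + A') :=
      pow_le_pow_right₀ hn1 (by omega)
    have hA' : ((p.2 : ℝ) + 1) ^ A' ≤ ((p.2 : ℝ) + 1) ^ (A + A') :=
      pow_le_pow_right₀ hn1 (by omega)
    have hw := wt_pos p.1
    have f1 : ‖((co F p.1 p.2).coeff 0).eval L‖ * Real.exp (L.re * t) ^ p.1 ≤
        (wt p.1 ^ 3)⁻¹ * (K ^ N * B * ((p.2 : ℝ) + 1) ^ (A + A')) := by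
      calc _ ≤ (K ^ N * (B * ((p.2 : ℝ) + 1) ^ A * (wt p.1 ^ 3)⁻¹)) * 1 := by
            gcongr
            · exact e1.trans (mul_le_mul_of_nonneg_left (hb p.1 p.2) (by positivity))
            · exact pow_le_one₀ (Real.exp_pos _).le e5
        _ ≤ (K ^ N * (B * ((p.2 : ℝ) + 1) ^ (A + A') * (wt p.1 ^ 3)⁻¹)) * 1 := by gcongr
        _ = _ := by ring
    have f2 : ‖L‖ * t * (K ^ N * K ^ N * nrm (co F p.1 p.2)) * Real.exp (L.re * t) ^ p.1 ≤
        (wt p.1 ^ 3)⁻¹ * (‖L‖ * (1 + c⁻¹) * (K ^ N * K ^ N * B') *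
          ((p.2 : ℝ) + 1) ^ (A + A')) := by
      calc _ = ‖L‖ * (t * Real.exp (L.re * t) ^ p.1) *
            (K ^ N * K ^ N * nrm (co F p.1 p.2)) := by ring
        _ ≤ ‖L‖ * ((1 + c⁻¹) * (wt p.1 ^ 2)⁻¹) *
            (K ^ N * K ^ N * (B' * ((p.2 : ℝ) + 1) ^ (A + A') * (wt p.1)⁻¹)) := by
            have h3 := (hb' p.1 p.2).trans (show _ ≤
              B' * ((p.2 : ℝ) + 1) ^ (A + A') * (wt p.1)⁻¹ by gcongr)
            have h4 := nrm_nonneg (co F p.1 p.2)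
            gcongr
        _ = _ := by field_simp
    rw [tm, norm_mul, norm_mul, norm_pow, norm_pow, norm_exp_mul, norm_exp_mul_one_sub]
    calc _ ≤ (‖((co F p.1 p.2).coeff 0).eval L‖ +
          ‖L‖ * t * (K ^ N * K ^ N * nrm (co F p.1 p.2))) *
          (Real.exp (L.re * t) ^ p.1 * ρ ^ p.2) := by
          have := nrm_nonneg (co F p.1 p.2)
          gcongr
          exact e4.trans (add_le_add le_rfl e2)
      _ = (‖((co F p.1 p.2).coeff 0).eval L‖ * Real.exp (L.re * t) ^ p.1 +
          ‖L‖ * t * (K ^ N * K ^ N * nrm (co F p.1 p.2)) * Real.exp (L.re * t) ^ p.1) *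
            ρ ^ p.2 := by ring
      _ ≤ ((wt p.1 ^ 3)⁻¹ * (K ^ N * B * ((p.2 : ℝ) + 1) ^ (A + A')) +
          (wt p.1 ^ 3)⁻¹ * (‖L‖ * (1 + c⁻¹) * (K ^ N * K ^ N * B') *
          ((p.2 : ℝ) + 1) ^ (A + A'))) * ρ ^ p.2 := by gcongr
      _ = _ := by rw [hbound]; ring
  have hT := tendsto_tsum_of_dominated_convergence hsum hlim hbd
  have hgs : Summable g := Summable.of_norm_bounded hsum fun p =>
    le_of_tendsto (hlim p).norm (hbd.mono fun t ht => ht p)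
  have hg0 : ∑' p, g p = 0 := by
    have hgs' : Summable fun c => g (Equiv.prodComm ℕ ℕ c) :=
      (Equiv.prodComm ℕ ℕ).summable_iff.2 hgs
    rw [← (Equiv.prodComm ℕ ℕ).tsum_eq g, hgs'.tsum_prod]
    refine (tsum_congr fun n => ?_).trans tsum_zero
    simp only [Equiv.prodComm_apply, Prod.swap_prod_mk, hg]
    rw [tsum_mul_right]
    refine mul_eq_zero_of_left ?_ _
    have h1 : ∀ m, ((co F m n).coeff 0).eval L =
        ∑ b ∈ Finset.range (N + 1), cf F m n 0 b * L ^ b := fun m =>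
      eval_eq_sum_range' (Nat.lt_succ_of_le ((h.td m n).natDegree_coeff_le 0)) L
    simp only [h1]
    rw [Summable.tsum_finsetSum fun b _ => (h.summable n b).mul_right _]
    refine Finset.sum_eq_zero fun b _ => ?_
    rw [tsum_mul_right, hz n b, zero_mul]
  rw [hg0] at hT
  exact hT

end EllMZV

namespace EllMZV

open Polynomial

/-- The Kronecker-type double series `∑ (p + z) ^ j x ^ (M (p + 1)) y ^ (M p)` over `M ≥ 1`,
`p ≥ 0`. -/
noncomputable def kron (j : ℕ) (x y z : ℂ) : ℂ :=
  ∑' p : ℕ × ℕ, ((p.2 : ℂ) + z) ^ j * (x ^ ((p.1 + 1) * (p.2 + 1)) * y ^ ((p.1 + 1) * p.2))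

lemma summable_kron (j : ℕ) {x y : ℂ} (hx : ‖x‖ < 1) (hy : ‖y‖ < 1) (z : ℂ) :
    Summable fun p : ℕ × ℕ =>
      ((p.2 : ℂ) + z) ^ j * (x ^ ((p.1 + 1) * (p.2 + 1)) * y ^ ((p.1 + 1) * p.2)) := by
  refine Summable.of_norm_bounded
    (summable_geom₂ 0 j ((1 + ‖z‖) ^ j) (norm_nonneg x) hx (norm_nonneg x) hx) fun p => ?_
  rw [norm_mul, norm_mul, norm_pow, norm_pow, norm_pow, pow_zero, one_mul, ← pow_add, ← mul_pow]
  refine mul_le_mul ?_ ?_ (by positivity) (by positivity)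
  · refine pow_le_pow_left₀ (norm_nonneg _) ((norm_add_le _ _).trans ?_) _
    rw [Complex.norm_natCast]
    nlinarith [norm_nonneg z, (Nat.cast_nonneg p.2 : (0 : ℝ) ≤ p.2)]
  · refine (mul_le_of_le_one_right (by positivity) (pow_le_one₀ (norm_nonneg _) hy.le)).trans
      (pow_le_pow_of_le_one (norm_nonneg _) hx.le ?_)
    nlinarith [Nat.zero_le (p.1 * p.2)]

lemma kron_add (j : ℕ) {x y : ℂ} (hx : ‖x‖ < 1) (hy : ‖y‖ < 1) (z w : ℂ) :
    kron j x y (w + z) =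
      ∑ k ∈ Finset.range (j + 1), z ^ k * kron (j - k) x y w * (j.choose k : ℂ) := by
  have h : ∀ k ∈ Finset.range (j + 1), z ^ k * kron (j - k) x y w * (j.choose k : ℂ) =
      ∑' p : ℕ × ℕ, z ^ k * (((p.2 : ℂ) + w) ^ (j - k) *
        (x ^ ((p.1 + 1) * (p.2 + 1)) * y ^ ((p.1 + 1) * p.2))) * (j.choose k : ℂ) := fun k _ => by
    rw [kron, ← tsum_mul_left, ← tsum_mul_right]
  rw [Finset.sum_congr rfl h, ← Summable.tsum_finsetSum fun k _ =>
    ((summable_kron (j - k) hx hy w).mul_left _).mul_right _]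
  refine tsum_congr fun p => ?_
  rw [← add_assoc, add_comm _ z, add_pow, Finset.sum_mul]
  exact Finset.sum_congr rfl fun k _ => by ring

lemma tsum_prod_shift {g : ℕ × ℕ → ℂ} (hg : Summable g) :
    ∑' p, g p = ∑' a, g (a, 0) + ∑' p : ℕ × ℕ, g (p.1, p.2 + 1) := by
  have hinj : Function.Injective fun p : ℕ × ℕ => (p.1, p.2 + 1) := fun p q h => by
    simpa [Prod.ext_iff] using h
  have h1 : Summable fun p : ℕ × ℕ => g (p.1, p.2 + 1) := hg.comp_injective hinj
  have h2 : Summable fun a : ℕ => g (a, 0) :=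
    hg.comp_injective (i := fun a : ℕ => (a, 0)) fun a b h => by simpa using h
  rw [hg.tsum_prod, h1.tsum_prod, ← h2.tsum_add h1.prod]
  exact tsum_congr fun a => (hg.prod_factor a).tsum_eq_zero_add

lemma kron_zero_shift (j : ℕ) {x y : ℂ} (hx : ‖x‖ < 1) (hy : ‖y‖ < 1) :
    kron j x y 0 = (0 : ℂ) ^ j * (x / (1 - x)) + ∑' p : ℕ × ℕ,
      ((p.2 : ℂ) + 1) ^ j * (x ^ ((p.1 + 1) * (p.2 + 1 + 1)) * y ^ ((p.1 + 1) * (p.2 + 1))) := by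
  rw [kron, tsum_prod_shift (summable_kron j hx hy 0)]
  congr 1
  · simp only [Nat.cast_zero, add_zero, mul_zero, pow_zero, mul_one, zero_add]
    rw [tsum_mul_left]
    congr 1
    simp only [pow_succ]
    rw [tsum_mul_right, tsum_geometric_of_norm_lt_one hx, inv_mul_eq_div]
  · simp

section fKr

variable {τ : ℂ} {t : ℝ}

lemma two_pi_I_mul_re (hτ : 0 < τ.im) : (2 * ↑π * Complex.I * τ).re < 0 := by
  have : (2 * ↑π * Complex.I * τ).re = -(2 * π * τ.im) := by simp
  rw [this]
  have := mul_pos Real.two_pi_pos hτ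
  linarith

lemma exp_nat_mul_xi (a : ℕ) : Complex.exp (2 * ↑π * Complex.I * ((a : ℂ) + 1) * (τ * t)) =
    Complex.exp (2 * ↑π * Complex.I * τ * t) ^ (a + 1) := by
  rw [← Complex.exp_nat_mul]
  congr 1
  push_cast
  ring

lemma fKr_summand (a b : ℕ) {x y : ℂ} (hx : x = Complex.exp (2 * ↑π * Complex.I * τ * t))
    (hy : y = Complex.exp (2 * ↑π * Complex.I * τ * (1 - t))) (ε : ℂ) :
    (Complex.exp (2 * ↑π * Complex.I * ((a : ℂ) + 1) * (τ * t)) +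
      ε * Complex.exp (-(2 * ↑π * Complex.I * ((a : ℂ) + 1) * (τ * t)))) *
      Complex.exp (2 * ↑π * Complex.I * τ) ^ ((a + 1) * (b + 1)) =
    x ^ ((a + 1) * (b + 1 + 1)) * y ^ ((a + 1) * (b + 1)) +
      ε * (y ^ ((a + 1) * (b + 1)) * x ^ ((a + 1) * b)) := by
  have hq : Complex.exp (2 * ↑π * Complex.I * τ) = x * y := by
    rw [hx, hy, ← Complex.exp_add]; congr 1; ring
  have hx0 : x ≠ 0 := hx ▸ Complex.exp_ne_zero _
  rw [Complex.exp_neg, exp_nat_mul_xi, ← hx, hq, mul_pow]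
  field_simp
  ring

lemma norm_x_lt (hτ : 0 < τ.im) (h0 : 0 < t) :
    ‖Complex.exp (2 * ↑π * Complex.I * τ * t)‖ < 1 := by
  rw [norm_exp_mul]; exact exp_mul_lt_one (two_pi_I_mul_re hτ) h0

lemma norm_y_lt (hτ : 0 < τ.im) (h1 : t < 1) :
    ‖Complex.exp (2 * ↑π * Complex.I * τ * (1 - t))‖ < 1 := by
  rw [norm_exp_mul_one_sub]; exact exp_mul_lt_one (two_pi_I_mul_re hτ) (sub_pos.2 h1)

lemma fKr_tsum (hτ : 0 < τ.im) (h0 : 0 < t) (h1 : t < 1) (j : ℕ) {x y : ℂ}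
    (hx : x = Complex.exp (2 * ↑π * Complex.I * τ * t))
    (hy : y = Complex.exp (2 * ↑π * Complex.I * τ * (1 - t))) :
    ∑' p : ℕ × ℕ, (Complex.exp (2 * ↑π * Complex.I * ((p.1 : ℂ) + 1) * (τ * t)) +
      (-1) ^ (j + 1) * Complex.exp (-(2 * ↑π * Complex.I * ((p.1 : ℂ) + 1) * (τ * t)))) *
      ((p.2 : ℂ) + 1) ^ j *
      Complex.exp (2 * ↑π * Complex.I * τ) ^ ((p.1 + 1) * (p.2 + 1)) =
    kron j x y 0 - (0 : ℂ) ^ j * (x / (1 - x)) + (-1) ^ (j + 1) * kron j y x 1 := by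
  have hx1 : ‖x‖ < 1 := hx ▸ norm_x_lt hτ h0
  have hy1 : ‖y‖ < 1 := hy ▸ norm_y_lt hτ h1
  have hs : Summable fun p : ℕ × ℕ => ((p.2 : ℂ) + 1) ^ j *
      (x ^ ((p.1 + 1) * (p.2 + 1 + 1)) * y ^ ((p.1 + 1) * (p.2 + 1))) := by
    refine ((summable_kron j hx1 hy1 0).comp_injective
      (i := fun p : ℕ × ℕ => (p.1, p.2 + 1)) fun p q h => ?_).congr fun p => ?_
    · simpa [Prod.ext_iff] using h
    · simp
  rw [kron_zero_shift j hx1 hy1, add_sub_cancel_left, kron, ← tsum_mul_left,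
    ← hs.tsum_add ((summable_kron j hy1 hx1 1).mul_left _)]
  refine tsum_congr fun p => ?_
  rw [mul_right_comm, fKr_summand p.1 p.2 hx hy]
  ring

lemma fKr_eq (hτ : 0 < τ.im) (h0 : 0 < t) (h1 : t < 1) (j : ℕ) {x y : ℂ}
    (hx : x = Complex.exp (2 * ↑π * Complex.I * τ * t))
    (hy : y = Complex.exp (2 * ↑π * Complex.I * τ * (1 - t))) :
    fKr (j + 1) (τ * t) τ = 2 * ↑π * Complex.I * ((_root_.bernoulli (j + 1) : ℂ) / ((j + 1)! : ℂ) -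
      (j ! : ℂ)⁻¹ * (kron j x y 0 + (-1) ^ (j + 1) * kron j y x 1)) := by
  rcases j with _ | j
  · have h := fKr_tsum hτ h0 h1 0 hx hy
    have hx1 : ‖x‖ < 1 := hx ▸ norm_x_lt hτ h0
    have hne : 1 - x ≠ 0 := sub_ne_zero.2 fun h => by rw [← h] at hx1; simp at hx1
    have hcot : (π : ℂ) * Complex.cot (π * (τ * t)) =
        -(π * Complex.I) - 2 * π * Complex.I * (x / (1 - x)) := by
      rw [Complex.cot_pi_eq_exp_ratio, ← mul_assoc, ← hx]
      field_simp
      rw [Complex.I_sq]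
      ring
    rw [fKr, hcot]
    simp only [zero_add, pow_one, pow_zero, mul_one, one_mul, neg_mul, ← sub_eq_add_neg] at h
    rw [h]
    simp
    ring
  · have h := fKr_tsum hτ h0 h1 (j + 1) hx hy
    rw [fKr, h, Nat.factorial_succ (j + 1)]
    have := Nat.factorial_ne_zero (j + 1)
    have h2 : (j : ℂ) + 2 ≠ 0 := by exact_mod_cast (by omega : j + 2 ≠ 0)
    have h3 : (j : ℂ) + 1 + 1 ≠ 0 := by exact_mod_cast (by omega : j + 2 ≠ 0)
    push_cast
    simp
    field_simp
    ring

end fKr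

end EllMZV

namespace EllMZV

open Polynomial

lemma pow_sub_succ_factorial {n k : ℕ} (hk : k ∈ Finset.range (n + 1)) (z : ℂ) (K : ℂ) :
    z ^ k / (k ! : ℂ) * (((n - k)! : ℂ)⁻¹ * K) = (n ! : ℂ)⁻¹ * (z ^ k * K * (n.choose k : ℂ)) := by
  rw [Nat.cast_choose ℂ (Finset.mem_range_succ_iff.1 hk)]
  have h1 : ((n - k)! : ℂ) ≠ 0 := by exact_mod_cast Nat.factorial_ne_zero _
  have h2 : (n ! : ℂ) ≠ 0 := by exact_mod_cast Nat.factorial_ne_zero _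
  have h3 : (k ! : ℂ) ≠ 0 := by exact_mod_cast Nat.factorial_ne_zero _
  field_simp

lemma omKr_succ {τ : ℂ} (hτ : 0 < τ.im) {t : ℝ} (h0 : 0 < t) (h1 : t < 1) (n : ℕ) {x y : ℂ}
    (hx : x = Complex.exp (2 * ↑π * Complex.I * τ * t))
    (hy : y = Complex.exp (2 * ↑π * Complex.I * τ * (1 - t))) :
    omKr (n + 1) (τ * t) τ = 2 * ↑π * Complex.I *
      (∑ k ∈ Finset.range (n + 2),
        (t : ℂ) ^ k / (k ! : ℂ) * ((_root_.bernoulli (n + 1 - k) : ℂ) / ((n + 1 - k)! : ℂ)) -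
      (n ! : ℂ)⁻¹ * (kron n x y t + (-1) ^ (n + 1) * kron n y x (1 - t))) := by
  have hx1 : ‖x‖ < 1 := hx ▸ norm_x_lt hτ h0
  have hy1 : ‖y‖ < 1 := hy ▸ norm_y_lt hτ h1
  have him : (τ * (t : ℂ)).im / τ.im = t := by
    rw [Complex.im_mul_ofReal, mul_comm, mul_div_assoc, div_self hτ.ne', mul_one]
  have hc : ∀ k, (((t ^ k / (k ! : ℝ) : ℝ)) : ℂ) = (t : ℂ) ^ k / (k ! : ℂ) := fun k => by
    push_cast; rfl
  rw [omKr]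
  simp only [him, hc]
  rw [Finset.sum_range_succ, Finset.sum_range_succ _ (n + 1), Nat.sub_self, fKr]
  have key : ∀ k ∈ Finset.range (n + 1), (t : ℂ) ^ k / (k ! : ℂ) * fKr (n + 1 - k) (τ * t) τ =
      2 * ↑π * Complex.I * ((t : ℂ) ^ k / (k ! : ℂ) *
        ((_root_.bernoulli (n + 1 - k) : ℂ) / ((n + 1 - k)! : ℂ)) -
        ((n ! : ℂ)⁻¹ * ((t : ℂ) ^ k * kron (n - k) x y 0 * (n.choose k : ℂ)) +
        (n ! : ℂ)⁻¹ * ((-1) ^ (n + 1) * ((-(t : ℂ)) ^ k * kron (n - k) y x 1 *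
          (n.choose k : ℂ))))) := by
    intro k hk
    have hk' := Finset.mem_range_succ_iff.1 hk
    rw [Nat.sub_add_comm hk', fKr_eq hτ h0 h1 (n - k) hx hy,
      ← pow_sub_succ_factorial hk (t : ℂ), mul_left_comm ((n ! : ℂ)⁻¹) ((-1) ^ (n + 1)),
      ← pow_sub_succ_factorial hk (-(t : ℂ))]
    have hs : (-1 : ℂ) ^ (n - k + 1) = (-1) ^ (n + 1) * (-1) ^ k := by
      have : n + 1 = n - k + 1 + k := by omega
      conv_rhs => rw [this, pow_add, mul_assoc, ← mul_pow]
      simp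
    rw [hs, neg_pow (t : ℂ)]
    ring
  rw [Finset.sum_congr rfl key, ← Finset.mul_sum, Finset.sum_sub_distrib, Finset.sum_add_distrib,
    ← Finset.mul_sum, ← Finset.mul_sum, ← Finset.mul_sum, ← kron_add n hx1 hy1,
    ← kron_add n hy1 hx1, zero_add, ← sub_eq_add_neg]
  simp
  ring

lemma kerP_emb (k a p : ℕ) :
    kerP k ((a + 1) * (p + 1)) ((a + 1) * p) = ((p : ℂ) • C X + X) ^ k := by
  have h1 : (a + 1) * (p + 1) - (a + 1) * p = a + 1 := by
    rw [← Nat.mul_sub]; simp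
  rw [kerP, h1, if_pos ⟨by nlinarith, Dvd.intro _ rfl⟩, Nat.mul_div_cancel_left _ (Nat.succ_pos a)]

lemma hasSum_kerP (k : ℕ) (L s : ℂ) {x y : ℂ} (hx : ‖x‖ < 1) (hy : ‖y‖ < 1) (hL : L ≠ 0) :
    HasSum (fun p : ℕ × ℕ => evLP L s (kerP k p.1 p.2) * (x ^ p.1 * y ^ p.2))
      (L ^ k * kron k x y (s / L)) := by
  set i : ℕ × ℕ → ℕ × ℕ := fun p => ((p.1 + 1) * (p.2 + 1), (p.1 + 1) * p.2) with hi
  have hinj : Function.Injective i := by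
    rintro ⟨a, p⟩ ⟨b, q⟩ h
    simp only [hi, Prod.mk.injEq] at h
    have h1 : a = b := by nlinarith [h.1, h.2]
    subst h1
    have h2 := Nat.eq_of_mul_eq_mul_left (Nat.succ_pos a) h.2
    rw [h2]
  rw [← hinj.hasSum_iff]
  · have := ((summable_kron k hx hy (s / L)).hasSum).mul_left (L ^ k)
    rw [show (fun p : ℕ × ℕ => evLP L s (kerP k p.1 p.2) * (x ^ p.1 * y ^ p.2)) ∘ i = _ from
      funext fun p => ?_]
    · exact this
    simp only [hi, Function.comp_apply, kerP_emb, map_pow, map_add, evLP_smul, evLP_C, eval_X,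
      evLP_X]
    rw [← mul_assoc (L ^ k), ← mul_pow, mul_add L, mul_div_cancel₀ _ hL, mul_comm L]
  · rintro ⟨m, n⟩ h
    rw [kerP, if_neg, map_zero, zero_mul]
    rintro ⟨h1, c, h2⟩
    refine h ⟨(m - n - 1, c), ?_⟩
    have h3 : m - n - 1 + 1 = m - n := by omega
    simp only [hi, h3, mul_add, ← h2, mul_one, Prod.mk.injEq, and_true]
    simp only at h1
    omega

lemma ev_kerW_succ {L : ℂ} (hL : L.re < 0) {t : ℝ} (h0 : 0 < t) (h1 : t < 1) (n : ℕ) {x y : ℂ}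
    (hx : x = Complex.exp (L * t)) (hy : y = Complex.exp (L * (1 - t))) :
    ev L (kerW (n + 1)) t = L ^ (n + 1) * (∑ k ∈ Finset.range (n + 2),
        (t : ℂ) ^ k / (k ! : ℂ) * ((_root_.bernoulli (n + 1 - k) : ℂ) / ((n + 1 - k)! : ℂ)) -
      (n ! : ℂ)⁻¹ * (kron n x y t + (-1) ^ (n + 1) * kron n y x (1 - t))) := by
  have hx1 : ‖x‖ < 1 := by rw [hx, norm_exp_mul]; exact exp_mul_lt_one hL h0
  have hy1 : ‖y‖ < 1 := by
    rw [hy, norm_exp_mul_one_sub]; exact exp_mul_lt_one hL (sub_pos.2 h1)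
  have hL0 : L ≠ 0 := fun h => by simp [h] at hL
  have hA := hasSum_kerP n L (L * t) hx1 hy1 hL0
  have hB := (Equiv.prodComm ℕ ℕ).hasSum_iff.2 (hasSum_kerP n L (L * (1 - t)) hy1 hx1 hL0)
  rw [mul_div_cancel_left₀ _ hL0] at hA hB
  have hC : HasSum (fun p : ℕ × ℕ => if p = (0, 0) then evLP L (L * t) (bern (n + 1)) else 0)
      (evLP L (L * t) (bern (n + 1))) := hasSum_ite_eq _ _
  have hS := hC.sub (((hA.add (hB.mul_left ((-1) ^ (n + 1)))).mul_left L).mul_left ((n ! : ℂ)⁻¹))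
  rw [ev]
  refine ((tsum_congr fun p => ?_).trans hS.tsum_eq).trans ?_
  · rw [tm, co_kerW_succ, map_sub, evLP_smul, map_mul, map_add, evLP_smul, evLP_flip, evLP_C,
      eval_X, ← hx, ← hy, show L - L * t = L * (1 - t) by ring]
    simp only [Function.comp_apply, Equiv.prodComm_apply, Prod.fst_swap, Prod.snd_swap]
    rcases p with ⟨m, m'⟩
    by_cases hp : m = 0 ∧ m' = 0
    · obtain ⟨rfl, rfl⟩ := hp
      simp
    · rw [if_neg hp, if_neg fun h => hp (by simpa using h), map_zero]
      ring
  · rw [bern, map_sum, ← Finset.sum_range_reflect, mul_sub, Finset.mul_sum]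
    congr 1
    · refine Finset.sum_congr rfl fun k hk => ?_
      have hk' : k ≤ n + 1 := Finset.mem_range_succ_iff.1 hk
      rw [show n + 1 + 1 - 1 - k = n + 1 - k by omega, show n + 1 - (n + 1 - k) = k by omega,
        evLP_smul, map_mul, map_pow, map_pow, evLP_C, evLP_X, eval_X, mul_pow]
      have : L ^ (n + 1) = L ^ (n + 1 - k) * L ^ k := by rw [← pow_add]; congr 1; omega
      rw [this]
      have h1 : ((n + 1 - k)! : ℂ) ≠ 0 := by exact_mod_cast Nat.factorial_ne_zero _
      have h3 : (k ! : ℂ) ≠ 0 := by exact_mod_cast Nat.factorial_ne_zero _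
      field_simp
    · ring

lemma ev_one (L : ℂ) (t : ℝ) : ev L 1 t = 1 := by
  rw [ev, tsum_eq_single ((0, 0) : ℕ × ℕ)]
  · simp [tm, co_one]
  · rintro ⟨m, n⟩ h
    rw [tm, co_one, if_neg fun h' => h (by simpa using h'), map_zero, zero_mul]

lemma omKr_eq_ev {τ : ℂ} (hτ : 0 < τ.im) {t : ℝ} (h0 : 0 < t) (h1 : t < 1) (n : ℕ) :
    omKr n (τ * t) τ = 2 * ↑π * Complex.I * ((2 * ↑π * Complex.I * τ) ^ n)⁻¹ *
      ev (2 * ↑π * Complex.I * τ) (kerW n) t := by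
  have hL := two_pi_I_mul_re hτ
  have hL0 : 2 * ↑π * Complex.I * τ ≠ 0 := fun h => by simp [h] at hL
  rcases n with _ | n
  · rw [show kerW 0 = 1 from rfl, ev_one]
    simp [omKr, fKr]
  · rw [omKr_succ hτ h0 h1 n rfl rfl, ev_kerW_succ hL h0 h1 n rfl rfl, mul_assoc _ (_⁻¹),
      inv_mul_cancel_left₀ (pow_ne_zero _ hL0)]

end EllMZV

namespace EllMZV

/-- Iterated integrals `∫_{T > t₁ > ⋯ > t_r > 0} ψ_{k₁}(t₁) ⋯ ψ_{k_r}(t_r)`. -/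
noncomputable def itInt {𝕜 : Type*} [RCLike 𝕜] (ψ : ℕ → ℝ → 𝕜) : List ℕ → ℝ → 𝕜
  | [], _ => 1
  | k :: v, T => ∫ t in Set.Ioo 0 T, ψ k t * itInt ψ v t

/-- The nested integrals of the norms converge. -/
def ItGood (ψ : ℕ → ℝ → ℂ) : List ℕ → ℝ → Prop
  | [], _ => True
  | k :: v, T => (∀ t ∈ Set.Ioo 0 T, ItGood ψ v t) ∧
      IntegrableOn (fun t => ‖ψ k t‖ * itInt (fun k t => ‖ψ k t‖) v t) (Set.Ioo 0 T)

lemma stronglyMeasurable_itInt {𝕜 : Type*} [RCLike 𝕜] {ψ : ℕ → ℝ → 𝕜}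
    (hψ : ∀ k, StronglyMeasurable (ψ k)) (v : List ℕ) : StronglyMeasurable (itInt ψ v) := by
  induction v with
  | nil => exact stronglyMeasurable_const
  | cons k v ih =>
    have h : itInt ψ (k :: v) = fun T => ∫ t,
        {p : ℝ × ℝ | 0 < p.2 ∧ p.2 < p.1}.indicator (fun p => ψ k p.2 * itInt ψ v p.2) (T, t) := by
      funext T
      rw [itInt, ← integral_indicator measurableSet_Ioo]
      rfl
    rw [h]
    refine StronglyMeasurable.integral_prod_right' (StronglyMeasurable.indicator ?_ ?_)
    · exact ((hψ k).mul ih).comp_measurable measurable_snd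
    · exact (measurableSet_lt measurable_const measurable_snd).inter
        (measurableSet_lt measurable_snd measurable_fst)

lemma itInt_norm_nonneg (ψ : ℕ → ℝ → ℂ) (v : List ℕ) (T : ℝ) :
    0 ≤ itInt (fun k t => ‖ψ k t‖) v T := by
  induction v generalizing T with
  | nil => exact zero_le_one
  | cons k v ih => exact integral_nonneg fun t => mul_nonneg (norm_nonneg _) (ih t)

lemma norm_itInt_le {ψ : ℕ → ℝ → ℂ} {v : List ℕ} {T : ℝ} (h : ItGood ψ v T) :
    ‖itInt ψ v T‖ ≤ itInt (fun k t => ‖ψ k t‖) v T := by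
  induction v generalizing T with
  | nil => simp [itInt]
  | cons k v ih =>
    refine (norm_integral_le_integral_norm _).trans
      (integral_mono_of_nonneg (.of_forall fun t => norm_nonneg _) h.2 ?_)
    refine (ae_restrict_mem measurableSet_Ioo).mono fun t ht => ?_
    dsimp only
    rw [norm_mul]
    exact mul_le_mul_of_nonneg_left (ih (h.1 t ht)) (norm_nonneg _)

lemma ItGood.integrableOn {ψ : ℕ → ℝ → ℂ} (hψ : ∀ k, StronglyMeasurable (ψ k)) {k : ℕ} {v : List ℕ}
    {T : ℝ} (h : ItGood ψ (k :: v) T) :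
    IntegrableOn (fun t => ψ k t * itInt ψ v t) (Set.Ioo 0 T) := by
  refine Integrable.mono' h.2
    ((hψ k).mul (stronglyMeasurable_itInt hψ v)).aestronglyMeasurable ?_
  refine (ae_restrict_mem measurableSet_Ioo).mono fun t ht => ?_
  rw [norm_mul]
  exact mul_le_mul_of_nonneg_left (norm_itInt_le (h.1 t ht)) (norm_nonneg _)

/-- The open simplex `{T > t₁ > ⋯ > t_r > 0}`. -/
def simplexTo (r : ℕ) (T : ℝ) : Set (Fin r → ℝ) :=
  {t | (∀ i, 0 < t i ∧ t i < T) ∧ ∀ i j : Fin r, i < j → t j < t i}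

lemma measurableSet_simplexTo (r : ℕ) (T : ℝ) : MeasurableSet (simplexTo r T) := by
  have : simplexTo r T = (⋂ i, {t : Fin r → ℝ | 0 < t i} ∩ {t | t i < T}) ∩
      ⋂ i, ⋂ j, ⋂ (_ : i < j), {t : Fin r → ℝ | t j < t i} := by
    ext; simp [simplexTo]
  rw [this]
  refine (MeasurableSet.iInter fun i => ?_).inter (MeasurableSet.iInter fun i =>
    MeasurableSet.iInter fun j => MeasurableSet.iInter fun _ => ?_)
  · exact (measurableSet_lt measurable_const (measurable_pi_apply i)).inter
      (measurableSet_lt (measurable_pi_apply i) measurable_const)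
  · exact measurableSet_lt (measurable_pi_apply j) (measurable_pi_apply i)

lemma cons_mem_simplexTo {r : ℕ} {T a : ℝ} {s : Fin r → ℝ} :
    (Fin.cons a s : Fin (r + 1) → ℝ) ∈ simplexTo (r + 1) T ↔
      a ∈ Set.Ioo 0 T ∧ s ∈ simplexTo r a := by
  simp only [simplexTo, Set.mem_ofPred_eq, Fin.forall_fin_succ, Fin.cons_zero, Fin.cons_succ,
    Set.mem_Ioo, Fin.succ_lt_succ_iff, Fin.succ_pos, Fin.not_lt_zero, false_imp_iff,
    true_and, forall_true_left]
  constructor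
  · rintro ⟨⟨ha, hs⟩, h1, h2⟩
    exact ⟨ha, fun i => ⟨(hs i).1, h1 i⟩, h2⟩
  · rintro ⟨ha, hs, h2⟩
    exact ⟨⟨ha, fun i => ⟨(hs i).1, (hs i).2.trans ha.2⟩⟩, fun i => (hs i).2, h2⟩

lemma simplex_itInt {ψ : ℕ → ℝ → ℂ} (hψ : ∀ k, StronglyMeasurable (ψ k)) {r : ℕ} (n : Fin r → ℕ)
    {T : ℝ} (h : ItGood ψ (List.ofFn n) T) :
    IntegrableOn (fun t : Fin r → ℝ => ∏ i, ψ (n i) (t i)) (simplexTo r T) ∧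
    ∫ t in simplexTo r T, ∏ i, ψ (n i) (t i) = itInt ψ (List.ofFn n) T ∧
    ∫ t in simplexTo r T, ‖∏ i, ψ (n i) (t i)‖ =
      itInt (fun k t => ‖ψ k t‖) (List.ofFn n) T := by
  induction r generalizing T with
  | zero =>
    have hs : simplexTo 0 T = Set.univ := by ext; simp [simplexTo]
    have hv : (volume : Measure (Fin 0 → ℝ)).real Set.univ = 1 := by
      rw [volume_pi, measureReal_def, Measure.pi_empty_univ, ENNReal.toReal_one]
    rw [hs]
    simp [itInt, hv]
  | succ r ih =>
    set f : (Fin (r + 1) → ℝ) → ℂ :=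
      (simplexTo (r + 1) T).indicator fun t => ∏ i, ψ (n i) (t i) with hf
    set e := MeasurableEquiv.piFinSuccAbove (fun _ : Fin (r + 1) => ℝ) 0 with he
    have hmp := volume_preserving_piFinSuccAbove (fun _ : Fin (r + 1) => ℝ) 0
    set G : ℝ × (Fin r → ℝ) → ℂ := fun p => f (e.symm p) with hG
    have hfG : f = G ∘ e := by funext t; simp [hG]
    have hfm : StronglyMeasurable f := by
      refine StronglyMeasurable.indicator ?_ (measurableSet_simplexTo _ _)
      exact Finset.stronglyMeasurable_fun_prod _ fun i _ =>
        (hψ (n i)).comp_measurable (measurable_pi_apply i)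
    have hGm : StronglyMeasurable G := hfm.comp_measurable e.symm.measurable
    set v := List.ofFn fun i : Fin r => n i.succ with hv
    rw [List.ofFn_succ] at h ⊢
    have hGa : ∀ a ∈ Set.Ioo 0 T, (fun s => G (a, s)) = fun s => ψ (n 0) a *
        (simplexTo r a).indicator (fun s => ∏ i : Fin r, ψ (n i.succ) (s i)) s := by
      intro a ha
      funext s
      have h1 : e.symm (a, s) = Fin.cons a s := by
        simp only [he, MeasurableEquiv.piFinSuccAbove]
        simp
        rfl
      simp only [hG, hf, h1]
      by_cases hs : s ∈ simplexTo r a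
      · rw [Set.indicator_of_mem (cons_mem_simplexTo.2 ⟨ha, hs⟩), Set.indicator_of_mem hs,
          Fin.prod_univ_succ]
        simp
      · rw [Set.indicator_of_notMem fun h => hs (cons_mem_simplexTo.1 h).2,
          Set.indicator_of_notMem hs, mul_zero]
    have hGa0 : ∀ a ∉ Set.Ioo 0 T, (fun s => G (a, s)) = fun s => 0 := by
      intro a ha
      funext s
      have h1 : e.symm (a, s) = Fin.cons a s := by
        simp only [he, MeasurableEquiv.piFinSuccAbove]
        simp
        rfl
      simp only [hG, hf, h1]
      exact Set.indicator_of_notMem (fun h => ha (cons_mem_simplexTo.1 h).1) _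
    have hint : (fun a => ∫ s, G (a, s)) =
        (Set.Ioo 0 T).indicator fun t => ψ (n 0) t * itInt ψ v t := by
      funext a
      by_cases ha : a ∈ Set.Ioo 0 T
      · rw [hGa a ha, Set.indicator_of_mem ha, integral_const_mul,
          integral_indicator (measurableSet_simplexTo _ _), (ih _ (h.1 a ha)).2.1]
      · rw [hGa0 a ha, Set.indicator_of_notMem ha, integral_zero]
    have hnorm : (fun a => ∫ s, ‖G (a, s)‖) = (Set.Ioo 0 T).indicator fun t =>
        ‖ψ (n 0) t‖ * itInt (fun k t => ‖ψ k t‖) v t := by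
      funext a
      by_cases ha : a ∈ Set.Ioo 0 T
      · have h2 : (fun s => ‖G (a, s)‖) = fun s => ‖ψ (n 0) a‖ *
            (simplexTo r a).indicator (fun s => ‖∏ i : Fin r, ψ (n i.succ) (s i)‖) s := by
          funext s
          rw [congrFun (hGa a ha) s, norm_mul, norm_indicator_eq_indicator_norm]
        rw [h2, Set.indicator_of_mem ha, integral_const_mul,
          integral_indicator (measurableSet_simplexTo _ _), (ih _ (h.1 a ha)).2.2]
      · have h2 : (fun s => ‖G (a, s)‖) = fun s => 0 := by
          funext s
          rw [congrFun (hGa0 a ha) s, norm_zero]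
        rw [h2, Set.indicator_of_notMem ha, integral_zero]
    have hGi : Integrable G (volume.prod volume) := by
      rw [integrable_prod_iff hGm.aestronglyMeasurable]
      refine ⟨.of_forall fun a => ?_, ?_⟩
      · by_cases ha : a ∈ Set.Ioo 0 T
        · rw [hGa a ha]
          exact ((integrable_indicator_iff (measurableSet_simplexTo _ _)).2
            (ih _ (h.1 a ha)).1).const_mul _
        · rw [hGa0 a ha]
          exact integrable_zero _ _ _
      · rw [hnorm, integrable_indicator_iff measurableSet_Ioo]
        exact h.2
    refine ⟨?_, ?_, ?_⟩
    · rw [← integrable_indicator_iff (measurableSet_simplexTo _ _), ← hf, hfG]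
      exact (hmp.integrable_comp_emb e.measurableEmbedding).2 hGi
    · rw [← integral_indicator (measurableSet_simplexTo _ _), ← hf, hfG]
      refine (hmp.integral_comp e.measurableEmbedding G).trans ?_
      rw [Measure.volume_eq_prod, integral_prod _ hGi, hint, integral_indicator measurableSet_Ioo]
      rfl
    · rw [← integral_indicator (measurableSet_simplexTo _ _)]
      simp only [← norm_indicator_eq_indicator_norm]
      rw [← hf, hfG]
      refine (hmp.integral_comp e.measurableEmbedding fun p => ‖G p‖).trans ?_
      rw [Measure.volume_eq_prod, integral_prod _ hGi.norm, hnorm,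
        integral_indicator measurableSet_Ioo]
      rfl

end EllMZV

namespace EllMZV

lemma exists_norm_kron_le (n : ℕ) {ρ : ℝ} (h0 : 0 ≤ ρ) (h1 : ρ < 1) : ∃ C : ℝ, 0 ≤ C ∧
    ∀ x y : ℂ, ‖x‖ < 1 → ‖y‖ < 1 → ‖x * y‖ ≤ ρ → ∀ z : ℝ, 0 ≤ z → z ≤ 1 →
      ‖kron n x y z‖ ≤ z ^ n * (‖x‖ / (1 - ‖x‖)) + C := by
  have hs := summable_geom₂ 0 n (2 ^ n) h0 h1 h0 h1
  refine ⟨∑' p : ℕ × ℕ, 2 ^ n * (((p.1 : ℝ) + 1) ^ 0 * ((p.2 : ℝ) + 1) ^ n) *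
    (ρ ^ p.1 * ρ ^ p.2), tsum_nonneg fun p => by positivity, fun x y hx hy hxy z hz0 hz1 => ?_⟩
  rw [kron, tsum_prod_shift (summable_kron n hx hy z)]
  refine (norm_add_le _ _).trans (add_le_add ?_ ?_)
  · simp only [Nat.cast_zero, zero_add, mul_zero, pow_zero, mul_one]
    rw [tsum_mul_left]
    simp only [pow_succ]
    rw [tsum_mul_right, tsum_geometric_of_norm_lt_one hx, norm_mul, norm_pow, Complex.norm_real,
      Real.norm_of_nonneg hz0, norm_mul, norm_inv, div_eq_inv_mul]
    have h2 : 1 - ‖x‖ ≤ ‖1 - x‖ := by simpa using norm_sub_norm_le 1 x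
    have h3 : 0 < 1 - ‖x‖ := sub_pos.2 hx
    gcongr
  · refine tsum_of_norm_bounded hs.hasSum fun p => ?_
    have e : x ^ ((p.1 + 1) * (p.2 + 1 + 1)) * y ^ ((p.1 + 1) * (p.2 + 1)) =
        (x * y) ^ ((p.1 + 1) * (p.2 + 1)) * x ^ (p.1 + 1) := by ring
    rw [e, norm_mul, norm_mul, norm_pow, norm_pow, norm_pow, pow_zero, one_mul, ← mul_pow,
      ← pow_add]
    refine mul_le_mul (pow_le_pow_left₀ (norm_nonneg _) ?_ _) ?_ (by positivity) (by positivity)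
    · push_cast
      refine (norm_add_le _ _).trans ?_
      rw [Complex.norm_real, Real.norm_of_nonneg hz0]
      have h3 : ‖(p.2 : ℂ) + 1‖ = (p.2 : ℝ) + 1 := by exact_mod_cast Complex.norm_natCast (p.2 + 1)
      rw [h3]
      have := (Nat.cast_nonneg p.2 : (0 : ℝ) ≤ p.2)
      linarith
    · refine (mul_le_of_le_one_right (by positivity) (pow_le_one₀ (norm_nonneg _) hx.le)).trans
        ((pow_le_pow_left₀ (norm_nonneg _) hxy _).trans (pow_le_pow_of_le_one h0 h1.le ?_))
      nlinarith [Nat.zero_le (p.1 * p.2)]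

lemma exp_neg_div_le {u : ℝ} (hu : 0 < u) : Real.exp (-u) / (1 - Real.exp (-u)) ≤ u⁻¹ := by
  have h1 : Real.exp (-u) < 1 := Real.exp_lt_one_iff.2 (by linarith)
  rw [div_le_iff₀ (sub_pos.2 h1), ← div_eq_inv_mul, le_div_iff₀ hu]
  have h2 : Real.exp (-u) * Real.exp u = 1 := by rw [← Real.exp_add]; simp
  nlinarith [Real.add_one_le_exp u, Real.exp_pos (-u)]

lemma one_le_inv_mul_one_sub {t : ℝ} (h0 : 0 < t) (h1 : t < 1) : 1 ≤ (t * (1 - t))⁻¹ :=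
  (one_le_inv₀ (mul_pos h0 (sub_pos.2 h1))).2 (by nlinarith)

lemma exists_norm_ev_kerW_le {L : ℂ} (hL : L.re < 0) (n : ℕ) : ∃ C : ℝ, 0 ≤ C ∧
    ∀ t : ℝ, 0 < t → t < 1 → ‖ev L (kerW n) t‖ ≤ C * (t * (1 - t))⁻¹ ∧
      (n ≠ 1 → ‖ev L (kerW n) t‖ ≤ C) := by
  rcases n with _ | n
  · refine ⟨1, zero_le_one, fun t h0 h1 => ?_⟩
    rw [show kerW 0 = 1 from rfl, ev_one, norm_one, one_mul]
    exact ⟨one_le_inv_mul_one_sub h0 h1, fun _ => le_rfl⟩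
  obtain ⟨C, hC, hk⟩ := exists_norm_kron_le n (Real.exp_pos L.re).le (Real.exp_lt_one_iff.2 hL)
  set c := -L.re with hc
  have hc0 : 0 < c := neg_pos.2 hL
  set S := ∑ k ∈ Finset.range (n + 2),
    ‖(_root_.bernoulli (n + 1 - k) : ℂ) / ((n + 1 - k)! : ℂ)‖ with hS
  have hS0 : 0 ≤ S := Finset.sum_nonneg fun _ _ => norm_nonneg _
  have hker : ∀ t : ℝ, 0 < t → t < 1 →
      ‖kron n (Complex.exp (L * t)) (Complex.exp (L * (1 - t))) t‖ ≤ t ^ n * (c * t)⁻¹ + C := by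
    intro t h0 h1
    refine (hk _ _ ?_ ?_ ?_ t h0.le h1.le).trans ?_
    · rw [norm_exp_mul]; exact exp_mul_lt_one hL h0
    · rw [norm_exp_mul_one_sub]; exact exp_mul_lt_one hL (sub_pos.2 h1)
    · rw [← Complex.exp_add, ← mul_add, add_sub_cancel, mul_one, Complex.norm_exp]
    · rw [norm_exp_mul, show L.re * t = -(c * t) by rw [hc]; ring]
      have := exp_neg_div_le (mul_pos hc0 h0)
      gcongr
  have hker' : ∀ t : ℝ, 0 < t → t < 1 →
      ‖kron n (Complex.exp (L * (1 - t))) (Complex.exp (L * t)) (1 - t)‖ ≤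
        (1 - t) ^ n * (c * (1 - t))⁻¹ + C := by
    intro t h0 h1
    simpa using hker (1 - t) (sub_pos.2 h1) (by linarith)
  have hmain : ∀ t : ℝ, 0 < t → t < 1 → ‖ev L (kerW (n + 1)) t‖ ≤ ‖L‖ ^ (n + 1) *
      (S + ((t ^ n * (c * t)⁻¹ + C) + ((1 - t) ^ n * (c * (1 - t))⁻¹ + C))) := by
    intro t h0 h1
    rw [ev_kerW_succ hL h0 h1 n rfl rfl, norm_mul, norm_pow]
    refine mul_le_mul_of_nonneg_left ((norm_sub_le _ _).trans (add_le_add ?_ ?_)) (by positivity)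
    · refine (norm_sum_le _ _).trans (Finset.sum_le_sum fun k _ => ?_)
      rw [norm_mul]
      refine mul_le_of_le_one_left (norm_nonneg _) ?_
      rw [norm_div, norm_pow, Complex.norm_real, Real.norm_of_nonneg h0.le, Complex.norm_natCast]
      exact div_le_one_of_le₀ ((pow_le_one₀ h0.le h1.le).trans
        (by exact_mod_cast Nat.one_le_iff_ne_zero.2 (Nat.factorial_ne_zero k))) (by positivity)
    · rw [norm_mul, norm_inv, Complex.norm_natCast]
      refine (mul_le_of_le_one_left (norm_nonneg _) (inv_le_one_of_one_le₀
        (by exact_mod_cast Nat.one_le_iff_ne_zero.2 (Nat.factorial_ne_zero n)))).trans ?_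
      refine (norm_add_le _ _).trans (add_le_add (hker t h0 h1) ?_)
      rw [norm_mul, norm_pow, norm_neg, norm_one, one_pow, one_mul]
      exact hker' t h0 h1
  have hD : ∀ t : ℝ, 0 < t → t < 1 → t ^ n * (c * t)⁻¹ ≤ c⁻¹ * (t * (1 - t))⁻¹ := by
    intro t h0 h1
    have h2 : 0 < 1 - t := sub_pos.2 h1
    refine (mul_le_of_le_one_left (by positivity) (pow_le_one₀ h0.le h1.le)).trans ?_
    rw [mul_inv]
    gcongr
    nlinarith
  have hD' : n ≠ 0 → ∀ t : ℝ, 0 < t → t < 1 → t ^ n * (c * t)⁻¹ ≤ c⁻¹ := by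
    intro hn t h0 h1
    obtain ⟨m, rfl⟩ := Nat.exists_eq_succ_of_ne_zero hn
    have : t ^ (m + 1) * (c * t)⁻¹ = t ^ m * c⁻¹ := by field_simp; ring
    rw [Nat.succ_eq_add_one, this]
    exact mul_le_of_le_one_left (by positivity) (pow_le_one₀ h0.le h1.le)
  refine ⟨‖L‖ ^ (n + 1) * (S + ((c⁻¹ + C) + (c⁻¹ + C))), by positivity, fun t h0 h1 => ⟨?_, ?_⟩⟩
  · refine (hmain t h0 h1).trans ?_
    rw [mul_assoc]
    refine mul_le_mul_of_nonneg_left ?_ (by positivity)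
    have h2 := one_le_inv_mul_one_sub h0 h1
    have h3 := hD t h0 h1
    have h4 := hD (1 - t) (sub_pos.2 h1) (by linarith)
    rw [sub_sub_cancel, mul_comm (1 - t) t] at h4
    have h5 := le_mul_of_one_le_right hC h2
    have h6 := le_mul_of_one_le_right hS0 h2
    linarith
  · intro hn
    have hn : n ≠ 0 := by omega
    refine (hmain t h0 h1).trans (mul_le_mul_of_nonneg_left ?_ (by positivity))
    have h3 := hD' hn t h0 h1
    have h4 := hD' hn (1 - t) (sub_pos.2 h1) (by linarith)
    linarith

lemma continuousOn_ev {F : FS} (hF : PB F) {L : ℂ} (hL : L.re < 0) :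
    ContinuousOn (ev L F) (Set.Ioo 0 1) := by
  intro t ht
  obtain ⟨h0, h1⟩ := ht
  obtain ⟨B, A, hB, h⟩ := hF ‖L‖
  have hs := summable_geom₂ A A B (Real.exp_pos (L.re * (t / 2))).le
    (exp_mul_lt_one hL (by linarith)) (Real.exp_pos (L.re * ((1 - t) / 2))).le
      (exp_mul_lt_one hL (by linarith))
  have hc : ContinuousOn (ev L F) (Set.Ioo (t / 2) ((1 + t) / 2)) := by
    refine continuousOn_tsum (fun p u _ => (hasDerivAt_tm L F p u).continuousAt.continuousWithinAt)
      hs fun p u hu => ?_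
    exact norm_tm_le (h L _ le_rfl
      (norm_mul_ofReal_le L (by linarith [hu.1]) (by linarith [hu.2])) p.1 p.2)
      (exp_mul_le_exp_mul hL hu.1.le) (exp_mul_le_exp_mul hL (by linarith [hu.2]))
  exact (hc.continuousAt (Ioo_mem_nhds (by linarith) (by linarith))).continuousWithinAt

/-- The kernels of the iterated integrals, supported on the open unit interval. -/
noncomputable def ker (L : ℂ) (n : ℕ) : ℝ → ℂ :=
  (Set.Ioo 0 1).indicator fun t => L * ev L (kerW n) t

lemma ker_of_mem (L : ℂ) (n : ℕ) {t : ℝ} (h0 : 0 < t) (h1 : t < 1) :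
    ker L n t = L * ev L (kerW n) t := Set.indicator_of_mem (Set.mem_Ioo.2 ⟨h0, h1⟩) _

lemma stronglyMeasurable_ker {L : ℂ} (hL : L.re < 0) (n : ℕ) : StronglyMeasurable (ker L n) := by
  classical
  refine Measurable.stronglyMeasurable ?_
  rw [ker, ← Set.piecewise_eq_indicator]
  exact (continuousOn_const.mul (continuousOn_ev (pb_kerW n) hL)).measurable_piecewise continuousOn_const
    measurableSet_Ioo

lemma exists_norm_ker_le {L : ℂ} (hL : L.re < 0) (n : ℕ) : ∃ C : ℝ, 0 ≤ C ∧
    ∀ t : ℝ, 0 < t → t < 1 → ‖ker L n t‖ ≤ C * (t * (1 - t))⁻¹ ∧ (n ≠ 1 → ‖ker L n t‖ ≤ C) := by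
  obtain ⟨C, hC, h⟩ := exists_norm_ev_kerW_le hL n
  refine ⟨‖L‖ * C, by positivity, fun t h0 h1 => ?_⟩
  rw [ker_of_mem L n h0 h1, norm_mul, mul_assoc]
  exact ⟨mul_le_mul_of_nonneg_left (h t h0 h1).1 (norm_nonneg _),
    fun hn => mul_le_mul_of_nonneg_left ((h t h0 h1).2 hn) (norm_nonneg _)⟩

end EllMZV

namespace EllMZV

/-- The comparison function `(t / (1 - t)) ^ α`. -/
noncomputable def cmp (α t : ℝ) : ℝ := (t / (1 - t)) ^ α

lemma cmp_nonneg (α : ℝ) {t : ℝ} (h0 : 0 < t) (h1 : t < 1) : 0 ≤ cmp α t :=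
  Real.rpow_nonneg (div_nonneg h0.le (sub_pos.2 h1).le) _

lemma hasDerivAt_cmp (α : ℝ) {t : ℝ} (h0 : 0 < t) (h1 : t < 1) :
    HasDerivAt (cmp α) (α * (cmp α t * (t * (1 - t))⁻¹)) t := by
  have h2 : 0 < 1 - t := sub_pos.2 h1
  have hd := (hasDerivAt_id t).div ((hasDerivAt_id t).const_sub 1) h2.ne'
  have h3 : (id t : ℝ) / (1 - id t) ≠ 0 := (div_pos h0 h2).ne'
  have := hd.rpow_const (p := α) (Or.inl h3)
  refine this.congr_deriv ?_
  change _ * α * (t / (1 - t)) ^ (α - 1) = _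
  rw [Real.rpow_sub_one (div_pos h0 h2).ne', cmp, id]
  field_simp
  ring

lemma continuousOn_cmp {α : ℝ} (hα : 0 < α) {T : ℝ} (h1 : T < 1) :
    ContinuousOn (cmp α) (Set.Icc 0 T) := by
  refine ContinuousOn.rpow_const (ContinuousOn.div continuousOn_id
    (continuousOn_const.sub continuousOn_id) fun t ht => ?_) fun t _ => Or.inr hα.le
  exact (sub_pos.2 (ht.2.trans_lt h1)).ne'

lemma cmp_zero {α : ℝ} (hα : 0 < α) : cmp α 0 = 0 := by
  rw [cmp, zero_div, Real.zero_rpow hα.ne']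

lemma integrableOn_cmp {α : ℝ} (hα : 0 < α) {T : ℝ} (h1 : T < 1) :
    IntegrableOn (fun t => α * (cmp α t * (t * (1 - t))⁻¹)) (Set.Ioo 0 T) := by
  refine (intervalIntegral.integrableOn_deriv_of_nonneg (continuousOn_cmp hα h1)
    (fun t ht => hasDerivAt_cmp α ht.1 (ht.2.trans h1)) fun t ht => ?_).mono_set
      Set.Ioo_subset_Ioc_self
  have := sub_pos.2 (ht.2.trans h1)
  have h2 := ht.1
  have h3 := cmp_nonneg α ht.1 (ht.2.trans h1)
  positivity

lemma integral_cmp {α : ℝ} (hα : 0 < α) {T : ℝ} (h0 : 0 < T) (h1 : T < 1) :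
    ∫ t in Set.Ioo 0 T, α * (cmp α t * (t * (1 - t))⁻¹) = cmp α T := by
  rw [← integral_Ioc_eq_integral_Ioo, ← intervalIntegral.integral_of_le h0.le,
    intervalIntegral.integral_eq_sub_of_hasDerivAt_of_le h0.le (continuousOn_cmp hα h1)
      (fun t ht => hasDerivAt_cmp α ht.1 (ht.2.trans h1)), cmp_zero hα, sub_zero]
  rw [intervalIntegrable_iff_integrableOn_Ioo_of_le h0.le]
  exact integrableOn_cmp hα h1

lemma one_le_cmp_mul {α : ℝ} (hα : α ≤ 1) (hα0 : 0 < α) {t : ℝ} (h0 : 0 < t) (h1 : t < 1) :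
    1 ≤ cmp α t * (t * (1 - t))⁻¹ := by
  have h2 : 0 < 1 - t := sub_pos.2 h1
  have h3 : t ≤ cmp α t := by
    refine (Real.self_le_rpow_of_le_one h0.le h1.le hα).trans
      (Real.rpow_le_rpow h0.le ?_ hα0.le)
    rw [le_div_iff₀ h2]
    nlinarith
  rw [← div_eq_mul_inv, le_div_iff₀ (mul_pos h0 h2)]
  nlinarith

section bounds

variable {L : ℂ} (hL : L.re < 0)

include hL

lemma exists_integrand_le {k : ℕ} {v : List ℕ} (hv : Adm (k :: v)) {α : ℝ} (hα0 : 0 < α)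
    (hα : α ≤ 1) (h : v ≠ [] → ∃ C : ℝ, 0 ≤ C ∧ ∀ t : ℝ, 0 < t → t < 1 →
      itInt (fun k t => ‖ker L k t‖) v t ≤ C * cmp α t) :
    ∃ C : ℝ, 0 ≤ C ∧ ∀ t : ℝ, 0 < t → t < 1 →
      ‖ker L k t‖ * itInt (fun k t => ‖ker L k t‖) v t ≤
        C * (α * (cmp α t * (t * (1 - t))⁻¹)) := by
  obtain ⟨C, hC, hk⟩ := exists_norm_ker_le hL k
  by_cases hne : v = []
  · subst hne
    refine ⟨C * α⁻¹, by positivity, fun t h0 h1 => ?_⟩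
    rw [itInt, mul_one, mul_assoc, inv_mul_cancel_left₀ hα0.ne']
    exact ((hk t h0 h1).2 fun h => hv.1 h rfl).trans
      (le_mul_of_one_le_right hC (one_le_cmp_mul hα hα0 h0 h1))
  · obtain ⟨C', hC', h'⟩ := h hne
    refine ⟨C * C' * α⁻¹, by positivity, fun t h0 h1 => ?_⟩
    have h2 := cmp_nonneg α h0 h1
    refine (mul_le_mul (hk t h0 h1).1 (h' t h0 h1) (itInt_norm_nonneg _ _ _) ?_).trans_eq ?_
    · have := sub_pos.2 h1
      positivity
    · field_simp

lemma itGood_and_le {v : List ℕ} (hv : Adm v) {α : ℝ} (hα0 : 0 < α) (hα : α ≤ 1) :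
    (∀ T : ℝ, T < 1 → ItGood (ker L) v T) ∧
    (v ≠ [] → ∃ C : ℝ, 0 ≤ C ∧ ∀ T : ℝ, 0 < T → T < 1 →
      itInt (fun k t => ‖ker L k t‖) v T ≤ C * cmp α T) := by
  induction v with
  | nil => exact ⟨fun _ _ => trivial, fun h => absurd rfl h⟩
  | cons k v ih =>
    obtain ⟨ih1, ih2⟩ := ih hv.2
    obtain ⟨C, hC, h⟩ := exists_integrand_le hL hv hα0 hα ih2
    have hm : StronglyMeasurable fun t => ‖ker L k t‖ * itInt (fun k t => ‖ker L k t‖) v t :=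
      (stronglyMeasurable_ker hL k).norm.mul
        (stronglyMeasurable_itInt (fun k => (stronglyMeasurable_ker hL k).norm) v)
    have hle : ∀ T : ℝ, T < 1 → ∀ᵐ t ∂volume.restrict (Set.Ioo 0 T),
        ‖ker L k t‖ * itInt (fun k t => ‖ker L k t‖) v t ≤
          C * (α * (cmp α t * (t * (1 - t))⁻¹)) := fun T hT =>
      (ae_restrict_mem measurableSet_Ioo).mono fun t ht => h t ht.1 (ht.2.trans hT)
    refine ⟨fun T hT => ⟨fun t ht => ih1 t (ht.2.trans hT), ?_⟩, fun _ => ⟨C, hC, ?_⟩⟩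
    · refine Integrable.mono' ((integrableOn_cmp hα0 hT).const_mul C) hm.aestronglyMeasurable ?_
      refine (hle T hT).mono fun t ht => ?_
      rwa [Real.norm_of_nonneg (mul_nonneg (norm_nonneg _) (itInt_norm_nonneg _ _ _))]
    · intro T h0 hT
      rw [itInt, ← integral_cmp hα0 h0 hT, ← integral_const_mul]
      exact integral_mono_of_nonneg (.of_forall fun t =>
        mul_nonneg (norm_nonneg _) (itInt_norm_nonneg _ _ _))
          ((integrableOn_cmp hα0 hT).const_mul C) (hle T hT)

omit hL in
lemma integrableOn_one_sub_rpow :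
    IntegrableOn (fun t : ℝ => (1 - t) ^ (-(1 / 2) : ℝ)) (Set.Ioo 0 1) := by
  have h := (intervalIntegral.intervalIntegrable_rpow' (a := 0) (b := 1)
    (r := (-(1 / 2) : ℝ)) (by norm_num)).comp_sub_left 1
  rw [sub_zero, sub_self] at h
  exact (intervalIntegrable_iff_integrableOn_Ioo_of_le zero_le_one).1 h.symm

lemma itGood_one {v : List ℕ} (hv : Adm v) (h : v.head? ≠ some 1) : ItGood (ker L) v 1 := by
  rcases v with _ | ⟨k, v⟩
  · trivial
  have hk1 : k ≠ 1 := by simpa using h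
  obtain ⟨C, hC, hk⟩ := exists_norm_ker_le hL k
  have hm : StronglyMeasurable fun t => ‖ker L k t‖ * itInt (fun k t => ‖ker L k t‖) v t :=
    (stronglyMeasurable_ker hL k).norm.mul
      (stronglyMeasurable_itInt (fun k => (stronglyMeasurable_ker hL k).norm) v)
  obtain ⟨h1, h2⟩ := itGood_and_le hL hv.2 (α := 1 / 2) (by norm_num) (by norm_num)
  have h3 : ∃ C' : ℝ, 0 ≤ C' ∧ ∀ t ∈ Set.Ioo (0 : ℝ) 1,
      itInt (fun k t => ‖ker L k t‖) v t ≤ C' * (1 - t) ^ (-(1 / 2) : ℝ) := by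
    by_cases hne : v = []
    · refine ⟨1, zero_le_one, fun t ht => ?_⟩
      rw [hne, itInt, one_mul]
      exact Real.one_le_rpow_of_pos_of_le_one_of_nonpos (sub_pos.2 ht.2) (by linarith [ht.1])
        (by norm_num)
    · obtain ⟨C', hC', h'⟩ := h2 hne
      refine ⟨C', hC', fun t ht => (h' t ht.1 ht.2).trans (mul_le_mul_of_nonneg_left ?_ hC')⟩
      have h4 := sub_pos.2 ht.2
      rw [cmp, Real.rpow_neg h4.le, ← Real.inv_rpow h4.le]
      refine Real.rpow_le_rpow (div_nonneg ht.1.le h4.le) ?_ (by norm_num)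
      rw [div_eq_mul_inv]
      exact mul_le_of_le_one_left (inv_nonneg.2 h4.le) ht.2.le
  obtain ⟨C', hC', h3⟩ := h3
  refine ⟨fun t ht => h1 t ht.2, Integrable.mono' (integrableOn_one_sub_rpow.const_mul (C * C'))
    hm.aestronglyMeasurable ?_⟩
  refine (ae_restrict_mem measurableSet_Ioo).mono fun t ht => ?_
  rw [Real.norm_of_nonneg (mul_nonneg (norm_nonneg _) (itInt_norm_nonneg _ _ _)), mul_assoc]
  exact mul_le_mul ((hk t ht.1 ht.2).2 hk1) (h3 t ht) (itInt_norm_nonneg _ _ _) hC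

end bounds

end EllMZV

namespace EllMZV

section limit

variable {L : ℂ} (hL : L.re < 0)

include hL

lemma ev_itS {v : List ℕ} (hv : Adm v) {t : ℝ} (h0 : 0 < t) (h1 : t < 1) :
    ev L (itS v) t = itInt (ker L) v t := by
  induction v generalizing t with
  | nil => rw [itS, itInt, ev_one]
  | cons n v ih =>
    have hS := strong_itS hv
    have hk : PB (itS v) := (strong_itS hv.2).1.pb
    have hD : PB (derD (itS (n :: v))) := by
      rw [derD_itS_cons]
      exact (pb_kerW n).mul hk
    have hd : ∀ u ∈ Set.Ioo 0 t,
        HasDerivAt (ev L (itS (n :: v))) (ker L n u * itInt (ker L) v u) u := fun u hu => by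
      have hu1 : u < 1 := hu.2.trans h1
      refine (hasDerivAt_ev hS.1.pb hD hL hu.1 hu1).congr_deriv ?_
      rw [derD_itS_cons, ev_mul (pb_kerW n) hk hL hu.1 hu1, ih hv.2 hu.1 hu1,
        ker_of_mem L n hu.1 hu1, mul_assoc]
    have hi : IntegrableOn (fun t => ker L n t * itInt (ker L) v t) (Set.Ioo 0 t) :=
      ItGood.integrableOn (stronglyMeasurable_ker hL)
        ((itGood_and_le hL hv one_half_pos (by norm_num)).1 t h1)
    have h := intervalIntegral.integral_eq_sub_of_hasDerivAt_of_tendsto h0 hd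
      ((intervalIntegrable_iff_integrableOn_Ioo_of_le h0.le).2 hi)
      (hS.1.tendsto_ev (hS.2 (List.cons_ne_nil _ _)) hL)
      ((hasDerivAt_ev hS.1.pb hD hL h0 h1).continuousAt.mono_left nhdsWithin_le_nhds)
    rw [itInt, ← integral_Ioc_eq_integral_Ioo, ← intervalIntegral.integral_of_le h0.le, h, sub_zero]

lemma tendsto_itInt {v : List ℕ} (hv : Adm v) (h : v.head? ≠ some 1) :
    Tendsto (itInt (ker L) v) (𝓝[<] 1) (𝓝 (itInt (ker L) v 1)) := by
  rcases v with _ | ⟨n, v⟩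
  · exact tendsto_const_nhds
  have hi : IntegrableOn (fun t => ker L n t * itInt (ker L) v t) (Set.Icc 0 1) := by
    rw [integrableOn_Icc_iff_integrableOn_Ioo]
    exact ItGood.integrableOn (stronglyMeasurable_ker hL) (itGood_one hL hv h)
  have hc := intervalIntegral.continuousOn_primitive hi
  have h1 := (hc 1 (Set.right_mem_Icc.2 zero_le_one)).mono Set.Ioo_subset_Icc_self
  have h2 : Tendsto _ (𝓝[Set.Ioo 0 1] (1 : ℝ)) (𝓝 _) := h1
  simp only [integral_Ioc_eq_integral_Ioo] at h2
  rwa [nhdsWithin_Ioo_eq_nhdsLT zero_lt_one] at h2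

omit hL in
lemma pb_itR {u : List ℕ} (hu : Adm u) : PB (itR u) := (strong_itS hu).1.pb.sig.smul _

omit hL in
lemma pb_pathS {u v : List ℕ} (hu : Adm u) (hv : Adm v) (h : u = [] → v.head? ≠ some 1) :
    PB (pathS u v) := by
  induction v generalizing u with
  | nil => exact pb_itR hu
  | cons n v ih =>
    exact ((pb_itR hu).mul (strong_itS hv).1.pb).add
      (ih ⟨fun hn hu' => by simp [hu', hn] at h, hu⟩ hv.2 (by simp))

omit hL in
lemma ev_itR (u : List ℕ) (t : ℝ) :
    ev L (itR u) t = (-1) ^ u.sum * ev L (itS u) (1 - t) := by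
  rw [itR, ev_smul, ev_sig]

lemma exists_norm_ev_itS_le {v : List ℕ} (hv : Adm v) (hne : v ≠ []) {α : ℝ} (h0 : 0 < α)
    (h1 : α ≤ 1) : ∃ C : ℝ, 0 ≤ C ∧ ∀ t : ℝ, 0 < t → t < 1 → ‖ev L (itS v) t‖ ≤ C * cmp α t := by
  obtain ⟨hg, h⟩ := itGood_and_le hL hv h0 h1
  obtain ⟨C, hC, h⟩ := h hne
  refine ⟨C, hC, fun t ht0 ht1 => ?_⟩
  rw [ev_itS hL hv ht0 ht1]
  exact (norm_itInt_le (hg t ht1)).trans (h t ht0 ht1)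

lemma exists_norm_ev_itR_le {u : List ℕ} (hu : Adm u) (hne : u ≠ []) : ∃ C : ℝ, 0 ≤ C ∧
    ∀ t : ℝ, 0 < t → t < 1 → ‖ev L (itR u) t‖ ≤ C * cmp (1 / 2) (1 - t) := by
  obtain ⟨C, hC, h⟩ := exists_norm_ev_itS_le hL hu hne (α := 1 / 2) (by norm_num) (by norm_num)
  refine ⟨C, hC, fun t h0 h1 => ?_⟩
  rw [ev_itR, norm_mul, norm_pow, norm_neg, norm_one, one_pow, one_mul]
  exact h (1 - t) (sub_pos.2 h1) (by linarith)

omit hL in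
lemma tendsto_cmp_one_sub {α : ℝ} (hα : 0 < α) :
    Tendsto (fun t => cmp α (1 - t)) (𝓝[<] 1) (𝓝 0) := by
  have h : ContinuousAt (fun t : ℝ => cmp α (1 - t)) 1 := by
    refine ContinuousAt.rpow_const (ContinuousAt.div (by fun_prop) (by fun_prop) (by norm_num))
      (Or.inr hα.le)
  have h2 := h.tendsto.mono_left (nhdsWithin_le_nhds (s := Set.Iio 1))
  rwa [sub_self, cmp_zero hα] at h2

omit hL in
lemma cmp_one_sub_mul {α β : ℝ} {t : ℝ} (h0 : 0 < t) (h1 : t < 1) :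
    cmp (α + β) (1 - t) * cmp β t = cmp α (1 - t) := by
  have h2 := sub_pos.2 h1
  rw [cmp, cmp, cmp, sub_sub_cancel, Real.rpow_add (div_pos h2 h0), mul_assoc,
    ← Real.mul_rpow (div_pos h2 h0).le (div_pos h0 h2).le, div_mul_div_cancel₀ h0.ne',
    div_self h2.ne', Real.one_rpow, mul_one]

lemma tendsto_ev_itR {u : List ℕ} (hu : Adm u) (hne : u ≠ []) :
    Tendsto (ev L (itR u)) (𝓝[<] 1) (𝓝 0) := by
  obtain ⟨C, hC, h⟩ := exists_norm_ev_itR_le hL hu hne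
  have hlim : Tendsto (fun t => C * cmp (1 / 2) (1 - t)) (𝓝[<] 1) (𝓝 0) := by
    simpa only [mul_zero] using (tendsto_cmp_one_sub one_half_pos).const_mul C
  refine squeeze_zero_norm' ?_ hlim
  filter_upwards [Ioo_mem_nhdsLT zero_lt_one] with t ht using h t ht.1 ht.2

lemma tendsto_ev_itR_mul {u v : List ℕ} (hu : Adm u) (hv : Adm v) (hue : u ≠ []) (hve : v ≠ []) :
    Tendsto (ev L (itR u * itS v)) (𝓝[<] 1) (𝓝 0) := by
  obtain ⟨C, hC, h⟩ := exists_norm_ev_itR_le hL hu hue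
  obtain ⟨C', hC', h'⟩ := exists_norm_ev_itS_le hL hv hve (α := 1 / 4) (by norm_num) (by norm_num)
  have hlim : Tendsto (fun t => C * C' * cmp (1 / 4) (1 - t)) (𝓝[<] 1) (𝓝 0) := by
    simpa using (tendsto_cmp_one_sub (α := 1 / 4) (by norm_num)).const_mul (C * C')
  refine squeeze_zero_norm' ?_ hlim
  filter_upwards [Ioo_mem_nhdsLT zero_lt_one] with t ht
  rw [ev_mul (pb_itR hu) (strong_itS hv).1.pb hL ht.1 ht.2, norm_mul,
    ← cmp_one_sub_mul (α := 1 / 4) (β := 1 / 4) ht.1 ht.2, mul_mul_mul_comm]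
  refine mul_le_mul ((h t ht.1 ht.2).trans_eq ?_) (h' t ht.1 ht.2) (norm_nonneg _)
    (mul_nonneg hC (cmp_nonneg _ (sub_pos.2 ht.2) (by linarith [ht.1])))
  norm_num

lemma tendsto_ev_pathS {u v : List ℕ} (hu : Adm u) (hv : Adm v) (hne : u ≠ []) :
    Tendsto (ev L (pathS u v)) (𝓝[<] 1) (𝓝 0) := by
  induction v generalizing u with
  | nil => exact tendsto_ev_itR hL hu hne
  | cons n v ih =>
    have hu' : Adm (n :: u) := ⟨fun _ => hne, hu⟩
    have h := (tendsto_ev_itR_mul hL hu hv hne (List.cons_ne_nil n v)).add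
      (ih hu' hv.2 (List.cons_ne_nil _ _))
    rw [add_zero] at h
    refine h.congr' ?_
    filter_upwards [Ioo_mem_nhdsLT zero_lt_one] with t ht
    rw [pathS, ev_add ((pb_itR hu).mul (strong_itS hv).1.pb)
      (pb_pathS hu' hv.2 (by simp)) hL ht.1 ht.2]

lemma tendsto_ev_pathS_nil {v : List ℕ} (hv : Adm v) (h : v.head? ≠ some 1) :
    Tendsto (ev L (pathS [] v)) (𝓝[<] 1) (𝓝 (itInt (ker L) v 1)) := by
  rcases v with _ | ⟨n, v⟩
  · rw [pathS, itR_nil, itInt, show ev L 1 = fun _ => 1 from funext (ev_one L)]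
    exact tendsto_const_nhds
  have hn : Adm [n] := ⟨fun hn => by simp [hn] at h, trivial⟩
  have h3 := (tendsto_itInt hL hv h).add (tendsto_ev_pathS hL hn hv.2 (List.cons_ne_nil _ _))
  rw [add_zero] at h3
  refine h3.congr' ?_
  filter_upwards [Ioo_mem_nhdsLT zero_lt_one] with t ht
  rw [pathS, itR_nil, one_mul, ev_add (strong_itS hv).1.pb (pb_pathS hn hv.2 (by simp)) hL
    ht.1 ht.2, ev_itS hL hv ht.1 ht.2]

omit hL in
lemma tm_pathS_diag {v : List ℕ} (hv : Adm v) (h : v.head? ≠ some 1) (hne : v ≠ []) (t : ℝ)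
    (j : ℕ) : tm L (pathS [] v) t (j, j) =
      (∑ b ∈ Finset.Icc 1 (v.sum + v.length), dcoef v j b * L ^ b) * Complex.exp L ^ j := by
  rw [tm, evLP_pathS hv h hne, if_pos rfl, ← mul_pow, ← Complex.exp_add, ← mul_add,
    add_sub_cancel, mul_one]

/-- The `q`-expansion of the full iterated integral. -/
theorem summable_and_hasSum_itInt {v : List ℕ} (hv : Adm v) (h : v.head? ≠ some 1) (hne : v ≠ []) :
    (Summable fun j : ℕ => ‖(∑ b ∈ Finset.Icc 1 (v.sum + v.length), dcoef v j b * L ^ b) *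
      Complex.exp L ^ j‖) ∧
    HasSum (fun j : ℕ => (∑ b ∈ Finset.Icc 1 (v.sum + v.length), dcoef v j b * L ^ b) *
      Complex.exp L ^ j) (itInt (ker L) v 1) := by
  have hpb := pb_pathS (u := []) trivial hv fun _ => h
  have hinj : Function.Injective fun j : ℕ => (j, j) := fun a b hab => congrArg Prod.fst hab
  have hs : Summable fun j : ℕ => ‖(∑ b ∈ Finset.Icc 1 (v.sum + v.length), dcoef v j b * L ^ b) *
      Complex.exp L ^ j‖ := by
    refine ((hpb.summable hL one_half_pos one_half_lt_one).comp_injective hinj).congr fun j => ?_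
    rw [Function.comp_apply, tm_pathS_diag hv h hne]
  refine ⟨hs, ?_⟩
  have hev : ∀ t : ℝ, ev L (pathS [] v) t =
      ∑' j : ℕ, (∑ b ∈ Finset.Icc 1 (v.sum + v.length), dcoef v j b * L ^ b) *
        Complex.exp L ^ j := fun t => by
    rw [ev, ← hinj.tsum_eq]
    · exact tsum_congr fun j => tm_pathS_diag hv h hne t j
    · rintro ⟨m, n⟩ hp
      by_contra hmn
      refine hp ?_
      rw [tm, evLP_pathS hv h hne, if_neg, zero_mul]
      exact fun hmn' => hmn ⟨m, Prod.ext rfl hmn'⟩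
  have hlim := tendsto_ev_pathS_nil hL hv h
  rw [funext hev] at hlim
  rw [tendsto_nhds_unique hlim tendsto_const_nhds]
  exact hs.of_norm.hasSum

end limit

end EllMZV

namespace EllMZV

lemma adm_of_getLast? {v : List ℕ} (h : v.getLast? ≠ some 1) : Adm v := by
  induction v with
  | nil => trivial
  | cons n v ih =>
    rcases v with _ | ⟨m, v⟩
    · exact ⟨fun hn => by simp [hn] at h, trivial⟩
    · exact ⟨fun _ => List.cons_ne_nil _ _, ih (by rwa [List.getLast?_cons_cons] at h)⟩

lemma zpow_two_pi_I_mem (k : ℤ) : (2 * ↑π * Complex.I : ℂ) ^ k ∈ mzvTwoPiIAlgebra := by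
  have h1 : (2 * ↑π * Complex.I : ℂ) ∈ mzvTwoPiIAlgebra :=
    Algebra.subset_adjoin (Or.inr (Or.inl rfl))
  have h2 : (2 * ↑π * Complex.I : ℂ)⁻¹ ∈ mzvTwoPiIAlgebra :=
    Algebra.subset_adjoin (Or.inr (Or.inr rfl))
  rcases k with k | k
  · rw [Int.ofNat_eq_natCast, zpow_natCast]
    exact pow_mem h1 k
  · rw [zpow_negSucc, ← inv_pow]
    exact pow_mem h2 _

lemma prod_omKr_eq {r : ℕ} (n : Fin r → ℕ) {τ : ℂ} (hτ : 0 < τ.im) {t : Fin r → ℝ}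
    (ht : t ∈ openSimplex r) : ∏ i, omKr (n i) (τ * ((t i : ℝ) : ℂ)) τ =
      (2 * ↑π * Complex.I) ^ r * ((2 * ↑π * Complex.I * τ) ^ (∑ i, n i + r))⁻¹ *
        ∏ i, ker (2 * ↑π * Complex.I * τ) (n i) (t i) := by
  have hL := two_pi_I_mul_re hτ
  set L := 2 * ↑π * Complex.I * τ with hLdef
  have hL0 : L ≠ 0 := fun h => by simp [h] at hL
  have h : ∀ i, omKr (n i) (τ * ((t i : ℝ) : ℂ)) τ =
      2 * ↑π * Complex.I * ((L ^ n i)⁻¹ * L⁻¹) * ker L (n i) (t i) := fun i => by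
    rw [omKr_eq_ev hτ (ht.1 i).1 (ht.1 i).2, ker_of_mem _ _ (ht.1 i).1 (ht.1 i).2, ← hLdef]
    field_simp
  rw [Finset.prod_congr rfl fun i _ => h i]
  simp only [Finset.prod_mul_distrib, Finset.prod_inv_distrib, Finset.prod_pow_eq_pow_sum,
    Finset.prod_const, Finset.card_univ, Fintype.card_fin, pow_add, mul_inv, mul_pow]

lemma measurableSet_openSimplex (r : ℕ) : MeasurableSet (openSimplex r) :=
  measurableSet_simplexTo r 1

lemma integrableOn_prod_omKr {r : ℕ} {n : Fin r → ℕ} (hv : Adm (List.ofFn n))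
    (h : (List.ofFn n).head? ≠ some 1) {τ : ℂ} (hτ : 0 < τ.im) :
    IntegrableOn (fun t : Fin r → ℝ => ∏ i, omKr (n i) (τ * ((t i : ℝ) : ℂ)) τ)
      (openSimplex r) := by
  have hL := two_pi_I_mul_re hτ
  exact IntegrableOn.congr_fun ((simplex_itInt (stronglyMeasurable_ker hL) n
    (itGood_one hL hv h)).1.const_mul _) (fun t ht => (prod_omKr_eq n hτ ht).symm)
      (measurableSet_openSimplex r)

lemma bell_eq {r : ℕ} {n : Fin r → ℕ} (hv : Adm (List.ofFn n))
    (h : (List.ofFn n).head? ≠ some 1) {τ : ℂ} (hτ : 0 < τ.im) :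
    Bell n τ = τ ^ (∑ i, n i) * ((2 * ↑π * Complex.I) ^ r *
      ((2 * ↑π * Complex.I * τ) ^ (∑ i, n i + r))⁻¹ *
        itInt (ker (2 * ↑π * Complex.I * τ)) (List.ofFn n) 1) := by
  have hL := two_pi_I_mul_re hτ
  rw [Bell, setIntegral_congr_fun (measurableSet_openSimplex r)
    fun t ht => prod_omKr_eq n hτ ht, integral_const_mul]
  exact congrArg _ (congrArg _ (simplex_itInt (stronglyMeasurable_ker hL) n
    (itGood_one hL hv h)).2.1)

/-- The coefficients of the expansion of `Bell n`. -/
noncomputable def bcoef {r : ℕ} (n : Fin r → ℕ) (j : ℕ) (i : ℤ) : ℂ :=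
  (2 * ↑π * Complex.I) ^ (i + r - (∑ i, n i : ℕ)) * dcoef (List.ofFn n) j (i + r).toNat

lemma sum_bcoef {r : ℕ} (n : Fin r → ℕ) {τ : ℂ} (hτ : τ ≠ 0) (q : ℂ) (j : ℕ) :
    ∑ i ∈ Finset.Icc (1 - (r : ℤ)) ((∑ i, n i : ℕ) : ℤ), bcoef n j i * τ ^ i * q ^ j =
      τ ^ (∑ i, n i) * ((2 * ↑π * Complex.I) ^ r *
        ((2 * ↑π * Complex.I * τ) ^ (∑ i, n i + r))⁻¹ *
          ((∑ b ∈ Finset.Icc 1 (∑ i, n i + r), dcoef (List.ofFn n) j b *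
            (2 * ↑π * Complex.I * τ) ^ b) * q ^ j)) := by
  rw [Finset.sum_mul, Finset.mul_sum, Finset.mul_sum]
  refine Finset.sum_nbij' (fun i => (i + r).toNat) (fun b => (b : ℤ) - r) ?_ ?_ ?_ ?_ ?_
  · intro i hi
    rw [Finset.mem_Icc] at *
    omega
  · intro b hb
    rw [Finset.mem_Icc] at *
    omega
  · intro i hi
    rw [Finset.mem_Icc] at hi
    omega
  · intro b _
    omega
  · intro i hi
    obtain ⟨b, hb⟩ : ∃ b : ℕ, i + r = b := ⟨(i + r).toNat, by rw [Finset.mem_Icc] at hi; omega⟩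
    have hi' : i = b - r := by omega
    have h0 : (2 * ↑π * Complex.I : ℂ) ≠ 0 := Complex.two_pi_I_ne_zero
    rw [bcoef, hb, Int.toNat_natCast, hi', zpow_sub₀ h0, zpow_sub₀ hτ]
    simp only [zpow_natCast, mul_pow _ τ]
    field_simp
    ring

end EllMZV

/-- For an admissible tuple (first and last entry `≠ 1`), the iterated integral
defining `B(n₁,…,n_r;τ)` converges absolutely for every `τ ∈ ℍ`, and
`B(n₁,…,n_r;τ) = Σ_{j≥0} Σ_{i=1−r}^{w} b_{i,j} τ^i q^j` with coefficients `b_{i,j}` in the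
`ℚ`-algebra generated by multiple zeta values, `2πi` and `(2πi)⁻¹`, the series converging
absolutely. -/
theorem Bell_expansion (r : ℕ) (hr : 1 ≤ r) (n : Fin r → ℕ)
    (h1 : n ⟨0, hr⟩ ≠ 1) (h2 : n ⟨r - 1, by omega⟩ ≠ 1) :
    (∀ τ : ℂ, 0 < τ.im →
      MeasureTheory.IntegrableOn
        (fun t : Fin r → ℝ => ∏ i, omKr (n i) (τ * ((t i : ℝ) : ℂ)) τ)
        (openSimplex r) MeasureTheory.volume) ∧
    ∃ b : ℕ → ℤ → ℂ,
      (∀ j i, b j i ∈ mzvTwoPiIAlgebra) ∧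
      ∀ τ : ℂ, 0 < τ.im →
        Summable (fun j : ℕ =>
          ‖∑ i ∈ Finset.Icc (1 - (r : ℤ)) ((∑ i, n i : ℕ) : ℤ),
              b j i * τ ^ i * Complex.exp (2 * ↑π * Complex.I * τ) ^ j‖) ∧
        HasSum (fun j : ℕ =>
            ∑ i ∈ Finset.Icc (1 - (r : ℤ)) ((∑ i, n i : ℕ) : ℤ),
              b j i * τ ^ i * Complex.exp (2 * ↑π * Complex.I * τ) ^ j)
          (Bell n τ) := by
  have hhead : (List.ofFn n).head? ≠ some 1 := by
    rw [List.head?_eq_getElem?, List.getElem?_ofFn, dif_pos (Nat.zero_lt_of_lt hr)]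
    simpa using h1
  have hlast : (List.ofFn n).getLast? ≠ some 1 := by
    rw [List.getLast?_eq_getElem?, List.length_ofFn, List.getElem?_ofFn, dif_pos (by omega)]
    simpa using h2
  have hv := EllMZV.adm_of_getLast? hlast
  have hne : List.ofFn n ≠ [] := by
    rw [Ne, List.ofFn_eq_nil_iff]
    omega
  refine ⟨fun τ hτ => EllMZV.integrableOn_prod_omKr hv hhead hτ, EllMZV.bcoef n,
    fun j i => mul_mem (EllMZV.zpow_two_pi_I_mem _) (EllMZV.dcoef_mem hv hhead j _),
    fun τ hτ => ?_⟩
  have hτ0 : τ ≠ 0 := fun h => by simp [h] at hτ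
  obtain ⟨hs, hsum⟩ := EllMZV.summable_and_hasSum_itInt (EllMZV.two_pi_I_mul_re hτ) hv hhead hne
  rw [List.sum_ofFn, List.length_ofFn] at hs hsum
  simp only [EllMZV.sum_bcoef n hτ0]
  refine ⟨?_, ?_⟩
  · simpa only [norm_mul, mul_assoc] using (hs.mul_left
      ‖(2 * ↑π * Complex.I) ^ r * ((2 * ↑π * Complex.I * τ) ^ (∑ i, n i + r))⁻¹‖).mul_left
        ‖τ ^ (∑ i, n i)‖
  · rw [EllMZV.bell_eq hv hhead hτ]
    exact (hsum.mul_left _).mul_left _
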